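/- Let P₁, P₂ : ℝ → ℝ be polynomials with 1 ≤ deg P₁ < deg P₂ = d₂ and P₁(0) = P₂(0) = 0. Then there exists c > 0 depending only on P₁ and P₂ such that for every ε > 0 there is δ > 0 with δ ≥ exp(−exp(c·ε^{−6})) and the following property: for every real N > 1 and every measurable function f : ℝ → ℝ with support contained in [0, N], 0 ≤ f ≤ 1, and ∫₀^N f ≥ εN, one has ∫₀^N ∫₀^{N^{1/d₂}} f(x) · f(x + P₁(t)) · f(x + P₂(t)) dt dx > δ · N^{1 + 1/d₂}. -/

import Mathlib

open MeasureTheory Polynomial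

/-- `f` is differentiable, and `A` bounds both `f` and its derivative. -/
structure BddC1 {V : Type*} [NormedAddCommGroup V] [NormedSpace ℝ V] (f : V → ℝ) (A : ℝ) :
    Prop where
  diff : Differentiable ℝ f
  bound : ∀ x, |f x| ≤ A
  fderiv_bound : ∀ x, ‖fderiv ℝ f x‖ ≤ A

namespace BddC1

variable {V : Type*} [NormedAddCommGroup V] [NormedSpace ℝ V] {f g : V → ℝ} {A B : ℝ}

lemma nonneg (hf : BddC1 f A) : 0 ≤ A := (abs_nonneg _).trans (hf.bound 0)

lemma mono (hf : BddC1 f A) (h : A ≤ B) : BddC1 f B :=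
  ⟨hf.diff, fun x => (hf.bound x).trans h, fun x => (hf.fderiv_bound x).trans h⟩

lemma mul (hf : BddC1 f A) (hg : BddC1 g B) : BddC1 (fun x => f x * g x) (2 * A * B) := by
  have hA := hf.nonneg
  have hB := hg.nonneg
  refine ⟨hf.diff.mul hg.diff, fun x => ?_, fun x => ?_⟩
  · rw [abs_mul]
    have := mul_le_mul (hf.bound x) (hg.bound x) (abs_nonneg _) hA
    nlinarith [mul_nonneg hA hB]
  · rw [fderiv_fun_mul (hf.diff x) (hg.diff x)]
    refine (norm_add_le _ _).trans ?_
    rw [norm_smul, norm_smul, Real.norm_eq_abs, Real.norm_eq_abs]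
    have h1 := mul_le_mul (hf.bound x) (hg.fderiv_bound x) (norm_nonneg _) hA
    have h2 := mul_le_mul (hg.bound x) (hf.fderiv_bound x) (norm_nonneg _) hB
    linarith

lemma sub (hf : BddC1 f A) (hg : BddC1 g B) : BddC1 (fun x => f x - g x) (A + B) := by
  refine ⟨hf.diff.sub hg.diff, fun x => ?_, fun x => ?_⟩
  · exact (abs_sub _ _).trans (add_le_add (hf.bound x) (hg.bound x))
  · rw [fderiv_fun_sub (hf.diff x) (hg.diff x)]
    exact (norm_sub_le _ _).trans (add_le_add (hf.fderiv_bound x) (hg.fderiv_bound x))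

lemma neg (hf : BddC1 f A) : BddC1 (fun x => -f x) A := by
  refine ⟨hf.diff.neg, fun x => ?_, fun x => ?_⟩
  · rw [abs_neg]; exact hf.bound x
  · rw [fderiv_fun_neg, norm_neg]; exact hf.fderiv_bound x

lemma const_mul (hf : BddC1 f A) {c : ℝ} (hc : |c| ≤ 1) : BddC1 (fun x => c * f x) A := by
  refine ⟨hf.diff.const_mul c, fun x => ?_, fun x => ?_⟩
  · rw [abs_mul]
    exact (mul_le_of_le_one_left (abs_nonneg _) hc).trans (hf.bound x)
  · rw [fderiv_const_mul (hf.diff x), norm_smul, Real.norm_eq_abs]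
    exact (mul_le_of_le_one_left (norm_nonneg _) hc).trans (hf.fderiv_bound x)

lemma scalar_comp {h h' : ℝ → ℝ} {C D : ℝ} (hf : BddC1 f A) (hh : ∀ y, HasDerivAt h (h' y) y)
    (hC : ∀ y, |h y| ≤ C) (hD : ∀ y, |h' y| ≤ D) (hCB : C ≤ B) (hDB : D * A ≤ B) :
    BddC1 (fun x => h (f x)) B := by
  have key : ∀ x, HasFDerivAt (fun x => h (f x)) (h' (f x) • fderiv ℝ f x) x := fun x =>
    (hh (f x)).comp_hasFDerivAt x (hf.diff x).hasFDerivAt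
  refine ⟨fun x => (key x).differentiableAt, fun x => (hC _).trans hCB, fun x => ?_⟩
  rw [(key x).fderiv, norm_smul, Real.norm_eq_abs]
  exact (mul_le_mul (hD _) (hf.fderiv_bound x) (norm_nonneg _)
    ((abs_nonneg _).trans (hD 0))).trans hDB

lemma of_hasDerivAt {h h' : ℝ → ℝ} {C : ℝ} (hh : ∀ y, HasDerivAt h (h' y) y)
    (hC : ∀ y, |h y| ≤ C) (hD : ∀ y, |h' y| ≤ C) : BddC1 h C := by
  refine ⟨fun x => (hh x).differentiableAt, hC, fun x => ?_⟩
  rw [← norm_deriv_eq_norm_fderiv, (hh x).deriv]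
  exact hD x

lemma comp_clm {h : ℝ → ℝ} {C : ℝ} (hh : BddC1 h C) (φ : V →L[ℝ] ℝ) {c : ℝ} (hc : 1 ≤ c)
    (hφ : ∀ v, ‖φ v‖ ≤ c * ‖v‖) : BddC1 (fun x => h (φ x)) (c * C) := by
  have key : ∀ x, HasFDerivAt (fun x => h (φ x)) ((fderiv ℝ h (φ x)).comp φ) x := fun x =>
    (hh.diff (φ x)).hasFDerivAt.comp x φ.hasFDerivAt
  refine ⟨fun x => (key x).differentiableAt, fun x => ?_, fun x => ?_⟩
  · have := hh.bound (φ x)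
    have := hh.nonneg
    nlinarith
  · rw [(key x).fderiv]
    refine (ContinuousLinearMap.opNorm_comp_le _ _).trans ?_
    have h1 : ‖φ‖ ≤ c := φ.opNorm_le_bound (by linarith) hφ
    rw [mul_comm]
    exact mul_le_mul h1 (hh.fderiv_bound _) (norm_nonneg _) (by linarith)

end BddC1

lemma integrable_of_bounded_support {α : Type*} [MeasurableSpace α] {μ : Measure α} {f : α → ℝ}
    {S : Set α} {C : ℝ} (hf : AEStronglyMeasurable f μ) (hS : μ S < ⊤)
    (hsupp : ∀ x, x ∉ S → f x = 0) (hb : ∀ x, |f x| ≤ C) : Integrable f μ := by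
  have h1 : IntegrableOn f S μ := by
    refine Measure.integrableOn_of_bounded (M := C) hS.ne hf ?_
    exact Filter.Eventually.of_forall hb
  refine (integrableOn_iff_integrable_of_support_subset ?_).1 h1
  intro x hx
  by_contra h
  exact hx (hsupp x h)

lemma abs_integral_le_of_bounded_support {α : Type*} [MeasurableSpace α] {μ : Measure α}
    {f : α → ℝ} {S : Set α} {C : ℝ} (hS : μ S < ⊤)
    (hsupp : ∀ x, x ∉ S → f x = 0) (hb : ∀ x, |f x| ≤ C) : |∫ x, f x ∂μ| ≤ C * μ.real S := by
  rw [← setIntegral_eq_integral_of_forall_compl_eq_zero hsupp]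
  exact norm_setIntegral_le_of_norm_le_const (f := f) hS fun x _ => hb x

/-- A `C¹` bump function supported on `[-1, 1]`. -/
noncomputable def bump (y : ℝ) : ℝ := (max 0 (1 - y ^ 2)) ^ 2

lemma hasDerivAt_max_zero_sq (y : ℝ) :
    HasDerivAt (fun y : ℝ => (max 0 y) ^ 2) (2 * max 0 y) y := by
  rcases lt_trichotomy y 0 with h | h | h
  · rw [max_eq_left h.le, mul_zero]
    refine (hasDerivAt_const y (0 : ℝ)).congr_of_eventuallyEq ?_
    filter_upwards [Iio_mem_nhds h] with z hz
    simp [max_eq_left (le_of_lt (Set.mem_Iio.1 hz))]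
  · subst h
    rw [hasDerivAt_iff_isLittleO]
    simp only [max_self, sub_zero, mul_zero, smul_zero, ne_eq, OfNat.ofNat_ne_zero,
      not_false_eq_true, zero_pow]
    refine Asymptotics.IsBigO.trans_isLittleO (g := fun y : ℝ => y ^ 2) ?_ ?_
    · refine Asymptotics.IsBigO.of_bound 1 (Filter.Eventually.of_forall fun z => ?_)
      rw [one_mul, Real.norm_eq_abs, Real.norm_eq_abs, abs_pow, abs_pow]
      refine pow_le_pow_left₀ (abs_nonneg _) ?_ 2
      rcases le_total z 0 with hz | hz
      · simp [max_eq_left hz]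
      · simp [max_eq_right hz]
    · exact Asymptotics.isLittleO_pow_id one_lt_two
  · rw [max_eq_right h.le]
    have := hasDerivAt_pow 2 y
    simp only [Nat.cast_ofNat, Nat.add_one_sub_one, pow_one] at this
    refine this.congr_of_eventuallyEq ?_
    filter_upwards [Ioi_mem_nhds h] with z hz
    simp [max_eq_right (le_of_lt (Set.mem_Ioi.1 hz))]

lemma hasDerivAt_bump (y : ℝ) : HasDerivAt bump (-4 * y * max 0 (1 - y ^ 2)) y := by
  have h := (hasDerivAt_max_zero_sq (1 - y ^ 2)).comp y ((hasDerivAt_pow 2 y).const_sub 1)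
  refine h.congr_deriv ?_
  norm_num
  ring

lemma bump_nonneg (y : ℝ) : 0 ≤ bump y := sq_nonneg _

lemma bump_eq_zero {y : ℝ} (hy : 1 ≤ |y|) : bump y = 0 := by
  have : 1 ≤ y ^ 2 := by rw [← sq_abs]; nlinarith
  simp [bump, max_eq_left (show 1 - y ^ 2 ≤ 0 by linarith)]

lemma bump_le_one (y : ℝ) : bump y ≤ 1 := by
  have h1 : max 0 (1 - y ^ 2) ≤ 1 := max_le (by norm_num) (by nlinarith [sq_nonneg y])
  have h0 : 0 ≤ max 0 (1 - y ^ 2) := le_max_left _ _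
  unfold bump; nlinarith

lemma half_le_bump {y : ℝ} (hy : |y| ≤ 1 / 2) : 1 / 2 ≤ bump y := by
  have h : y ^ 2 ≤ 1 / 4 := by rw [← sq_abs]; nlinarith [abs_nonneg y]
  have h1 : 3 / 4 ≤ max 0 (1 - y ^ 2) := le_max_of_le_right (by linarith)
  unfold bump; nlinarith

lemma abs_deriv_bump_le (y : ℝ) : |-4 * y * max 0 (1 - y ^ 2)| ≤ 4 := by
  rcases le_or_gt 1 |y| with hy | hy
  · have : 1 ≤ y ^ 2 := by rw [← sq_abs]; nlinarith
    rw [max_eq_left (by linarith)]; norm_num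
  · have h1 : max 0 (1 - y ^ 2) ≤ 1 := max_le (by norm_num) (by nlinarith [sq_nonneg y])
    have h0 : 0 ≤ max 0 (1 - y ^ 2) := le_max_left _ _
    rw [abs_mul, abs_mul, abs_of_nonneg h0]
    norm_num
    nlinarith [abs_nonneg y]

/-- A `C¹` cutoff that is at least `1` on `[0, 1]` and vanishes outside `[-1, 2]`. -/
noncomputable def cutoff (x : ℝ) : ℝ := 2 * bump ((x - 1 / 2) / (3 / 2))

lemma cutoff_nonneg (x : ℝ) : 0 ≤ cutoff x := mul_nonneg zero_le_two (bump_nonneg _)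

lemma one_le_cutoff {x : ℝ} (hx : x ∈ Set.Icc (0 : ℝ) 1) : 1 ≤ cutoff x := by
  have := half_le_bump (y := (x - 1 / 2) / (3 / 2)) (by
    rw [abs_le]; constructor <;> [linarith [hx.1]; linarith [hx.2]])
  unfold cutoff; linarith

lemma cutoff_eq_zero {x : ℝ} (hx : x ∉ Set.Icc (-1 : ℝ) 2) : cutoff x = 0 := by
  have : 1 ≤ |(x - 1 / 2) / (3 / 2)| := by
    rw [le_abs]
    by_contra! h
    exact hx ⟨by linarith [h.2], by linarith [h.1]⟩
  rw [cutoff, bump_eq_zero this, mul_zero]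

lemma cutoff_le_two (x : ℝ) : cutoff x ≤ 2 := by
  have := bump_le_one ((x - 1 / 2) / (3 / 2))
  unfold cutoff; linarith

lemma bddC1_cutoff : BddC1 cutoff 6 := by
  refine BddC1.of_hasDerivAt (h' := fun x => 2 * ((-4 * ((x - 1 / 2) / (3 / 2)) *
    max 0 (1 - ((x - 1 / 2) / (3 / 2)) ^ 2)) * (1 / (3 / 2)))) (fun x => ?_) (fun x => ?_)
    (fun x => ?_)
  · have h2 : HasDerivAt (fun x : ℝ => (x - 1 / 2) / (3 / 2)) (1 / (3 / 2)) x :=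
      ((hasDerivAt_id x).sub_const _).div_const _
    exact ((hasDerivAt_bump _).comp x h2).const_mul 2
  · rw [abs_of_nonneg (cutoff_nonneg x)]
    linarith [cutoff_le_two x]
  · have := abs_deriv_bump_le ((x - 1 / 2) / (3 / 2))
    rw [abs_mul, abs_mul]
    norm_num at this ⊢
    linarith

lemma abs_hasDeriv_regularized_inv {κ : ℝ} (hκ : 0 < κ) (y : ℝ) :
    HasDerivAt (fun y => y / (y ^ 2 + κ ^ 2)) ((κ ^ 2 - y ^ 2) / (y ^ 2 + κ ^ 2) ^ 2) y ∧
    |y / (y ^ 2 + κ ^ 2)| ≤ κ⁻¹ ∧ |(κ ^ 2 - y ^ 2) / (y ^ 2 + κ ^ 2) ^ 2| ≤ (κ ^ 2)⁻¹ := by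
  have hpos : 0 < y ^ 2 + κ ^ 2 := by positivity
  refine ⟨?_, ?_, ?_⟩
  · have h := (hasDerivAt_id y).div ((hasDerivAt_pow 2 y).add_const (κ ^ 2)) hpos.ne'
    refine h.congr_deriv ?_
    simp only [id]
    congr 1
    norm_num
    ring
  · rw [abs_div, abs_of_pos hpos, div_le_iff₀ hpos, ← sq_abs y]
    have h : 2 * (|y| * κ) ≤ |y| ^ 2 + κ ^ 2 := by nlinarith [sq_nonneg (|y| - κ)]
    have h2 : |y| = κ⁻¹ * (|y| * κ) := by field_simp
    rw [h2]
    apply mul_le_mul_of_nonneg_left _ (by positivity)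
    rw [← h2]
    nlinarith [mul_nonneg (abs_nonneg y) hκ.le]
  · rw [abs_div, abs_of_pos (pow_pos hpos 2), div_le_iff₀ (pow_pos hpos 2)]
    have h1 : |κ ^ 2 - y ^ 2| ≤ y ^ 2 + κ ^ 2 := by
      rw [abs_le]; constructor <;> nlinarith [sq_nonneg y, sq_nonneg κ]
    refine h1.trans ?_
    rw [← div_eq_inv_mul, le_div_iff₀ (by positivity)]
    nlinarith [sq_nonneg y]

/-- Curve data at horizontal scale `s`: `q` has slope `s * p`, and `ν` is the slope of the level
curves of `(x, z) ↦ x + q (z - x)`, rescaled by `s`. -/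
structure CurveData (s M : ℝ) (q p ν : ℝ → ℝ) : Prop where
  s_pos : 0 < s
  s_le_one : s ≤ 1
  M_large : 6 ≤ M
  hasDerivAt : ∀ u, HasDerivAt q (s * p u) u
  p_bdd : BddC1 p M
  slope_bdd : BddC1 ν M
  slope_inv_bdd : BddC1 (fun u => (ν u)⁻¹) M
  slope_ne_zero : ∀ u, ν u ≠ 0
  slope_eq : ∀ u, p u = (1 - s * p u) * ν u

/-- A cutoff `w` supported on a set `U` where the curve is quantitatively curved. -/
structure CurvedCutoff (M : ℝ) (p ν w : ℝ → ℝ) (U : Set ℝ) : Prop where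
  bdd : BddC1 w M
  nonneg : ∀ u, 0 ≤ w u
  le_one : ∀ u, w u ≤ 1
  eq_zero : ∀ u, u ∉ U → w u = 0
  le_abs : ∀ u ∈ U, M⁻¹ ≤ |p u|
  curved : ∀ a ∈ U, ∀ b ∈ U, ∀ c ∈ U, ∀ d ∈ U, a + d = b + c →
    M⁻¹ * |b - a| * |c - a| ≤ |ν b * (ν a)⁻¹ - ν d * (ν c)⁻¹|

/-- Quadruples `((x₁, x₂), (z₁, z₂))`. -/
abbrev Quad := (ℝ × ℝ) × (ℝ × ℝ)

namespace Quad

/-- The coordinate `x₁`. -/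
def x₁ : Quad →L[ℝ] ℝ := (ContinuousLinearMap.fst ℝ ℝ ℝ).comp (ContinuousLinearMap.fst ℝ _ _)
/-- The coordinate `x₂`. -/
def x₂ : Quad →L[ℝ] ℝ := (ContinuousLinearMap.snd ℝ ℝ ℝ).comp (ContinuousLinearMap.fst ℝ _ _)
/-- The coordinate `z₁`. -/
def z₁ : Quad →L[ℝ] ℝ := (ContinuousLinearMap.fst ℝ ℝ ℝ).comp (ContinuousLinearMap.snd ℝ _ _)
/-- The coordinate `z₂`. -/
def z₂ : Quad →L[ℝ] ℝ := (ContinuousLinearMap.snd ℝ ℝ ℝ).comp (ContinuousLinearMap.snd ℝ _ _)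

@[simp] lemma x₁_apply (P : Quad) : x₁ P = P.1.1 := rfl
@[simp] lemma x₂_apply (P : Quad) : x₂ P = P.1.2 := rfl
@[simp] lemma z₁_apply (P : Quad) : z₁ P = P.2.1 := rfl
@[simp] lemma z₂_apply (P : Quad) : z₂ P = P.2.2 := rfl

lemma abs_coord_le (P : Quad) : |P.1.1| ≤ ‖P‖ ∧ |P.1.2| ≤ ‖P‖ ∧ |P.2.1| ≤ ‖P‖ ∧ |P.2.2| ≤ ‖P‖ := by
  simp only [Prod.norm_def, Real.norm_eq_abs]
  refine ⟨?_, ?_, ?_, ?_⟩ <;> simp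

/-- The box `[-1, 2]⁴`. -/
def box : Set Quad := (Set.Icc (-1) 2 ×ˢ Set.Icc (-1) 2) ×ˢ (Set.Icc (-1) 2 ×ˢ Set.Icc (-1) 2)

lemma volume_Icc_prod : (volume : Measure (ℝ × ℝ)) (Set.Icc (-1 : ℝ) 2 ×ˢ Set.Icc (-1 : ℝ) 2)
    = 9 := by
  rw [Measure.volume_eq_prod, Measure.prod_prod, Real.volume_Icc,
    ← ENNReal.ofReal_mul (by norm_num)]
  norm_num

lemma volume_box : (volume : Measure Quad) box = 81 := by
  rw [box, Measure.volume_eq_prod, Measure.prod_prod, volume_Icc_prod]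
  norm_num

/-- The product of the cutoffs of the four coordinates. -/
noncomputable def weight (P : Quad) : ℝ :=
  cutoff P.1.1 * cutoff P.1.2 * (cutoff P.2.1 * cutoff P.2.2)

lemma weight_nonneg (P : Quad) : 0 ≤ weight P := by
  have := cutoff_nonneg
  unfold weight
  have h1 := mul_nonneg (this P.1.1) (this P.1.2)
  have h2 := mul_nonneg (this P.2.1) (this P.2.2)
  exact mul_nonneg h1 h2

lemma weight_le (P : Quad) : weight P ≤ 16 := by
  have h0 := cutoff_nonneg
  have h2 := cutoff_le_two
  have h1 := mul_le_mul (h2 P.1.1) (h2 P.1.2) (h0 _) zero_le_two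
  have h3 := mul_le_mul (h2 P.2.1) (h2 P.2.2) (h0 _) zero_le_two
  have := mul_le_mul h1 h3 (mul_nonneg (h0 _) (h0 _)) (by norm_num)
  unfold weight
  linarith

lemma weight_eq_zero {P : Quad} (hP : P ∉ box) : weight P = 0 := by
  simp only [box, Set.mem_prod, not_and_or] at hP
  unfold weight
  rcases hP with (h | h) | (h | h) <;> simp [cutoff_eq_zero h]

/-- The product of the values of `w` at the four differences. -/
noncomputable def diffWeight (w : ℝ → ℝ) (P : Quad) : ℝ :=
  w (P.2.1 - P.1.1) * w (P.2.2 - P.1.1) * (w (P.2.1 - P.1.2) * w (P.2.2 - P.1.2))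

/-- The curvature determinant of a quadruple. -/
noncomputable def det (p ν : ℝ → ℝ) (P : Quad) : ℝ :=
  p (P.2.1 - P.1.1) * (ν (P.2.2 - P.1.1) * (ν (P.2.1 - P.1.1))⁻¹ -
    ν (P.2.2 - P.1.2) * (ν (P.2.1 - P.1.2))⁻¹)

/-- A density that inverts the determinant away from its zero set. -/
noncomputable def density (p ν w : ℝ → ℝ) (κ : ℝ) (P : Quad) : ℝ :=
  weight P * diffWeight w P * (det p ν P / (det p ν P ^ 2 + κ ^ 2))

variable {s M κ : ℝ} {q p ν w : ℝ → ℝ} {U : Set ℝ}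

lemma bddC1_diff {h : ℝ → ℝ} (hh : BddC1 h M) :
    BddC1 (fun P : Quad => h (P.2.1 - P.1.1)) (2 * M) ∧
    BddC1 (fun P : Quad => h (P.2.2 - P.1.1)) (2 * M) ∧
    BddC1 (fun P : Quad => h (P.2.1 - P.1.2)) (2 * M) ∧
    BddC1 (fun P : Quad => h (P.2.2 - P.1.2)) (2 * M) := by
  have key : ∀ φ : Quad →L[ℝ] ℝ, (∀ P, |φ P| ≤ 2 * ‖P‖) → BddC1 (fun P => h (φ P)) (2 * M) :=
    fun φ hφ => hh.comp_clm φ one_le_two hφ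
  refine ⟨key (z₁ - x₁) fun P => ?_, key (z₂ - x₁) fun P => ?_, key (z₁ - x₂) fun P => ?_,
    key (z₂ - x₂) fun P => ?_⟩ <;>
  · obtain ⟨h1, h2, h3, h4⟩ := abs_coord_le P
    simp only [sub_apply, x₁_apply, x₂_apply, z₁_apply, z₂_apply]
    refine (abs_sub _ _).trans ?_
    linarith

lemma bddC1_weight : BddC1 weight (2 * (2 * 6 * 6) * (2 * 6 * 6)) := by
  have key : ∀ φ : Quad →L[ℝ] ℝ, (∀ P, |φ P| ≤ 1 * ‖P‖) → BddC1 (fun P => cutoff (φ P)) 6 :=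
    fun φ hφ => (bddC1_cutoff.comp_clm φ le_rfl hφ).mono (by norm_num)
  refine ((key x₁ ?_).mul (key x₂ ?_)).mul ((key z₁ ?_).mul (key z₂ ?_)) <;>
  · intro P
    obtain ⟨h1, h2, h3, h4⟩ := abs_coord_le P
    simpa

lemma bddC1_diffWeight (hw : BddC1 w M) :
    BddC1 (diffWeight w) (2 * (2 * (2 * M) * (2 * M)) * (2 * (2 * M) * (2 * M))) := by
  obtain ⟨h1, h2, h3, h4⟩ := bddC1_diff hw
  exact (h1.mul h2).mul (h3.mul h4)

lemma bddC1_det (hC : CurveData s M q p ν) : BddC1 (det p ν) (64 * M ^ 3) := by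
  obtain ⟨h1, h2, h3, h4⟩ := bddC1_diff hC.slope_bdd
  obtain ⟨k1, k2, k3, k4⟩ := bddC1_diff hC.slope_inv_bdd
  exact ((bddC1_diff hC.p_bdd).1.mul ((h2.mul k1).sub (h4.mul k3))).mono (by ring_nf; rfl)

lemma bddC1_density (hC : CurveData s M q p ν) (hw : BddC1 w M) (hκ : 0 < κ) (hκ1 : κ ≤ 1) :
    BddC1 (density p ν w κ) (2 ^ 29 * M ^ 7 * (κ ^ 2)⁻¹) := by
  have hM : 6 ≤ M := hC.M_large
  have hr : BddC1 (fun P => det p ν P / (det p ν P ^ 2 + κ ^ 2)) (64 * M ^ 3 * (κ ^ 2)⁻¹) := by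
    refine (bddC1_det hC).scalar_comp (fun y => (abs_hasDeriv_regularized_inv hκ y).1)
      (fun y => (abs_hasDeriv_regularized_inv hκ y).2.1)
      (fun y => (abs_hasDeriv_regularized_inv hκ y).2.2) ?_ (by rw [mul_comm])
    have h1 : κ⁻¹ ≤ (κ ^ 2)⁻¹ := by
      apply inv_anti₀ (by positivity); nlinarith
    have h2 : 1 ≤ 64 * M ^ 3 := by
      have : 1 ≤ M ^ 3 := one_le_pow₀ (by linarith)
      linarith
    have h3 : 0 < (κ ^ 2)⁻¹ := by positivity
    nlinarith
  refine ((bddC1_weight.mul (bddC1_diffWeight hw)).mul hr).mono ?_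
  have : 0 ≤ M ^ 7 * (κ ^ 2)⁻¹ := by positivity
  ring_nf at this ⊢
  norm_num at this ⊢
  linarith

lemma density_eq_zero {P : Quad} (hP : P ∉ box) : density p ν w κ P = 0 := by
  simp [density, weight_eq_zero hP]

variable {s M κ v r B : ℝ} {q p ν w g G : ℝ → ℝ} {U : Set ℝ}

lemma isClosed_box : IsClosed box :=
  (isClosed_Icc.prod isClosed_Icc).prod (isClosed_Icc.prod isClosed_Icc)

lemma volume_box_lt_top : (volume : Measure Quad) box < ⊤ := by rw [volume_box]; simp

instance : (volume : Measure Quad).IsAddHaarMeasure :=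
  haveI : (volume : Measure (ℝ × ℝ)).IsAddHaarMeasure :=
    Measure.prod.instIsAddHaarMeasure (volume : Measure ℝ) volume
  Measure.prod.instIsAddHaarMeasure (volume : Measure (ℝ × ℝ)) volume

lemma abs_integral_mul_fderiv_le {ρ H : Quad → ℝ} {C : ℝ} (hρ : BddC1 ρ C) (hH : BddC1 H B)
    (hv : ∀ P, |H P| ≤ v) (hρ0 : ∀ P, P ∉ box → ρ P = 0) {e : Quad} (he : ‖e‖ ≤ 1) :
    Integrable (fun P => ρ P * fderiv ℝ H P e) ∧
      |∫ P, ρ P * fderiv ℝ H P e| ≤ C * v * 81 := by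
  have hd0 : ∀ P, P ∉ box → fderiv ℝ ρ P e = 0 := by
    intro P hP
    have : ρ =ᶠ[nhds P] fun _ => 0 := by
      filter_upwards [isClosed_box.isOpen_compl.mem_nhds hP] with Q hQ using hρ0 Q hQ
    rw [this.fderiv_eq]; simp
  have hbd : ∀ {h : Quad → ℝ} {A : ℝ}, BddC1 h A → ∀ P, |fderiv ℝ h P e| ≤ A := by
    intro h A hh P
    refine ((fderiv ℝ h P).le_opNorm e).trans ?_
    exact (mul_le_of_le_one_right (norm_nonneg _) he).trans (hh.fderiv_bound P)
  have hm : ∀ h : Quad → ℝ, Measurable fun P => fderiv ℝ h P e := fun h =>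
    measurable_fderiv_apply_const ℝ h e
  have hi : Integrable (fun P => ρ P * fderiv ℝ H P e) := by
    refine integrable_of_bounded_support (S := box) (C := C * B)
      (hρ.diff.continuous.measurable.mul (hm H)).aestronglyMeasurable volume_box_lt_top
      (fun P hP => by simp [hρ0 P hP]) fun P => ?_
    rw [abs_mul]
    exact mul_le_mul (hρ.bound P) (hbd hH P) (abs_nonneg _) hρ.nonneg
  have hv' : ∀ P, |fderiv ℝ ρ P e * H P| ≤ C * v := fun P => by
    rw [abs_mul]
    exact mul_le_mul (hbd hρ P) (hv P) (abs_nonneg _) hρ.nonneg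
  have hi2 : Integrable (fun P => fderiv ℝ ρ P e * H P) :=
    integrable_of_bounded_support (S := box) (C := C * v)
      ((hm ρ).mul hH.diff.continuous.measurable).aestronglyMeasurable volume_box_lt_top
      (fun P hP => by simp [hd0 P hP]) hv'
  have hi3 : Integrable (fun P => ρ P * H P) := by
    refine integrable_of_bounded_support (S := box) (C := C * v)
      (hρ.diff.continuous.mul hH.diff.continuous).aestronglyMeasurable volume_box_lt_top
      (fun P hP => by simp [hρ0 P hP]) fun P => ?_
    rw [abs_mul]
    exact mul_le_mul (hρ.bound P) (hv P) (abs_nonneg _) hρ.nonneg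
  refine ⟨hi, ?_⟩
  rw [integral_mul_fderiv_eq_neg_fderiv_mul_of_integrable hi2 hi hi3 (fun P _ => hρ.diff P)
    (fun P _ => hH.diff P), abs_neg]
  have := abs_integral_le_of_bounded_support (S := box) (μ := volume)
    (f := fun P => fderiv ℝ ρ P e * H P) (C := C * v) volume_box_lt_top (fun P hP => by simp [hd0 P hP]) hv'
  rwa [measureReal_def, volume_box, ENNReal.toReal_ofNat] at this

/-- The four-fold product of translates attached to a quadruple. -/
def corners (q f₁ f₂ : ℝ → ℝ) (P : Quad) : ℝ :=
  f₁ (P.1.1 + q (P.2.1 - P.1.1)) * f₂ (P.1.1 + q (P.2.2 - P.1.1)) *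
    (f₂ (P.1.2 + q (P.2.1 - P.1.2)) * f₂ (P.1.2 + q (P.2.2 - P.1.2)))

lemma bddC1_corners (hC : CurveData s M q p ν) (hG : BddC1 G B) (hg : BddC1 g B) :
    ∃ B', BddC1 (corners q G g) B' := by
  have hM : 6 ≤ M := hC.M_large
  have key : ∀ {h : ℝ → ℝ} (φ ψ : Quad →L[ℝ] ℝ), (∀ P, |φ P| ≤ ‖P‖) → (∀ P, |ψ P| ≤ ‖P‖) →
      BddC1 h B → BddC1 (fun P => h (φ P + q (ψ P - φ P))) (B * (1 + 2 * M)) := by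
    intro h φ ψ hφ hψ hh
    have hB := hh.nonneg
    have hd : ∀ P, HasFDerivAt (fun P => φ P + q (ψ P - φ P))
        (φ + (s * p (ψ P - φ P)) • (ψ - φ)) P := fun P =>
      φ.hasFDerivAt.add ((hC.hasDerivAt _).comp_hasFDerivAt P (ψ.hasFDerivAt.sub φ.hasFDerivAt))
    have hn : ∀ φ : Quad →L[ℝ] ℝ, (∀ P, |φ P| ≤ ‖P‖) → ‖φ‖ ≤ 1 := fun φ h =>
      φ.opNorm_le_bound zero_le_one (by simpa using h)
    have hd2 : ∀ P, HasFDerivAt (fun P => h (φ P + q (ψ P - φ P)))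
        (fderiv ℝ h (φ P + q (ψ P - φ P)) 1 • (φ + (s * p (ψ P - φ P)) • (ψ - φ))) P := fun P =>
      (hh.diff _).hasDerivAt.comp_hasFDerivAt P (hd P)
    refine ⟨fun P => (hd2 P).differentiableAt, fun P => ?_, fun P => ?_⟩
    · exact (hh.bound _).trans (by nlinarith)
    · rw [(hd2 P).fderiv, norm_smul]
      refine mul_le_mul ?_ ?_ (norm_nonneg _) hB
      · refine (ContinuousLinearMap.le_opNorm _ _).trans ?_
        simpa using hh.fderiv_bound _
      · refine (norm_add_le _ _).trans (add_le_add (hn φ hφ) ?_)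
        rw [norm_smul]
        have h1 : ‖s * p (ψ P - φ P)‖ ≤ M := by
          rw [Real.norm_eq_abs, abs_mul, abs_of_pos hC.s_pos]
          exact (mul_le_of_le_one_left (abs_nonneg _) hC.s_le_one).trans (hC.p_bdd.bound _)
        have h2 : ‖ψ - φ‖ ≤ 2 := (norm_sub_le _ _).trans (by linarith [hn φ hφ, hn ψ hψ])
        have := mul_le_mul h1 h2 (norm_nonneg _) (by linarith)
        linarith
  have c1 : ∀ P, |x₁ P| ≤ ‖P‖ := fun P => (abs_coord_le P).1
  have c2 : ∀ P, |x₂ P| ≤ ‖P‖ := fun P => (abs_coord_le P).2.1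
  have c3 : ∀ P, |z₁ P| ≤ ‖P‖ := fun P => (abs_coord_le P).2.2.1
  have c4 : ∀ P, |z₂ P| ≤ ‖P‖ := fun P => (abs_coord_le P).2.2.2
  exact ⟨_, ((key x₁ z₁ c1 c3 hG).mul (key x₁ z₂ c1 c4 hg)).mul
    ((key x₂ z₁ c2 c3 hg).mul (key x₂ z₂ c2 c4 hg))⟩

variable {s M κ v r B : ℝ} {q p ν w g G : ℝ → ℝ} {U : Set ℝ}

lemma fderiv_corners (hC : CurveData s M q p ν) (hG : ∀ y, HasDerivAt G (g y) y)
    (hg : Differentiable ℝ g) (P : Quad) :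
    fderiv ℝ (corners q G g) P ((s * ν (P.2.2 - P.1.1), s * ν (P.2.2 - P.1.2)),
      (-(ν (P.2.2 - P.1.2) * (ν (P.2.1 - P.1.2))⁻¹), -1)) =
    s * det p ν P * corners q g g P := by
  have key : ∀ {h h' : ℝ → ℝ} (φ ψ : Quad →L[ℝ] ℝ), (∀ y, HasDerivAt h (h' y) y) →
      HasFDerivAt (fun P => h (φ P + q (ψ P - φ P)))
        (h' (φ P + q (ψ P - φ P)) • (φ + (s * p (ψ P - φ P)) • (ψ - φ))) P := by
    intro h h' φ ψ hh
    exact (hh _).comp_hasFDerivAt P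
      (φ.hasFDerivAt.add ((hC.hasDerivAt _).comp_hasFDerivAt P (ψ.hasFDerivAt.sub φ.hasFDerivAt)))
  have hg' : ∀ y, HasDerivAt g (deriv g y) y := fun y => (hg y).hasDerivAt
  have hH : HasFDerivAt (corners q G g) _ P := ((key x₁ z₁ hG).mul (key x₁ z₂ hg')).mul
    ((key x₂ z₁ hg').mul (key x₂ z₂ hg'))
  rw [hH.fderiv]
  have ea := hC.slope_eq (P.2.1 - P.1.1)
  have eb := hC.slope_eq (P.2.2 - P.1.1)
  have ec := hC.slope_eq (P.2.1 - P.1.2)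
  have ed := hC.slope_eq (P.2.2 - P.1.2)
  have na := hC.slope_ne_zero (P.2.1 - P.1.1)
  have nc := hC.slope_ne_zero (P.2.1 - P.1.2)
  simp only [add_apply, smul_apply, sub_apply, x₁_apply,
    x₂_apply, z₁_apply, z₂_apply, smul_eq_mul, det, corners]
  have hb : s * ν (P.2.2 - P.1.1) + s * p (P.2.2 - P.1.1) * (-1 - s * ν (P.2.2 - P.1.1)) = 0 := by
    linear_combination (-s) * eb
  have hd : s * ν (P.2.2 - P.1.2) + s * p (P.2.2 - P.1.2) * (-1 - s * ν (P.2.2 - P.1.2)) = 0 := by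
    linear_combination (-s) * ed
  have hc : s * ν (P.2.2 - P.1.2) + s * p (P.2.1 - P.1.2) *
      (-(ν (P.2.2 - P.1.2) * (ν (P.2.1 - P.1.2))⁻¹) - s * ν (P.2.2 - P.1.2)) = 0 := by
    field_simp
    linear_combination (-s) * ν (P.2.2 - P.1.2) * ec
  have ha : s * ν (P.2.2 - P.1.1) + s * p (P.2.1 - P.1.1) *
      (-(ν (P.2.2 - P.1.2) * (ν (P.2.1 - P.1.2))⁻¹) - s * ν (P.2.2 - P.1.1)) =
      s * (p (P.2.1 - P.1.1) * (ν (P.2.2 - P.1.1) * (ν (P.2.1 - P.1.1))⁻¹ -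
    ν (P.2.2 - P.1.2) * (ν (P.2.1 - P.1.2))⁻¹)) := by
    field_simp
    linear_combination (-s) * ν (P.2.2 - P.1.1) * ν (P.2.1 - P.1.2) * ea
  rw [ha, hb, hc, hd]
  ring

lemma integral_add_four {α : Type*} [MeasurableSpace α] {μ : Measure α} {f₁ f₂ f₃ f₄ : α → ℝ}
    (h₁ : Integrable f₁ μ) (h₂ : Integrable f₂ μ) (h₃ : Integrable f₃ μ) (h₄ : Integrable f₄ μ) :
    ∫ x, (f₁ x + f₂ x + f₃ x + f₄ x) ∂μ =
      ∫ x, f₁ x ∂μ + ∫ x, f₂ x ∂μ + ∫ x, f₃ x ∂μ + ∫ x, f₄ x ∂μ := by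
  have h12 : Integrable (fun x => f₁ x + f₂ x) μ := h₁.add h₂
  have h123 : Integrable (fun x => f₁ x + f₂ x + f₃ x) μ := h12.add h₃
  rw [integral_add h123 h₄, integral_add h12 h₃, integral_add h₁ h₂]

/-- Integration by parts along the direction annihilating three of the four corners. -/
lemma abs_integral_density_le (hC : CurveData s M q p ν) (hw : BddC1 w M) (hκ : 0 < κ)
    (hκ1 : κ ≤ 1) (hG : ∀ y, HasDerivAt G (g y) y) (hg : BddC1 g B) (hg1 : ∀ y, |g y| ≤ 1)
    (hGv : ∀ y, |G y| ≤ v) :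
    |∫ P, density p ν w κ P * det p ν P * corners q g g P| ≤ 2 ^ 42 * M ^ 9 * (κ ^ 2)⁻¹ * (v / s) := by
  have hM : 6 ≤ M := hC.M_large
  have hs := hC.s_pos
  have hv : 0 ≤ v := (abs_nonneg _).trans (hGv 0)
  have hG' : BddC1 G (max B (max v 1)) :=
    BddC1.of_hasDerivAt hG (fun y => (hGv y).trans (by simp)) (fun y => (hg1 y).trans (by simp))
  obtain ⟨B', hH⟩ := bddC1_corners hC hG' (hg.mono (le_max_left B (max v 1)))
  have hHv : ∀ P, |corners q G g P| ≤ v := by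
    intro P
    simp only [corners, abs_mul]
    have h1 := mul_le_one₀ (hg1 (P.1.2 + q (P.2.1 - P.1.2))) (abs_nonneg _)
      (hg1 (P.1.2 + q (P.2.2 - P.1.2)))
    have h2 := mul_le_mul (hGv (P.1.1 + q (P.2.1 - P.1.1))) (hg1 (P.1.1 + q (P.2.2 - P.1.1)))
      (abs_nonneg _) hv
    have := mul_le_mul h2 h1 (by positivity) (by linarith)
    linarith
  obtain ⟨n1, n2, n3, n4⟩ := bddC1_diff hC.slope_bdd
  obtain ⟨k1, k2, k3, k4⟩ := bddC1_diff hC.slope_inv_bdd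
  have hD := bddC1_density hC hw hκ hκ1
  set D := 2 ^ 29 * M ^ 7 * (κ ^ 2)⁻¹ with hDdef
  have hD0 : 0 ≤ D := hD.nonneg
  have hs1 : |s| ≤ 1 := by rw [abs_of_pos hs]; exact hC.s_le_one
  have m8 : 2 * M ≤ 8 * M ^ 2 := by nlinarith
  have v1 := (n2.const_mul hs1).mono m8
  have v2 := (n4.const_mul hs1).mono m8
  have v3 : BddC1 (fun P : Quad => -(ν (P.2.2 - P.1.2) * (ν (P.2.1 - P.1.2))⁻¹)) (8 * M ^ 2) :=
    (n4.mul k3).neg.mono (by nlinarith)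
  have v4 : BddC1 (fun _ : Quad => (-1 : ℝ)) (8 * M ^ 2) :=
    ⟨differentiable_const _, fun _ => by simp; nlinarith, fun _ => by simp; nlinarith⟩
  have key : ∀ {V : Quad → ℝ}, BddC1 V (8 * M ^ 2) → ∀ e : Quad, ‖e‖ ≤ 1 →
      Integrable (fun P => density p ν w κ P * V P * fderiv ℝ (corners q G g) P e) ∧
      |∫ P, density p ν w κ P * V P * fderiv ℝ (corners q G g) P e| ≤
        2 * D * (8 * M ^ 2) * v * 81 := fun hV e he =>
    abs_integral_mul_fderiv_le (hD.mul hV) hH hHv (fun P hP => by simp [density_eq_zero hP]) he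
  have ne : ‖(((1, 0), (0, 0)) : Quad)‖ ≤ 1 ∧ ‖(((0, 1), (0, 0)) : Quad)‖ ≤ 1 ∧
    ‖(((0, 0), (1, 0)) : Quad)‖ ≤ 1 ∧ ‖(((0, 0), (0, 1)) : Quad)‖ ≤ 1 := by
    simp [Prod.norm_def]
  obtain ⟨i1, b1⟩ := key v1 _ ne.1
  obtain ⟨i2, b2⟩ := key v2 _ ne.2.1
  obtain ⟨i3, b3⟩ := key v3 _ ne.2.2.1
  obtain ⟨i4, b4⟩ := key v4 _ ne.2.2.2
  have hsum : (fun P => s * (density p ν w κ P * det p ν P * corners q g g P)) = fun P =>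
      density p ν w κ P * (s * ν (P.2.2 - P.1.1)) * fderiv ℝ (corners q G g) P ((1, 0), (0, 0)) +
      density p ν w κ P * (s * ν (P.2.2 - P.1.2)) * fderiv ℝ (corners q G g) P ((0, 1), (0, 0)) +
      density p ν w κ P * (-(ν (P.2.2 - P.1.2) * (ν (P.2.1 - P.1.2))⁻¹)) *
        fderiv ℝ (corners q G g) P ((0, 0), (1, 0)) +
      density p ν w κ P * (-1) * fderiv ℝ (corners q G g) P ((0, 0), (0, 1)) := by
    funext P
    have h := fderiv_corners hC hG hg.diff P
    have hV : ∀ a b c d : ℝ, (((a, b), (c, d)) : Quad) = a • (((1, 0), (0, 0)) : Quad) +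
        b • (((0, 1), (0, 0)) : Quad) + c • (((0, 0), (1, 0)) : Quad) +
        d • (((0, 0), (0, 1)) : Quad) := by
      intro a b c d; ext <;> simp
    rw [hV] at h
    simp only [map_add, map_smul, smul_eq_mul] at h
    linear_combination (-density p ν w κ P) * h
  have htot : s * |∫ P, density p ν w κ P * det p ν P * corners q g g P| ≤
      4 * (2 * D * (8 * M ^ 2) * v * 81) := by
    rw [← abs_of_pos hs, ← abs_mul, ← integral_const_mul, hsum,
      integral_add_four i1 i2 i3 i4]
    rw [abs_le] at b1 b2 b3 b4 ⊢
    constructor <;> linarith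
  have hX : 0 ≤ M ^ 9 * (κ ^ 2)⁻¹ * v := by positivity
  rw [mul_div_assoc', le_div_iff₀ hs, mul_comm]
  refine htot.trans ?_
  rw [hDdef]
  ring_nf at hX ⊢
  linarith

variable {s M κ v r B : ℝ} {q p ν w g G : ℝ → ℝ} {U : Set ℝ}

/-- The part of `[-1, 2]²` close to the diagonal. -/
def strip (r : ℝ) : Set (ℝ × ℝ) := (Set.Icc (-1) 2 ×ˢ Set.Icc (-1) 2) ∩ {y | |y.1 - y.2| < r}

lemma measurableSet_strip (r : ℝ) : MeasurableSet (strip r) :=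
  (measurableSet_Icc.prod measurableSet_Icc).inter
    (measurableSet_lt (by fun_prop) (by fun_prop))

lemma volume_strip_le (hr : 0 ≤ r) : volume (strip r) ≤ ENNReal.ofReal (6 * r) := by
  rw [Measure.volume_eq_prod, Measure.prod_apply (measurableSet_strip r)]
  have : ∀ x : ℝ, volume (Prod.mk x ⁻¹' strip r) ≤
      (Set.Icc (-1 : ℝ) 2).indicator (fun _ => ENNReal.ofReal (2 * r)) x := by
    intro x
    by_cases hx : x ∈ Set.Icc (-1 : ℝ) 2
    · rw [Set.indicator_of_mem hx]
      have : Prod.mk x ⁻¹' strip r ⊆ Set.Icc (x - r) (x + r) := by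
        intro y hy
        have : |x - y| < r := hy.2
        rw [abs_lt] at this
        constructor <;> linarith
      refine (measure_mono this).trans ?_
      rw [Real.volume_Icc]
      apply le_of_eq
      congr 1; ring
    · have : Prod.mk x ⁻¹' strip r = ∅ := by
        ext y; simp only [Set.mem_preimage, Set.mem_empty_iff_false, iff_false]
        exact fun hy => hx hy.1.1
      rw [this]; simp
  refine (lintegral_mono this).trans ?_
  rw [lintegral_indicator_const measurableSet_Icc, Real.volume_Icc,
    ← ENNReal.ofReal_mul (by linarith)]
  apply le_of_eq
  congr 1; ring

lemma volume_real_strip_prod_le (hr : 0 ≤ r) :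
    (volume : Measure Quad).real (strip r ×ˢ (Set.Icc (-1) 2 ×ˢ Set.Icc (-1) 2)) ≤ 54 * r ∧
    (volume : Measure Quad).real ((Set.Icc (-1) 2 ×ˢ Set.Icc (-1) 2) ×ˢ strip r) ≤ 54 * r := by
  have h9 : (volume : Measure (ℝ × ℝ)).real (Set.Icc (-1 : ℝ) 2 ×ˢ Set.Icc (-1 : ℝ) 2) = 9 := by
    rw [measureReal_def, volume_Icc_prod]; simp
  have hs : (volume : Measure (ℝ × ℝ)).real (strip r) ≤ 6 * r :=
    ENNReal.toReal_le_of_le_ofReal (by linarith) (volume_strip_le hr)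
  rw [Measure.volume_eq_prod, measureReal_prod_prod, measureReal_prod_prod, h9]
  constructor <;> linarith

lemma abs_corners_le_one (hg1 : ∀ y, |g y| ≤ 1) (P : Quad) : |corners q g g P| ≤ 1 := by
  simp only [corners, abs_mul]
  have h1 := mul_le_one₀ (hg1 (P.1.2 + q (P.2.1 - P.1.2))) (abs_nonneg _)
    (hg1 (P.1.2 + q (P.2.2 - P.1.2)))
  have h2 := mul_le_one₀ (hg1 (P.1.1 + q (P.2.1 - P.1.1))) (abs_nonneg _)
    (hg1 (P.1.1 + q (P.2.2 - P.1.1)))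
  exact mul_le_one₀ h2 (by positivity) h1

lemma diffWeight_mem_Icc (hw : CurvedCutoff M p ν w U) (P : Quad) :
    0 ≤ diffWeight w P ∧ diffWeight w P ≤ 1 := by
  have h0 := hw.nonneg
  have h1 := hw.le_one
  unfold diffWeight
  refine ⟨mul_nonneg (mul_nonneg (h0 _) (h0 _)) (mul_nonneg (h0 _) (h0 _)), ?_⟩
  exact mul_le_one₀ (mul_le_one₀ (h1 _) (h0 _) (h1 _)) (mul_nonneg (h0 _) (h0 _))
    (mul_le_one₀ (h1 _) (h0 _) (h1 _))

lemma le_abs_det (hw : CurvedCutoff M p ν w U) (hM : 0 < M) {P : Quad} (hP : diffWeight w P ≠ 0) :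
    (M ^ 2)⁻¹ * |P.2.2 - P.2.1| * |P.1.1 - P.1.2| ≤ |det p ν P| := by
  have hU : ∀ {u}, w u ≠ 0 → u ∈ U := fun {u} h => by
    by_contra h'; exact h (hw.eq_zero u h')
  simp only [diffWeight, mul_ne_zero_iff] at hP
  obtain ⟨⟨ha, hb⟩, hc, hd⟩ := hP
  have h1 := hw.curved _ (hU ha) _ (hU hb) _ (hU hc) _ (hU hd) (by ring)
  have h2 := hw.le_abs _ (hU ha)
  rw [show P.2.2 - P.1.1 - (P.2.1 - P.1.1) = P.2.2 - P.2.1 by ring,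
    show P.2.1 - P.1.2 - (P.2.1 - P.1.1) = P.1.1 - P.1.2 by ring] at h1
  rw [det, abs_mul]
  have := mul_le_mul h2 h1 (by positivity) (abs_nonneg _)
  refine le_trans (le_of_eq ?_) this
  field_simp

lemma abs_integral_corners_le (hC : CurveData s M q p ν) (hw : CurvedCutoff M p ν w U)
    (hr : 0 < r) (hrM : r * M ^ 4 ≤ 1) (hG : ∀ y, HasDerivAt G (g y) y) (hg : BddC1 g B)
    (hg1 : ∀ y, |g y| ≤ 1) (hGv : ∀ y, |G y| ≤ v) :
    |∫ P, weight P * diffWeight w P * corners q g g P| ≤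
      2 ^ 12 * r + 2 ^ 42 * M ^ 9 * (r ^ 6)⁻¹ * (v / s) := by
  have hM : 6 ≤ M := hC.M_large
  have hM4 : 1 ≤ M ^ 4 := one_le_pow₀ (by linarith)
  have hr1 : r ≤ 1 := by nlinarith
  have hκ : 0 < r ^ 3 := by positivity
  have hκ1 : r ^ 3 ≤ 1 := pow_le_one₀ hr.le hr1
  have hmain := abs_integral_density_le hC hw.bdd hκ hκ1 hG hg hg1 hGv
  rw [← pow_mul] at hmain
  norm_num only at hmain
  have hcont : Continuous (det p ν) := (bddC1_det hC).diff.continuous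
  have hcw : Continuous (diffWeight w) := (bddC1_diffWeight hw.bdd).diff.continuous
  have hc0 : Continuous weight := bddC1_weight.diff.continuous
  have hG' : BddC1 G (max B (max v 1)) :=
    BddC1.of_hasDerivAt hG (fun y => (hGv y).trans (by simp)) (fun y => (hg1 y).trans (by simp))
  obtain ⟨B', hgg⟩ := bddC1_corners hC hg hg
  have hcc := hgg.diff.continuous
  have hden : ∀ P, 0 < det p ν P ^ 2 + (r ^ 3) ^ 2 := fun P => by positivity
  set E : Quad → ℝ := fun P => weight P * diffWeight w P *
    ((r ^ 3) ^ 2 / (det p ν P ^ 2 + (r ^ 3) ^ 2)) * corners q g g P with hE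
  set I2 : Set (ℝ × ℝ) := Set.Icc (-1) 2 ×ˢ Set.Icc (-1) 2 with hI2
  have hmI : MeasurableSet I2 := measurableSet_Icc.prod measurableSet_Icc
  set S₁ : Set Quad := strip r ×ˢ I2
  set S₂ : Set Quad := I2 ×ˢ strip r
  have hm1 : MeasurableSet S₁ := (measurableSet_strip r).prod hmI
  have hm2 : MeasurableSet S₂ := hmI.prod (measurableSet_strip r)
  have hmb : MeasurableSet box := hmI.prod hmI
  have hfin : ∀ {S : Set Quad}, S ⊆ box → volume S ≠ ⊤ := fun hS =>
    ((measure_mono hS).trans_lt volume_box_lt_top).ne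
  have hs1 : S₁ ⊆ box := Set.prod_mono Set.inter_subset_left subset_rfl
  have hs2 : S₂ ⊆ box := Set.prod_mono subset_rfl Set.inter_subset_left
  have hEb : ∀ P, |E P| ≤ S₁.indicator (fun _ => 16) P + S₂.indicator (fun _ => 16) P +
      box.indicator (fun _ => 16 * (M ^ 4 * r ^ 2)) P := by
    intro P
    have n1 : 0 ≤ S₁.indicator (fun _ => (16 : ℝ)) P := Set.indicator_nonneg (by norm_num) _
    have n2 : 0 ≤ S₂.indicator (fun _ => (16 : ℝ)) P := Set.indicator_nonneg (by norm_num) _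
    have n3 : 0 ≤ box.indicator (fun _ => 16 * (M ^ 4 * r ^ 2)) P :=
      Set.indicator_nonneg (fun _ _ => by positivity) _
    by_cases hb : P ∈ box
    swap
    · rw [hE]; simp only [weight_eq_zero hb, zero_mul, abs_zero]; linarith
    by_cases hd : diffWeight w P = 0
    · rw [hE]; simp only [hd, mul_zero, zero_mul, abs_zero]; linarith
    obtain ⟨d0, d1⟩ := diffWeight_mem_Icc hw P
    have w0 := weight_nonneg P
    have w1 := weight_le P
    set t := (r ^ 3) ^ 2 / (det p ν P ^ 2 + (r ^ 3) ^ 2) with ht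
    have t0 : 0 ≤ t := by positivity
    have hEt : |E P| ≤ 16 * t := by
      rw [hE]
      simp only [← ht]
      rw [abs_mul, abs_mul, abs_mul, abs_of_nonneg w0, abs_of_nonneg d0, abs_of_nonneg t0]
      have a1 : weight P * diffWeight w P ≤ 16 * 1 := mul_le_mul w1 d1 d0 (by norm_num)
      have a2 := mul_le_mul_of_nonneg_right a1 t0
      have a3 := mul_le_mul a2 (abs_corners_le_one (q := q) hg1 P) (abs_nonneg _) (by linarith)
      linarith
    have t1 : t ≤ 1 := by
      rw [ht, div_le_one (hden P)]; nlinarith [sq_nonneg (det p ν P)]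
    by_cases h1 : |P.1.1 - P.1.2| < r
    · have : P ∈ S₁ := ⟨⟨hb.1, h1⟩, hb.2⟩
      rw [Set.indicator_of_mem this] at n1 ⊢
      linarith
    by_cases h2 : |P.2.1 - P.2.2| < r
    · have : P ∈ S₂ := ⟨hb.1, hb.2, h2⟩
      rw [Set.indicator_of_mem this] at n2 ⊢
      linarith
    rw [Set.indicator_of_mem hb] at n3 ⊢
    push Not at h1 h2
    rw [abs_sub_comm] at h2
    have hdet := le_abs_det hw (by linarith) hd
    have h3 : (M ^ 2)⁻¹ * r * r ≤ |det p ν P| := by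
      refine le_trans ?_ hdet
      gcongr
    have h4 : ((M ^ 2)⁻¹ * r * r) ^ 2 ≤ det p ν P ^ 2 := by
      rw [← sq_abs (det p ν P)]
      exact pow_le_pow_left₀ (by positivity) h3 2
    have h5 : t ≤ M ^ 4 * r ^ 2 := by
      rw [ht, div_le_iff₀ (hden P)]
      have h6 : (r ^ 3) ^ 2 = M ^ 4 * r ^ 2 * ((M ^ 2)⁻¹ * r * r) ^ 2 := by
        field_simp
      have h7 : M ^ 4 * r ^ 2 * ((M ^ 2)⁻¹ * r * r) ^ 2 ≤ M ^ 4 * r ^ 2 * det p ν P ^ 2 := by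
        gcongr
      have h8 : 0 ≤ M ^ 4 * r ^ 2 * (r ^ 3) ^ 2 := by positivity
      linarith
    linarith
  have ii : ∀ {S : Set Quad} (c : ℝ), MeasurableSet S → S ⊆ box →
      Integrable (S.indicator fun _ => c) ∧
        ∫ P, S.indicator (fun _ => c) P = volume.real S * c := fun {S} c hS hSb =>
    ⟨(integrable_indicator_iff hS).2 (integrableOn_const (hfin hSb)),
      integral_indicator_const c hS⟩
  obtain ⟨i1, e1⟩ := ii 16 hm1 hs1
  obtain ⟨i2, e2⟩ := ii 16 hm2 hs2
  obtain ⟨i3, e3⟩ := ii (16 * (M ^ 4 * r ^ 2)) hmb subset_rfl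
  have i12 : Integrable (fun P => S₁.indicator (fun _ => (16 : ℝ)) P +
    S₂.indicator (fun _ => 16) P) := i1.add i2
  have hEint : |∫ P, E P| ≤ 54 * r * 16 + 54 * r * 16 + 81 * (16 * (M ^ 4 * r ^ 2)) := by
    have i123 : Integrable fun P => S₁.indicator (fun _ => (16 : ℝ)) P +
        S₂.indicator (fun _ => 16) P + box.indicator (fun _ => 16 * (M ^ 4 * r ^ 2)) P :=
      i12.add i3
    refine (norm_integral_le_of_norm_le (f := E) i123 (Filter.Eventually.of_forall hEb)).trans ?_
    rw [integral_add i12 i3, integral_add i1 i2, e1, e2, e3]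
    have hv81 : (volume : Measure Quad).real box = 81 := by rw [measureReal_def, volume_box]; simp
    rw [hv81]
    obtain ⟨v1, v2⟩ := volume_real_strip_prod_le hr.le
    have := mul_le_mul_of_nonneg_right v1 (by norm_num : (0 : ℝ) ≤ 16)
    have := mul_le_mul_of_nonneg_right v2 (by norm_num : (0 : ℝ) ≤ 16)
    linarith
  have hEi : Integrable E := by
    refine integrable_of_bounded_support (S := box) (C := 16 + 16 + 16 * (M ^ 4 * r ^ 2)) ?_
      volume_box_lt_top (fun P hP => by simp [hE, weight_eq_zero hP]) fun P => ?_
    · exact (((hc0.mul hcw).mul (continuous_const.div₀ ((hcont.pow 2).add continuous_const)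
        fun P => (hden P).ne')).mul hcc).aestronglyMeasurable
    · refine (hEb P).trans (add_le_add (add_le_add ?_ ?_) ?_) <;>
        exact Set.indicator_le_self' (fun _ _ => by positivity) _
  have hmi : Integrable fun P => density p ν w (r ^ 3) P * det p ν P * corners q g g P := by
    have hD := bddC1_density hC hw.bdd hκ hκ1
    refine integrable_of_bounded_support (S := box)
      (C := 2 ^ 29 * M ^ 7 * ((r ^ 3) ^ 2)⁻¹ * (64 * M ^ 3) * 1)
      ((hD.diff.continuous.mul hcont).mul hcc).aestronglyMeasurable
      volume_box_lt_top (fun P hP => by simp [density_eq_zero hP]) fun P => ?_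
    rw [abs_mul, abs_mul]
    exact mul_le_mul (mul_le_mul (hD.bound P) ((bddC1_det hC).bound P) (abs_nonneg _) hD.nonneg)
      (abs_corners_le_one hg1 P) (abs_nonneg _) (by positivity)
  have hsplit : (fun P => weight P * diffWeight w P * corners q g g P) = fun P =>
      density p ν w (r ^ 3) P * det p ν P * corners q g g P + E P := by
    funext P
    have := (hden P).ne'
    rw [hE, density]
    field_simp
  rw [hsplit, integral_add hmi hEi]
  refine (abs_add_le _ _).trans ?_
  have : M ^ 4 * r ^ 2 ≤ r := by nlinarith
  linarith

end Quad

lemma sq_integral_le_integral_sq {α : Type*} [MeasurableSpace α] {μ : Measure α}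
    [IsProbabilityMeasure μ] {F : α → ℝ} {C : ℝ} (hF : AEStronglyMeasurable F μ)
    (hC : ∀ x, |F x| ≤ C) : (∫ x, F x ∂μ) ^ 2 ≤ ∫ x, F x ^ 2 ∂μ := by
  have i1 : Integrable F μ := Integrable.of_bound hF C (Filter.Eventually.of_forall hC)
  have i2 : Integrable (fun x => F x ^ 2) μ :=
    Integrable.of_bound (hF.pow 2) (C ^ 2) (Filter.Eventually.of_forall fun x => by
      rw [Real.norm_eq_abs, abs_pow]; exact pow_le_pow_left₀ (abs_nonneg _) (hC x) 2)
  set m := ∫ x, F x ∂μ with hm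
  have h0 : 0 ≤ ∫ x, (F x - m) ^ 2 ∂μ := integral_nonneg fun x => sq_nonneg _
  have h1 : (fun x => (F x - m) ^ 2) = fun x => F x ^ 2 - (2 * m * F x - m ^ 2) := by
    funext x; ring
  have i3 : Integrable (fun x => 2 * m * F x - m ^ 2) μ := (i1.const_mul _).sub (integrable_const _)
  rw [h1, integral_sub i2 i3, integral_sub (i1.const_mul _) (integrable_const _),
    integral_const_mul, ← hm] at h0
  simp at h0
  nlinarith

lemma sq_integral_mul_le {α : Type*} [MeasurableSpace α] {μ : Measure α} {S : Set α}
    (hS : MeasurableSet S) (hS1 : μ S = 1) {φ c k : α → ℝ} {C : ℝ}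
    (hφ : Measurable φ) (hk : Measurable k) (hφ1 : ∀ x, |φ x| ≤ 1) (hφ0 : ∀ x, x ∉ S → φ x = 0)
    (hkC : ∀ x, |k x| ≤ C) (hc : ∀ x, 0 ≤ c x) (hcS : ∀ x ∈ S, 1 ≤ c x)
    (hi : Integrable (fun x => c x * k x ^ 2) μ) :
    (∫ x, φ x * k x ∂μ) ^ 2 ≤ ∫ x, c x * k x ^ 2 ∂μ := by
  have : IsProbabilityMeasure (μ.restrict S) := ⟨by simp [hS1]⟩
  rw [← setIntegral_eq_integral_of_forall_compl_eq_zero (s := S)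
    (fun x hx => by rw [hφ0 x hx, zero_mul])]
  refine (sq_integral_le_integral_sq (C := C) (F := fun x => φ x * k x) (hφ.mul hk).aestronglyMeasurable fun x => ?_).trans ?_
  · rw [abs_mul]
    exact (mul_le_of_le_one_left (abs_nonneg _) (hφ1 x)).trans (hkC x)
  · refine le_trans ?_ (setIntegral_le_integral (s := S) hi
      (Filter.Eventually.of_forall fun x => mul_nonneg (hc x) (sq_nonneg _)))
    refine setIntegral_mono_on (f := fun x => (φ x * k x) ^ 2) ?_ hi.integrableOn hS fun x hx => ?_
    · refine Integrable.of_bound ((hφ.mul hk).pow_const 2).aestronglyMeasurable (C ^ 2)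
        (Filter.Eventually.of_forall fun x => ?_)
      rw [Real.norm_eq_abs, abs_pow]
      refine pow_le_pow_left₀ (abs_nonneg _) ?_ 2
      rw [abs_mul]
      exact (mul_le_of_le_one_left (abs_nonneg _) (hφ1 x)).trans (hkC x)
    · have h1 : φ x ^ 2 ≤ c x := by
        refine le_trans ?_ (hcS x hx)
        rw [← sq_abs]
        exact pow_le_one₀ (abs_nonneg _) (hφ1 x)
      rw [mul_pow]
      exact mul_le_mul_of_nonneg_right h1 (sq_nonneg _)

lemma continuous_cutoff : Continuous cutoff := bddC1_cutoff.diff.continuous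

/-- Two applications of the Cauchy–Schwarz inequality. -/
lemma bilinear_pow_four_le {K : ℝ × ℝ → ℝ} (hK : Continuous K) (hK1 : ∀ y, |K y| ≤ 1)
    {f₀ f₂ : ℝ → ℝ} (m₀ : Measurable f₀) (m₂ : Measurable f₂) (b₀ : ∀ x, |f₀ x| ≤ 1)
    (b₂ : ∀ x, |f₂ x| ≤ 1) (s₀ : ∀ x, x ∉ Set.Icc (0 : ℝ) 1 → f₀ x = 0)
    (s₂ : ∀ x, x ∉ Set.Icc (0 : ℝ) 1 → f₂ x = 0) :
    (∫ z, f₂ z * ∫ x, f₀ x * K (x, z)) ^ 4 ≤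
      ∫ P : Quad, Quad.weight P * (K (P.1.1, P.2.1) * K (P.1.1, P.2.2) *
        (K (P.1.2, P.2.1) * K (P.1.2, P.2.2))) := by
  have hvol : (volume : Measure ℝ) (Set.Icc 0 1) = 1 := by simp
  have hvol2 : (volume : Measure (ℝ × ℝ)) (Set.Icc 0 1 ×ˢ Set.Icc 0 1) = 1 := by
    rw [Measure.volume_eq_prod, Measure.prod_prod, hvol, one_mul]
  have hI2 : (volume : Measure (ℝ × ℝ)) (Set.Icc (-1) 2 ×ˢ Set.Icc (-1) 2) < ⊤ := by
    rw [Quad.volume_Icc_prod]; simp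
  have hI1 : (volume : Measure ℝ) (Set.Icc (-1) 2) < ⊤ := by simp
  have cc : ∀ x, |cutoff x| ≤ 2 := fun x => by
    rw [abs_of_nonneg (cutoff_nonneg x)]; exact cutoff_le_two x
  have cm : Measurable cutoff := continuous_cutoff.measurable
  -- the inner integral in `x`
  set h : ℝ → ℝ := fun z => ∫ x, f₀ x * K (x, z) with hh
  have hmeas : Measurable h := by
    have : StronglyMeasurable fun y : ℝ × ℝ => f₀ y.2 * K (y.2, y.1) :=
      ((m₀.comp measurable_snd).mul
        (hK.measurable.comp (measurable_snd.prodMk measurable_fst))).stronglyMeasurable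
    exact this.integral_prod_right.measurable
  have hb : ∀ z, |h z| ≤ 1 := fun z => by
    have := abs_integral_le_of_bounded_support (μ := volume) (f := fun x => f₀ x * K (x, z))
      (S := Set.Icc (0 : ℝ) 1) (C := 1) (by simp) (fun x hx => by simp [s₀ x hx]) fun x => by
        rw [abs_mul]; exact mul_le_one₀ (b₀ x) (abs_nonneg _) (hK1 _)
    simpa using this
  have ic : Integrable fun z => cutoff z * h z ^ 2 := by
    refine integrable_of_bounded_support (S := Set.Icc (-1) 2) (C := 2)
      (cm.mul (hmeas.pow_const 2)).aestronglyMeasurable hI1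
      (fun z hz => by simp [cutoff_eq_zero hz]) fun z => ?_
    rw [abs_mul, abs_pow]
    have := mul_le_mul (cc z) (pow_le_one₀ (n := 2) (abs_nonneg _) (hb z)) (by positivity)
      zero_le_two
    linarith
  have step1 : (∫ z, f₂ z * h z) ^ 2 ≤ ∫ z, cutoff z * h z ^ 2 :=
    sq_integral_mul_le measurableSet_Icc hvol m₂ hmeas b₂ s₂ hb cutoff_nonneg
      (fun x hx => one_le_cutoff hx) ic
  -- the correlation kernel
  set k : ℝ × ℝ → ℝ := fun y => ∫ z, cutoff z * (K (y.1, z) * K (y.2, z)) with hk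
  have kmeas : Measurable k := by
    have : StronglyMeasurable fun y : (ℝ × ℝ) × ℝ =>
        cutoff y.2 * (K (y.1.1, y.2) * K (y.1.2, y.2)) := by
      refine Continuous.stronglyMeasurable ?_
      have := continuous_cutoff
      fun_prop
    exact this.integral_prod_right.measurable
  have kb : ∀ y, |k y| ≤ 6 := fun y => by
    have := abs_integral_le_of_bounded_support (μ := volume)
      (f := fun z => cutoff z * (K (y.1, z) * K (y.2, z)))
      (S := Set.Icc (-1 : ℝ) 2) (C := 2) hI1 (fun x hx => by simp [cutoff_eq_zero hx]) fun x => by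
        rw [abs_mul, abs_mul]
        have := mul_le_mul (cc x) (mul_le_one₀ (hK1 (y.1, x)) (abs_nonneg _) (hK1 (y.2, x)))
          (by positivity) zero_le_two
        linarith
    refine this.trans ?_
    norm_num
  have swap : ∫ z, cutoff z * h z ^ 2 = ∫ y : ℝ × ℝ, f₀ y.1 * f₀ y.2 * k y := by
    have e1 : ∀ z, cutoff z * h z ^ 2 =
        ∫ y : ℝ × ℝ, f₀ y.1 * f₀ y.2 * (cutoff z * (K (y.1, z) * K (y.2, z))) := by
      intro z
      rw [sq, hh]
      simp only
      rw [← integral_prod_mul (fun x => f₀ x * K (x, z)) (fun x => f₀ x * K (x, z)),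
        ← integral_const_mul]
      refine integral_congr_ae (Filter.Eventually.of_forall fun y => ?_)
      simp only
      ring
    simp_rw [e1]
    rw [integral_integral_swap]
    · simp_rw [integral_const_mul]; rfl
    · refine integrable_of_bounded_support
        (S := Set.Icc (-1 : ℝ) 2 ×ˢ (Set.Icc (0 : ℝ) 1 ×ˢ Set.Icc (0 : ℝ) 1)) (C := 2) ?_ ?_ ?_ ?_
      · have := continuous_cutoff.measurable
        have := hK.measurable
        refine Measurable.aestronglyMeasurable ?_
        simp only [Function.uncurry_def]
        fun_prop
      · rw [Measure.prod_prod, hvol2, mul_one]; exact hI1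
      · rintro ⟨z, x, x'⟩ hx
        simp only [Set.mem_prod, not_and_or] at hx
        rcases hx with hx | hx | hx
        · simp [Function.uncurry, cutoff_eq_zero hx]
        all_goals simp [Function.uncurry, s₀ _ hx]
      · rintro ⟨z, x, x'⟩
        simp only [Function.uncurry, abs_mul]
        have h1 := mul_le_one₀ (b₀ x) (abs_nonneg _) (b₀ x')
        have h2 := mul_le_one₀ (hK1 (x, z)) (abs_nonneg _) (hK1 (x', z))
        have h3 := mul_le_mul (cc z) h2 (by positivity) zero_le_two
        have := mul_le_mul h1 h3 (by positivity) zero_le_one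
        linarith
  set c : ℝ × ℝ → ℝ := fun y => cutoff y.1 * cutoff y.2 with hc
  have hc4 : ∀ y, |c y| ≤ 4 := fun y => by
    rw [hc, abs_mul]
    have := mul_le_mul (cc y.1) (cc y.2) (abs_nonneg _) zero_le_two
    linarith
  have hc0 : ∀ y, y ∉ Set.Icc (-1 : ℝ) 2 ×ˢ Set.Icc (-1 : ℝ) 2 → c y = 0 := fun y hy => by
    simp only [Set.mem_prod, not_and_or] at hy
    rcases hy with hy | hy <;> simp [hc, cutoff_eq_zero hy]
  have hcm : Measurable c := by fun_prop
  have step2 : (∫ y : ℝ × ℝ, f₀ y.1 * f₀ y.2 * k y) ^ 2 ≤ ∫ y, c y * k y ^ 2 := by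
    refine sq_integral_mul_le (measurableSet_Icc.prod measurableSet_Icc) hvol2
      (φ := fun y => f₀ y.1 * f₀ y.2) (by fun_prop) kmeas (fun y => ?_) (fun y hy => ?_) kb
      (fun y => mul_nonneg (cutoff_nonneg _) (cutoff_nonneg _)) (fun y hy => ?_) ?_
    · rw [abs_mul]; exact mul_le_one₀ (b₀ _) (abs_nonneg _) (b₀ _)
    · simp only [Set.mem_prod, not_and_or] at hy
      rcases hy with hy | hy <;> simp [s₀ _ hy]
    · exact one_le_mul_of_one_le_of_one_le (one_le_cutoff hy.1) (one_le_cutoff hy.2)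
    · refine integrable_of_bounded_support (C := 4 * 36)
        (hcm.mul (kmeas.pow_const 2)).aestronglyMeasurable hI2
        (fun y hy => by simp [hc0 y hy]) fun y => ?_
      rw [abs_mul, abs_pow]
      have := pow_le_pow_left₀ (abs_nonneg _) (kb y) 2
      exact mul_le_mul (hc4 y) (this.trans (by norm_num)) (by positivity) (by norm_num)
  have hbox : ∫ y, c y * k y ^ 2 = ∫ P : Quad, Quad.weight P *
      (K (P.1.1, P.2.1) * K (P.1.1, P.2.2) * (K (P.1.2, P.2.1) * K (P.1.2, P.2.2))) := by
    rw [Measure.volume_eq_prod (ℝ × ℝ) (ℝ × ℝ), integral_prod]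
    · refine integral_congr_ae (Filter.Eventually.of_forall fun y => ?_)
      simp only
      rw [sq, hk]
      simp only
      rw [← integral_prod_mul, ← integral_const_mul]
      refine integral_congr_ae (Filter.Eventually.of_forall fun z => ?_)
      simp only [Quad.weight, hc]
      ring
    · refine integrable_of_bounded_support (S := Quad.box) (C := 16) ?_ Quad.volume_box_lt_top
        (fun P hP => by simp [Quad.weight_eq_zero hP]) fun P => ?_
      · refine Continuous.aestronglyMeasurable ?_
        have := bddC1_cutoff.diff.continuous
        unfold Quad.weight
        fun_prop
      · rw [abs_mul, abs_of_nonneg (Quad.weight_nonneg P)]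
        have h1 : |K (P.1.1, P.2.1) * K (P.1.1, P.2.2) *
            (K (P.1.2, P.2.1) * K (P.1.2, P.2.2))| ≤ 1 := by
          simp only [abs_mul]
          exact mul_le_one₀ (mul_le_one₀ (hK1 _) (abs_nonneg _) (hK1 _)) (by positivity)
            (mul_le_one₀ (hK1 _) (abs_nonneg _) (hK1 _))
        have := mul_le_mul (Quad.weight_le P) h1 (abs_nonneg _) (by norm_num)
        linarith
  calc (∫ z, f₂ z * h z) ^ 4 = ((∫ z, f₂ z * h z) ^ 2) ^ 2 := by ring
    _ ≤ (∫ y : ℝ × ℝ, f₀ y.1 * f₀ y.2 * k y) ^ 2 := by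
        rw [← swap]
        exact pow_le_pow_left₀ (sq_nonneg _) step1 2
    _ ≤ _ := hbox ▸ step2

/-- The trilinear form along the curve `u ↦ (q u, u)`. -/
noncomputable def tri (w q f₀ f₁ f₂ : ℝ → ℝ) : ℝ :=
  ∫ u, w u * ∫ x, f₀ x * f₁ (x + q u) * f₂ (x + u)

section
variable {w q f₀ g f₂ : ℝ → ℝ}

lemma tri_eq_bilinear (hw : Measurable w) (hw1 : ∀ u, |w u| ≤ 1) (hq : Measurable q)
    (m₀ : Measurable f₀) (m₂ : Measurable f₂) (mg : Measurable g) (b₀ : ∀ x, |f₀ x| ≤ 1)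
    (b₂ : ∀ x, |f₂ x| ≤ 1) (bg : ∀ x, |g x| ≤ 1)
    (s₀ : ∀ x, x ∉ Set.Icc (0 : ℝ) 1 → f₀ x = 0)
    (s₂ : ∀ x, x ∉ Set.Icc (0 : ℝ) 1 → f₂ x = 0) :
    tri w q f₀ g f₂ = ∫ z, f₂ z * ∫ x, f₀ x * (w (z - x) * g (x + q (z - x))) := by
  have hb : ∀ a b c d : ℝ, |f₀ a * g b * f₂ c * w d| ≤ 1 := fun a b c d => by
    simp only [abs_mul]
    exact mul_le_one₀ (mul_le_one₀ (mul_le_one₀ (b₀ _) (abs_nonneg _) (bg _)) (abs_nonneg _)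
      (b₂ _)) (abs_nonneg _) (hw1 _)
  have i1 : Integrable (Function.uncurry fun u x : ℝ => f₀ x * g (x + q u) * f₂ (x + u) * w u)
      (volume.prod volume) := by
    refine integrable_of_bounded_support (S := Set.Icc (-1) 1 ×ˢ Set.Icc 0 1) (C := 1)
      (Measurable.aestronglyMeasurable (by simp only [Function.uncurry_def]; fun_prop)) ?_ ?_ ?_
    · rw [Measure.prod_prod]; norm_num
    · rintro ⟨u, x⟩ h
      simp only [Function.uncurry_apply_pair]
      by_cases hx : x ∈ Set.Icc (0 : ℝ) 1
      · have : x + u ∉ Set.Icc (0 : ℝ) 1 := fun h' => h ⟨⟨by linarith [hx.2, h'.1],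
          by linarith [hx.1, h'.2]⟩, hx⟩
        simp [s₂ _ this]
      · simp [s₀ _ hx]
    · rintro ⟨u, x⟩; exact hb _ _ _ _
  have i2 : Integrable (Function.uncurry fun x z : ℝ =>
      f₀ x * g (x + q (z - x)) * f₂ z * w (z - x)) (volume.prod volume) := by
    refine integrable_of_bounded_support (S := Set.Icc 0 1 ×ˢ Set.Icc 0 1) (C := 1)
      (Measurable.aestronglyMeasurable (by simp only [Function.uncurry_def]; fun_prop)) ?_ ?_ ?_
    · rw [Measure.prod_prod]; norm_num
    · rintro ⟨x, z⟩ h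
      simp only [Set.mem_prod, not_and_or] at h
      rcases h with h | h
      · simp [s₀ _ h]
      · simp [s₂ _ h]
    · rintro ⟨u, x⟩; exact hb _ _ _ _
  calc tri w q f₀ g f₂ = ∫ u, ∫ x, f₀ x * g (x + q u) * f₂ (x + u) * w u := by
        simp only [tri, integral_mul_const]
        exact integral_congr_ae (Filter.Eventually.of_forall fun u => mul_comm _ _)
    _ = ∫ x, ∫ u, f₀ x * g (x + q u) * f₂ (x + u) * w u := integral_integral_swap i1
    _ = ∫ x, ∫ z, f₀ x * g (x + q (z - x)) * f₂ z * w (z - x) := by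
        refine integral_congr_ae (Filter.Eventually.of_forall fun x => ?_)
        have := integral_add_left_eq_self (μ := volume)
          (fun z => f₀ x * g (x + q (z - x)) * f₂ z * w (z - x)) x
        simpa only [add_sub_cancel_left] using this
    _ = ∫ z, ∫ x, f₀ x * g (x + q (z - x)) * f₂ z * w (z - x) := integral_integral_swap i2
    _ = _ := by
        refine integral_congr_ae (Filter.Eventually.of_forall fun z => ?_)
        beta_reduce
        rw [← integral_const_mul]
        refine integral_congr_ae (Filter.Eventually.of_forall fun x => ?_)
        ring

lemma tendsto_tri (hw : Measurable w) (hw1 : ∀ u, |w u| ≤ 1) (hq : Measurable q)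
    (m₀ : Measurable f₀) (m₂ : Measurable f₂) {G : ℕ → ℝ → ℝ} (mG : ∀ n, Measurable (G n))
    (bG : ∀ n x, |G n x| ≤ 1)
    (hG : ∀ᵐ x, Filter.Tendsto (fun n => G n x) Filter.atTop (nhds (g x)))
    (b₀ : ∀ x, |f₀ x| ≤ 1) (b₂ : ∀ x, |f₂ x| ≤ 1)
    (s₀ : ∀ x, x ∉ Set.Icc (0 : ℝ) 1 → f₀ x = 0)
    (s₂ : ∀ x, x ∉ Set.Icc (0 : ℝ) 1 → f₂ x = 0) :
    Filter.Tendsto (fun n => tri w q f₀ (G n) f₂) Filter.atTop (nhds (tri w q f₀ g f₂)) := by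
  have hb : ∀ n a b c, |f₀ a * G n b * f₂ c| ≤ 1 := fun n a b c => by
    simp only [abs_mul]
    exact mul_le_one₀ (mul_le_one₀ (b₀ _) (abs_nonneg _) (bG n _)) (abs_nonneg _) (b₂ _)
  have hin : ∀ n u, |∫ x, f₀ x * G n (x + q u) * f₂ (x + u)| ≤ 1 := fun n u => by
    have := abs_integral_le_of_bounded_support (μ := volume) (S := Set.Icc (0 : ℝ) 1) (C := 1)
      (f := fun x => f₀ x * G n (x + q u) * f₂ (x + u)) (by simp) (fun x hx => by simp [s₀ x hx])
      fun x => hb n _ _ _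
    simpa using this
  refine tendsto_integral_of_dominated_convergence ((Set.Icc (-1 : ℝ) 1).indicator fun _ => 1)
    (fun n => ?_) ?_ (fun n => Filter.Eventually.of_forall fun u => ?_)
    (Filter.Eventually.of_forall fun u => ?_)
  · have : StronglyMeasurable fun y : ℝ × ℝ => f₀ y.2 * G n (y.2 + q y.1) * f₂ (y.2 + y.1) := by
      have := mG n
      exact Measurable.stronglyMeasurable (by fun_prop)
    exact (hw.mul this.integral_prod_right.measurable).aestronglyMeasurable
  · exact (integrable_indicator_iff measurableSet_Icc).2 (integrableOn_const (by simp))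
  · by_cases hu : u ∈ Set.Icc (-1 : ℝ) 1
    · rw [Set.indicator_of_mem hu, Real.norm_eq_abs, abs_mul]
      exact mul_le_one₀ (hw1 u) (abs_nonneg _) (hin n u)
    · rw [Set.indicator_of_notMem hu]
      have : ∀ x, f₀ x * G n (x + q u) * f₂ (x + u) = 0 := fun x => by
        by_cases hx : x ∈ Set.Icc (0 : ℝ) 1
        · have : x + u ∉ Set.Icc (0 : ℝ) 1 := fun h' => hu ⟨by linarith [hx.2, h'.1],
            by linarith [hx.1, h'.2]⟩
          simp [s₂ _ this]
        · simp [s₀ _ hx]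
      simp [this]
  · refine Filter.Tendsto.const_mul _ ?_
    refine tendsto_integral_of_dominated_convergence ((Set.Icc (0 : ℝ) 1).indicator fun _ => 1)
      (fun n => ?_) ?_ (fun n => Filter.Eventually.of_forall fun x => ?_) ?_
    · have := mG n
      exact Measurable.aestronglyMeasurable (by fun_prop)
    · exact (integrable_indicator_iff measurableSet_Icc).2 (integrableOn_const (by simp))
    · by_cases hx : x ∈ Set.Icc (0 : ℝ) 1
      · rw [Set.indicator_of_mem hx]; exact hb _ _ _ _
      · simp [s₀ x hx, Set.indicator_of_notMem hx]
    · have := (measurePreserving_add_right (volume : Measure ℝ) (q u)).quasiMeasurePreserving.ae hG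
      filter_upwards [this] with x hx
      exact (hx.const_mul _).mul_const _

end

/-- The Steklov average of `g`. -/
noncomputable def steklov (h : ℝ) (g : ℝ → ℝ) (x : ℝ) : ℝ := h⁻¹ * ∫ t in x..x + h, g t

section steklov
variable {g : ℝ → ℝ} {h v : ℝ}

lemma intervalIntegrable_of_abs_le_one (mg : Measurable g) (bg : ∀ x, |g x| ≤ 1) (a b : ℝ) :
    IntervalIntegrable g volume a b := by
  rw [intervalIntegrable_iff]
  exact Measure.integrableOn_of_bounded (M := 1) (by simp) mg.aestronglyMeasurable
    (Filter.Eventually.of_forall bg)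

lemma steklov_eq (mg : Measurable g) (bg : ∀ x, |g x| ≤ 1) (x : ℝ) :
    steklov h g x = h⁻¹ * ((∫ t in 0..x + h, g t) - ∫ t in 0..x, g t) := by
  have ii := intervalIntegrable_of_abs_le_one mg bg
  rw [steklov, intervalIntegral.integral_interval_sub_left (ii _ _) (ii _ _)]

lemma continuous_primitive_of_abs_le_one (mg : Measurable g) (bg : ∀ x, |g x| ≤ 1) :
    Continuous fun x => ∫ t in 0..x, g t :=
  intervalIntegral.continuous_primitive (intervalIntegrable_of_abs_le_one mg bg) 0

lemma continuous_steklov (mg : Measurable g) (bg : ∀ x, |g x| ≤ 1) :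
    Continuous (steklov h g) := by
  have : steklov h g = fun x => h⁻¹ * ((∫ t in 0..x + h, g t) - ∫ t in 0..x, g t) :=
    funext (steklov_eq mg bg)
  rw [this]
  have hc := continuous_primitive_of_abs_le_one mg bg
  exact continuous_const.mul ((hc.comp (continuous_add_const h)).sub hc)

lemma abs_steklov_le_one (bg : ∀ x, |g x| ≤ 1) (hh : 0 < h) (x : ℝ) : |steklov h g x| ≤ 1 := by
  have := intervalIntegral.norm_integral_le_of_norm_le_const (a := x) (b := x + h) (f := g) (C := 1)
    fun y _ => bg y
  rw [Real.norm_eq_abs] at this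
  rw [steklov, abs_mul, abs_inv, abs_of_pos hh, inv_mul_le_one₀ hh]
  simpa [abs_of_pos hh] using this

lemma abs_integral_steklov_le (mg : Measurable g) (bg : ∀ x, |g x| ≤ 1) (hh : 0 < h)
    (hv : ∀ a b, |∫ x in a..b, g x| ≤ v) (a b : ℝ) : |∫ x in a..b, steklov h g x| ≤ v := by
  have ii := intervalIntegrable_of_abs_le_one mg bg
  have hc := continuous_primitive_of_abs_le_one mg bg
  set F : ℝ → ℝ := fun x => ∫ t in 0..x, g t with hF
  have jj : ∀ a b, IntervalIntegrable F volume a b := fun a b => hc.intervalIntegrable a b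
  have hFi : ∫ x in a..b, steklov h g x = h⁻¹ * ∫ t in 0..h, (F (b + t) - F (a + t)) := by
    have es : ∀ x, steklov h g x = h⁻¹ * (F (x + h) - F x) := steklov_eq mg bg
    simp_rw [es]
    have jh : IntervalIntegrable (fun x => F (x + h)) volume a b :=
      (hc.comp (continuous_add_const h)).intervalIntegrable _ _
    have jt : ∀ c, IntervalIntegrable (fun t => F (c + t)) volume 0 h := fun c =>
      (hc.comp (continuous_const_add c)).intervalIntegrable _ _
    rw [intervalIntegral.integral_const_mul, intervalIntegral.integral_sub jh (jj _ _),
      intervalIntegral.integral_sub (jt b) (jt a)]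
    have e1 := intervalIntegral.integral_comp_add_right F h (a := a) (b := b)
    have e2 := intervalIntegral.integral_comp_add_left F b (a := 0) (b := h)
    have e3 := intervalIntegral.integral_comp_add_left F a (a := 0) (b := h)
    rw [e1, e2, e3, add_zero, add_zero]
    have k1 := intervalIntegral.integral_add_adjacent_intervals (jj a b) (jj b (b + h))
    have k2 := intervalIntegral.integral_add_adjacent_intervals (jj a (a + h)) (jj (a + h) (b + h))
    congr 1
    linarith
  have hd : ∀ t, |F (b + t) - F (a + t)| ≤ v := fun t => by
    rw [hF]
    simp only
    rw [intervalIntegral.integral_interval_sub_left (ii _ _) (ii _ _)]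
    exact hv _ _
  have := intervalIntegral.norm_integral_le_of_norm_le_const (a := 0) (b := h) (C := v)
    (f := fun t => F (b + t) - F (a + t)) fun y _ => hd y
  rw [Real.norm_eq_abs, sub_zero, abs_of_pos hh] at this
  rw [hFi, abs_mul, abs_inv, abs_of_pos hh, inv_mul_le_iff₀ hh]
  linarith

lemma hasDerivAt_steklov (hg : Continuous g) (bg : ∀ x, |g x| ≤ 1) (x : ℝ) :
    HasDerivAt (steklov h g) (h⁻¹ * (g (x + h) - g x)) x := by
  have : steklov h g = fun x => h⁻¹ * ((∫ t in 0..x + h, g t) - ∫ t in 0..x, g t) :=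
    funext (steklov_eq hg.measurable bg)
  rw [this]
  have hd : ∀ y, HasDerivAt (fun x => ∫ t in 0..x, g t) (g y) y := fun y =>
    intervalIntegral.integral_hasDerivAt_right (hg.intervalIntegrable _ _)
      hg.stronglyMeasurable.stronglyMeasurableAtFilter hg.continuousAt
  exact ((((hd (x + h)).comp_add_const x h)).sub (hd x)).const_mul _

lemma ae_tendsto_steklov (mg : Measurable g) (bg : ∀ x, |g x| ≤ 1) :
    ∀ᵐ x, Filter.Tendsto (fun n : ℕ => steklov (1 / ((n : ℝ) + 1)) g x) Filter.atTop
      (nhds (g x)) := by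
  have hl : LocallyIntegrable g volume := by
    refine (locallyIntegrable_const (1 : ℝ)).mono mg.aestronglyMeasurable ?_
    exact Filter.Eventually.of_forall fun x => by simpa using bg x
  filter_upwards [LocallyIntegrable.ae_hasDerivAt_integral hl] with x hx
  have h1 := (hasDerivAt_iff_tendsto_slope_zero.1 (hx 0))
  have h2 : Filter.Tendsto (fun n : ℕ => 1 / ((n : ℝ) + 1)) Filter.atTop (nhdsWithin 0 {0}ᶜ) :=
    tendsto_nhdsWithin_iff.2 ⟨tendsto_one_div_add_atTop_nhds_zero_nat,
      Filter.Eventually.of_forall fun n => by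
        simp only [Set.mem_compl_iff, Set.mem_singleton_iff]; positivity⟩
  refine (h1.comp h2).congr fun n => ?_
  rw [steklov_eq mg bg]
  simp

end steklov

section
variable {s M v B η : ℝ} {q p ν w g f₀ f₂ : ℝ → ℝ} {U : Set ℝ}

lemma abs_tri_le_of_bddC1 (hC : CurveData s M q p ν) (hw : CurvedCutoff M p ν w U)
    (m₀ : Measurable f₀) (m₂ : Measurable f₂) (b₀ : ∀ x, |f₀ x| ≤ 1) (b₂ : ∀ x, |f₂ x| ≤ 1)
    (s₀ : ∀ x, x ∉ Set.Icc (0 : ℝ) 1 → f₀ x = 0) (s₂ : ∀ x, x ∉ Set.Icc (0 : ℝ) 1 → f₂ x = 0)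
    (hg : BddC1 g B) (bg : ∀ x, |g x| ≤ 1) (hv : ∀ a b, |∫ x in a..b, g x| ≤ v)
    (hη : 0 < η) (hη1 : η ≤ 1) (hvη : v * (2 ^ 121 * M ^ 33) ≤ s * η ^ 28) :
    |tri w q f₀ g f₂| ≤ η := by
  have hM : 6 ≤ M := hC.M_large
  have hs := hC.s_pos
  have hgc : Continuous g := hg.diff.continuous
  have hwc : Continuous w := hw.bdd.diff.continuous
  have hqc : Continuous q := continuous_iff_continuousAt.2 fun u => (hC.hasDerivAt u).continuousAt
  have hw1 : ∀ u, |w u| ≤ 1 := fun u => by rw [abs_of_nonneg (hw.nonneg u)]; exact hw.le_one u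
  have hK := bilinear_pow_four_le (K := fun y => w (y.2 - y.1) * g (y.1 + q (y.2 - y.1)))
    (by fun_prop) (fun y => by
      rw [abs_mul]; exact mul_le_one₀ (hw1 _) (abs_nonneg _) (bg _)) m₀ m₂ b₀ b₂ s₀ s₂
  rw [← tri_eq_bilinear hwc.measurable hw1 hqc.measurable m₀ m₂ hgc.measurable b₀ b₂ bg s₀ s₂]
    at hK
  set r := η ^ 4 / (2 ^ 13 * M ^ 4) with hr
  have hr0 : 0 < r := by positivity
  have hrM : r * M ^ 4 ≤ 1 := by
    have : r * M ^ 4 = η ^ 4 / 2 ^ 13 := by rw [hr]; field_simp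
    rw [this]
    have := pow_le_one₀ (n := 4) hη.le hη1
    linarith
  have hbox := Quad.abs_integral_corners_le hC hw hr0 hrM
    (G := fun x => ∫ t in 0..x, g t) (fun y => intervalIntegral.integral_hasDerivAt_right
      (hgc.intervalIntegrable _ _) hgc.stronglyMeasurable.stronglyMeasurableAtFilter
      hgc.continuousAt) hg bg (fun y => hv 0 y)
  have e1 : (fun P : Quad => Quad.weight P *
      (w (P.2.1 - P.1.1) * g (P.1.1 + q (P.2.1 - P.1.1)) *
        (w (P.2.2 - P.1.1) * g (P.1.1 + q (P.2.2 - P.1.1))) *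
        (w (P.2.1 - P.1.2) * g (P.1.2 + q (P.2.1 - P.1.2)) *
        (w (P.2.2 - P.1.2) * g (P.1.2 + q (P.2.2 - P.1.2)))))) =
      fun P => Quad.weight P * Quad.diffWeight w P * Quad.corners q g g P := by
    funext P; simp only [Quad.diffWeight, Quad.corners]; ring
  rw [e1] at hK
  have h4 : (tri w q f₀ g f₂) ^ 4 ≤ η ^ 4 := by
    refine (hK.trans (le_abs_self _)).trans (hbox.trans ?_)
    have t1 : 2 ^ 12 * r ≤ η ^ 4 / 2 := by
      have : 2 ^ 12 * r = η ^ 4 / 2 * (M ^ 4)⁻¹ := by rw [hr]; field_simp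
      rw [this]
      have : (M ^ 4)⁻¹ ≤ 1 := inv_le_one_of_one_le₀ (one_le_pow₀ (by linarith))
      have h0 : 0 ≤ η ^ 4 / 2 := by positivity
      nlinarith
    have t2 : 2 ^ 42 * M ^ 9 * (r ^ 6)⁻¹ * (v / s) ≤ η ^ 4 / 2 := by
      have : 2 ^ 42 * M ^ 9 * (r ^ 6)⁻¹ * (v / s) =
          v * (2 ^ 121 * M ^ 33) * (2 * (η ^ 24 * s))⁻¹ := by
        rw [hr]; field_simp
      rw [this]
      calc v * (2 ^ 121 * M ^ 33) * (2 * (η ^ 24 * s))⁻¹ ≤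
            s * η ^ 28 * (2 * (η ^ 24 * s))⁻¹ := by gcongr
        _ = η ^ 4 / 2 := by field_simp
    linarith
  have h5 : |tri w q f₀ g f₂| ^ 4 ≤ η ^ 4 := by rwa [Even.pow_abs (by decide)]
  exact le_of_pow_le_pow_left₀ (by norm_num) hη.le h5

/-- A trilinear form along a curved arc is small if its middle function has small averages. -/
theorem abs_tri_le (hC : CurveData s M q p ν) (hw : CurvedCutoff M p ν w U)
    (m₀ : Measurable f₀) (m₂ : Measurable f₂) (b₀ : ∀ x, |f₀ x| ≤ 1) (b₂ : ∀ x, |f₂ x| ≤ 1)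
    (s₀ : ∀ x, x ∉ Set.Icc (0 : ℝ) 1 → f₀ x = 0) (s₂ : ∀ x, x ∉ Set.Icc (0 : ℝ) 1 → f₂ x = 0)
    (mg : Measurable g) (bg : ∀ x, |g x| ≤ 1) (hv : ∀ a b, |∫ x in a..b, g x| ≤ v)
    (hη : 0 < η) (hη1 : η ≤ 1) (hvη : v * (2 ^ 121 * M ^ 33) ≤ s * η ^ 28) :
    |tri w q f₀ g f₂| ≤ η := by
  have hwc : Continuous w := hw.bdd.diff.continuous
  have hqc : Continuous q := continuous_iff_continuousAt.2 fun u => (hC.hasDerivAt u).continuousAt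
  have hw1 : ∀ u, |w u| ≤ 1 := fun u => by rw [abs_of_nonneg (hw.nonneg u)]; exact hw.le_one u
  have hp : ∀ n : ℕ, (0 : ℝ) < 1 / ((n : ℝ) + 1) := fun n => by positivity
  have reduce : ∀ g : ℝ → ℝ, Measurable g → (∀ x, |g x| ≤ 1) →
      (∀ n : ℕ, |tri w q f₀ (steklov (1 / ((n : ℝ) + 1)) g) f₂| ≤ η) →
      |tri w q f₀ g f₂| ≤ η := fun g mg bg h =>
    le_of_tendsto (tendsto_tri hwc.measurable hw1 hqc.measurable m₀ m₂
      (fun n => (continuous_steklov mg bg).measurable) (fun n => abs_steklov_le_one bg (hp n))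
      (ae_tendsto_steklov mg bg) b₀ b₂ s₀ s₂).abs (Filter.Eventually.of_forall h)
  refine reduce g mg bg fun n => ?_
  have c1 : Continuous (steklov (1 / ((n : ℝ) + 1)) g) := continuous_steklov mg bg
  have b1 := abs_steklov_le_one bg (hp n)
  have v1 := abs_integral_steklov_le mg bg (hp n) hv
  refine reduce _ c1.measurable b1 fun m => ?_
  refine abs_tri_le_of_bddC1 (B := max 1 (((1 / ((m : ℝ) + 1))⁻¹) * 2)) hC hw m₀ m₂ b₀ b₂ s₀ s₂
    (BddC1.of_hasDerivAt (hasDerivAt_steklov c1 b1) (fun y =>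
      (abs_steklov_le_one b1 (hp m) y).trans (le_max_left _ _)) fun y => le_trans ?_
      (le_max_right _ _)) (abs_steklov_le_one b1 (hp m))
    (abs_integral_steklov_le c1.measurable b1 (hp m) v1) hη hη1 hvη
  rw [abs_mul, abs_of_pos (inv_pos.2 (hp m))]
  have := (abs_sub (steklov (1 / ((n : ℝ) + 1)) g (y + 1 / ((m : ℝ) + 1)))
    (steklov (1 / ((n : ℝ) + 1)) g y)).trans (add_le_add (b1 _) (b1 _))
  exact mul_le_mul_of_nonneg_left (by linarith) (inv_pos.2 (hp m)).le

/-- Averages against a `C¹` weight are small if all integrals over intervals are small. -/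
lemma abs_integral_mul_le_of_hasDerivAt {w' : ℝ → ℝ} {L : ℝ} (hw : ∀ u, HasDerivAt w (w' u) u)
    (hw' : Measurable w')
    (hL : ∀ u, |w' u| ≤ L) (hw0 : ∀ u, u ∉ Set.Icc (-1 : ℝ) 1 → w u = 0) (mg : Measurable g)
    (bg : ∀ x, |g x| ≤ 1) (hv : ∀ a b, |∫ x in a..b, g x| ≤ v) :
    |∫ u, w u * g u| ≤ 2 * L * v := by
  have hL0 : 0 ≤ L := (abs_nonneg _).trans (hL 0)
  have hv0 : 0 ≤ v := (abs_nonneg _).trans (hv 0 0)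
  have hw'0 : ∀ u, u ∉ Set.Icc (-1 : ℝ) 1 → w' u = 0 := by
    intro u hu
    have : w =ᶠ[nhds u] fun _ => 0 := by
      filter_upwards [isClosed_Icc.isOpen_compl.mem_nhds hu] with y hy using hw0 y hy
    exact (hw u).unique ((hasDerivAt_const u (0 : ℝ)).congr_of_eventuallyEq this)
  have hwi : ∀ u, w u = ∫ t in (-1 : ℝ)..u, w' t := by
    intro u
    have hwm1 : w (-1) = 0 := by
      have hc : Continuous w := continuous_iff_continuousAt.2 fun u => (hw u).continuousAt
      have h1 : Filter.Tendsto w (nhdsWithin (-1) (Set.Iio (-1))) (nhds (w (-1))) :=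
        hc.continuousWithinAt
      refine tendsto_nhds_unique h1 ((tendsto_const_nhds (x := (0 : ℝ))).congr' ?_)
      filter_upwards [self_mem_nhdsWithin] with y hy
      exact (hw0 y fun h => absurd h.1 (not_le.2 hy)).symm
    rw [intervalIntegral.integral_eq_sub_of_hasDerivAt (fun x _ => hw x), hwm1, sub_zero]
    rw [intervalIntegrable_iff]
    exact Measure.integrableOn_of_bounded (M := L) (by simp) hw'.aestronglyMeasurable
      (Filter.Eventually.of_forall hL)
  -- swap the order of integration
  have e1 : ∀ u, w u * g u = ∫ t, (Set.Icc (-1 : ℝ) 1).indicator (fun u => g u *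
      (Set.Ioc (-1) u).indicator w' t) u := by
    intro u
    by_cases hu : u ∈ Set.Icc (-1 : ℝ) 1
    · simp_rw [Set.indicator_of_mem hu]
      rw [integral_const_mul, integral_indicator measurableSet_Ioc,
        ← intervalIntegral.integral_of_le hu.1, ← hwi, mul_comm]
    · simp [Set.indicator_of_notMem hu, hw0 u hu]
  have e2 : ∀ t u : ℝ, (Set.Icc (-1 : ℝ) 1).indicator (fun u => g u *
      (Set.Ioc (-1) u).indicator w' t) u = w' t * ((Set.Icc (max (-1) t) 1).indicator g u *
        (Set.Ioc (-1 : ℝ) 1).indicator 1 t) := by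
    intro t u
    simp only [Set.indicator_apply, Set.mem_Icc, Set.mem_Ioc, max_le_iff, Pi.one_apply]
    split_ifs <;> first | ring1 | (exfalso; grind)
  simp_rw [e1, e2]
  rw [integral_integral_swap]
  · simp_rw [integral_const_mul, integral_mul_const]
    refine (abs_integral_le_of_bounded_support (S := Set.Icc (-1 : ℝ) 1) (C := L * v) (by simp)
      (fun t ht => by simp [hw'0 t ht]) fun t => ?_).trans (le_of_eq ?_)
    · rw [abs_mul]
      refine mul_le_mul (hL t) ?_ (abs_nonneg _) hL0
      by_cases ht : t ∈ Set.Ioc (-1 : ℝ) 1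
      · rw [Set.indicator_of_mem ht, Pi.one_apply, mul_one, integral_indicator measurableSet_Icc,
          integral_Icc_eq_integral_Ioc, ← intervalIntegral.integral_of_le (by simpa using ht.2)]
        exact hv _ _
      · simpa [Set.indicator_of_notMem ht] using hv0
    · simp; ring
  · refine integrable_of_bounded_support (S := Set.Icc (-1) 1 ×ˢ Set.Icc (-1) 1) (C := L) ?_ ?_ ?_ ?_
    · refine Measurable.aestronglyMeasurable ?_
      simp only [Function.uncurry_def]
      refine (hw'.comp measurable_snd).mul (Measurable.mul ?_ ?_)
      · have : (fun y : ℝ × ℝ => (Set.Icc (max (-1) y.2) 1).indicator g y.1) =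
            {y : ℝ × ℝ | max (-1) y.2 ≤ y.1 ∧ y.1 ≤ 1}.indicator fun y => g y.1 := by
          funext y; simp [Set.indicator_apply]
        rw [this]
        refine (mg.comp measurable_fst).indicator ?_
        have h1 : MeasurableSet {y : ℝ × ℝ | max (-1) y.2 ≤ y.1} :=
          measurableSet_le (by fun_prop) (by fun_prop)
        have h2 : MeasurableSet {y : ℝ × ℝ | y.1 ≤ 1} :=
          measurableSet_le (by fun_prop) (by fun_prop)
        exact h1.inter h2
      · exact (measurable_one.indicator measurableSet_Ioc).comp measurable_snd
    · rw [Measure.prod_prod]; norm_num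
    · rintro ⟨u, t⟩ h
      simp only [Set.mem_prod, not_and_or] at h
      simp only [Function.uncurry_apply_pair]
      rcases h with h | h
      · have : u ∉ Set.Icc (max (-1) t) 1 := fun h' => h ⟨(le_max_left _ _).trans h'.1, h'.2⟩
        simp [Set.indicator_of_notMem this]
      · simp [hw'0 t h]
    · rintro ⟨u, t⟩
      simp only [Function.uncurry_apply_pair]
      rw [abs_mul, abs_mul]
      have h1 : |(Set.Icc (max (-1) t) 1).indicator g u| ≤ 1 := by
        rw [Set.indicator_apply]; split_ifs
        · exact bg u
        · simp
      have h2 : |(Set.Ioc (-1 : ℝ) 1).indicator (1 : ℝ → ℝ) t| ≤ 1 := by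
        rw [Set.indicator_apply]; split_ifs <;> simp
      have := mul_le_mul (hL t) (mul_le_one₀ h1 (abs_nonneg _) h2) (by positivity) hL0
      linarith

end

/-- The average of `f` over the dyadic interval of length `2⁻ʲ` containing `x`. -/
noncomputable def dyadicAvg (j : ℕ) (f : ℝ → ℝ) (x : ℝ) : ℝ :=
  2 ^ j * ∫ t in (⌊2 ^ j * x⌋ : ℝ) / 2 ^ j..((⌊2 ^ j * x⌋ : ℝ) + 1) / 2 ^ j, f t

section dyadic
variable {f : ℝ → ℝ} {j k : ℕ}

lemma measurable_comp_floor (H : ℤ → ℝ) : Measurable fun x : ℝ => H ⌊2 ^ j * x⌋ :=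
  (measurable_of_countable H).comp (Int.measurable_floor.comp (measurable_const_mul _))

lemma measurable_dyadicAvg : Measurable (dyadicAvg j f) :=
  measurable_comp_floor fun i => 2 ^ j * ∫ t in (i : ℝ) / 2 ^ j..((i : ℝ) + 1) / 2 ^ j, f t

lemma dyadicAvg_mem_Icc (mf : Measurable f) (f0 : ∀ x, 0 ≤ f x) (f1 : ∀ x, f x ≤ 1) (x : ℝ) :
    dyadicAvg j f x ∈ Set.Icc (0 : ℝ) 1 := by
  have hf : ∀ x, |f x| ≤ 1 := fun x => by rw [abs_of_nonneg (f0 x)]; exact f1 x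
  have hle : (⌊2 ^ j * x⌋ : ℝ) / 2 ^ j ≤ ((⌊2 ^ j * x⌋ : ℝ) + 1) / 2 ^ j := by gcongr; simp
  refine ⟨mul_nonneg (by positivity) (intervalIntegral.integral_nonneg hle fun t _ => f0 t), ?_⟩
  have h1 : ∫ t in (⌊2 ^ j * x⌋ : ℝ) / 2 ^ j..((⌊2 ^ j * x⌋ : ℝ) + 1) / 2 ^ j, f t ≤
      ∫ t in (⌊2 ^ j * x⌋ : ℝ) / 2 ^ j..((⌊2 ^ j * x⌋ : ℝ) + 1) / 2 ^ j, (1 : ℝ) :=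
    intervalIntegral.integral_mono_on hle (intervalIntegrable_of_abs_le_one mf hf _ _)
      (by simp) fun t _ => f1 t
  rw [intervalIntegral.integral_const, smul_eq_mul, mul_one] at h1
  calc dyadicAvg j f x ≤ 2 ^ j * (((⌊2 ^ j * x⌋ : ℝ) + 1) / 2 ^ j - (⌊2 ^ j * x⌋ : ℝ) / 2 ^ j) :=
        mul_le_mul_of_nonneg_left h1 (by positivity)
    _ = 1 := by field_simp; ring

lemma abs_dyadicAvg_le (mf : Measurable f) (f0 : ∀ x, 0 ≤ f x) (f1 : ∀ x, f x ≤ 1) (x : ℝ) :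
    |dyadicAvg j f x| ≤ 1 := by
  have := dyadicAvg_mem_Icc (j := j) mf f0 f1 x
  rw [abs_of_nonneg this.1]; exact this.2

lemma dyadicAvg_eq_zero (hs : ∀ x, x ∉ Set.Icc (0 : ℝ) 1 → f x = 0) {x : ℝ}
    (hx : x ∉ Set.Ico (0 : ℝ) 1) : dyadicAvg j f x = 0 := by
  have h2 : (0 : ℝ) < 2 ^ j := by positivity
  have hle : (⌊2 ^ j * x⌋ : ℝ) / 2 ^ j ≤ ((⌊2 ^ j * x⌋ : ℝ) + 1) / 2 ^ j := by gcongr; simp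
  rw [dyadicAvg, intervalIntegral.integral_of_le hle, integral_Ioc_eq_integral_Ioo,
    setIntegral_eq_zero_of_forall_eq_zero, mul_zero]
  intro t ht
  refine hs t fun h => hx ?_
  rw [Set.mem_Ioo, div_lt_iff₀ h2, lt_div_iff₀ h2] at ht
  constructor
  · by_contra! hn
    have : ⌊2 ^ j * x⌋ < 0 := Int.floor_lt.2 (by push_cast; nlinarith)
    have : (⌊2 ^ j * x⌋ : ℝ) + 1 ≤ 0 := by exact_mod_cast this
    nlinarith [h.1]
  · by_contra! hn
    have : ((2 ^ j : ℕ) : ℤ) ≤ ⌊2 ^ j * x⌋ := Int.le_floor.2 (by push_cast; nlinarith)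
    have : (2 ^ j : ℝ) ≤ ⌊2 ^ j * x⌋ := by exact_mod_cast this
    nlinarith [h.2]

lemma floor_eq_of_mem_cell {i : ℤ} {t : ℝ}
    (ht : t ∈ Set.Ioo ((i : ℝ) / 2 ^ j) (((i : ℝ) + 1) / 2 ^ j)) : ⌊2 ^ j * t⌋ = i := by
  have h2 : (0 : ℝ) < 2 ^ j := by positivity
  rw [Set.mem_Ioo, div_lt_iff₀ h2, lt_div_iff₀ h2] at ht
  rw [Int.floor_eq_iff]
  constructor <;> linarith

lemma integral_cell_sub_dyadicAvg (mf : Measurable f) (bf : ∀ x, |f x| ≤ 1) (H : ℤ → ℝ) (i : ℤ) :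
    ∫ t in (i : ℝ) / 2 ^ j..((i : ℝ) + 1) / 2 ^ j,
      (f t - dyadicAvg j f t) * H ⌊2 ^ j * t⌋ = 0 := by
  have hle : (i : ℝ) / 2 ^ j ≤ ((i : ℝ) + 1) / 2 ^ j := by gcongr; simp
  have e : ∫ t in (i : ℝ) / 2 ^ j..((i : ℝ) + 1) / 2 ^ j,
      (f t - dyadicAvg j f t) * H ⌊2 ^ j * t⌋ = ∫ t in (i : ℝ) / 2 ^ j..((i : ℝ) + 1) / 2 ^ j,
      (f t - 2 ^ j * ∫ t in (i : ℝ) / 2 ^ j..((i : ℝ) + 1) / 2 ^ j, f t) * H i := by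
    rw [intervalIntegral.integral_of_le hle, intervalIntegral.integral_of_le hle,
      integral_Ioc_eq_integral_Ioo, integral_Ioc_eq_integral_Ioo]
    refine setIntegral_congr_fun measurableSet_Ioo fun t ht => ?_
    simp only [dyadicAvg, floor_eq_of_mem_cell ht]
  rw [e, intervalIntegral.integral_mul_const, intervalIntegral.integral_sub
    (intervalIntegrable_of_abs_le_one mf bf _ _) (by simp), intervalIntegral.integral_const]
  simp only [smul_eq_mul]
  have : ((i : ℝ) + 1) / 2 ^ j - i / 2 ^ j = (2 ^ j)⁻¹ := by field_simp; ring
  rw [this, inv_mul_cancel_left₀ (by positivity), sub_self, zero_mul]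

lemma intervalIntegrable_of_abs_le {F : ℝ → ℝ} {C : ℝ} (mF : Measurable F) (bF : ∀ x, |F x| ≤ C)
    (a b : ℝ) : IntervalIntegrable F volume a b := by
  rw [intervalIntegrable_iff]
  exact Measure.integrableOn_of_bounded (M := C) (by simp) mF.aestronglyMeasurable
    (Filter.Eventually.of_forall bF)

lemma integral_sub_dyadicAvg_mul (mf : Measurable f) (f0 : ∀ x, 0 ≤ f x) (f1 : ∀ x, f x ≤ 1)
    {H : ℤ → ℝ} {C : ℝ} (hH : ∀ i, |H i| ≤ C) (n : ℤ) :
    ∫ t in 0..(n : ℝ) / 2 ^ j, (f t - dyadicAvg j f t) * H ⌊2 ^ j * t⌋ = 0 := by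
  have bf : ∀ x, |f x| ≤ 1 := fun x => by rw [abs_of_nonneg (f0 x)]; exact f1 x
  have ii := intervalIntegrable_of_abs_le (C := (1 + 1) * C)
    ((mf.sub measurable_dyadicAvg).mul (measurable_comp_floor (j := j) H)) (F := fun t =>
      (f t - dyadicAvg j f t) * H ⌊2 ^ j * t⌋) fun x => by
        rw [abs_mul]
        exact mul_le_mul ((abs_sub _ _).trans (add_le_add (bf x) (abs_dyadicAvg_le mf f0 f1 x)))
          (hH _) (abs_nonneg _) (by norm_num)
  have key := integral_cell_sub_dyadicAvg (j := j) mf bf H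
  induction n using Int.induction_on with
  | zero => simp
  | succ i ih =>
    rw [← intervalIntegral.integral_add_adjacent_intervals (ii _ _) (ii _ _), ih, zero_add]
    have := key i
    push_cast at this ⊢
    exact this
  | pred i ih =>
    rw [← intervalIntegral.integral_add_adjacent_intervals (ii _ _) (ii _ _), ih, zero_add,
      intervalIntegral.integral_symm]
    have := key (-i - 1)
    push_cast at this ⊢
    rw [sub_add_cancel] at this
    rw [this, neg_zero]

/-- The dyadic averages have the same integral as `f` against step functions. -/
lemma integral_mul_step_eq (mf : Measurable f) (f0 : ∀ x, 0 ≤ f x) (f1 : ∀ x, f x ≤ 1)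
    (hs : ∀ x, x ∉ Set.Icc (0 : ℝ) 1 → f x = 0)
    {H : ℤ → ℝ} {C : ℝ} (hH : ∀ i, |H i| ≤ C) :
    ∫ t, f t * H ⌊2 ^ j * t⌋ = ∫ t, dyadicAvg j f t * H ⌊2 ^ j * t⌋ := by
  have bf : ∀ x, |f x| ≤ 1 := fun x => by rw [abs_of_nonneg (f0 x)]; exact f1 x
  have hd : ∀ x, x ∉ Set.Icc (0 : ℝ) 1 → dyadicAvg j f x = 0 := fun x hx =>
    dyadicAvg_eq_zero hs fun h => hx ⟨h.1, h.2.le⟩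
  have int : ∀ F : ℝ → ℝ, Measurable F → (∀ x, |F x| ≤ 1) →
      (∀ x, x ∉ Set.Icc (0 : ℝ) 1 → F x = 0) → Integrable fun t => F t * H ⌊2 ^ j * t⌋ :=
    fun F mF bF sF => integrable_of_bounded_support (S := Set.Icc 0 1) (C := 1 * C)
      (mF.mul (measurable_comp_floor H)).aestronglyMeasurable (by simp)
      (fun x hx => by rw [sF x hx, zero_mul]) fun x => by
        rw [abs_mul]; exact mul_le_mul (bF x) (hH _) (abs_nonneg _) zero_le_one
  rw [← sub_eq_zero, ← integral_sub (int f mf bf hs) (int _ measurable_dyadicAvg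
    (abs_dyadicAvg_le mf f0 f1) hd)]
  simp_rw [← sub_mul]
  rw [← setIntegral_eq_integral_of_forall_compl_eq_zero (s := Set.Icc (0 : ℝ) 1)
    (fun x hx => by rw [hs x hx, hd x hx, sub_zero, zero_mul]), integral_Icc_eq_integral_Ioc,
    ← intervalIntegral.integral_of_le zero_le_one]
  simpa using integral_sub_dyadicAvg_mul (j := j) mf f0 f1 hH (2 ^ j)

lemma abs_integral_sub_dyadicAvg_le (mf : Measurable f) (f0 : ∀ x, 0 ≤ f x) (f1 : ∀ x, f x ≤ 1)
    (a b : ℝ) : |∫ t in a..b, (f t - dyadicAvg j f t)| ≤ 2 * (2 ^ j)⁻¹ := by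
  have h2 : (0 : ℝ) < 2 ^ j := by positivity
  have b1 : ∀ x, |f x - dyadicAvg j f x| ≤ 1 := fun x => by
    have := dyadicAvg_mem_Icc (j := j) mf f0 f1 x
    rw [abs_le]; constructor <;> linarith [f0 x, f1 x, this.1, this.2]
  have ii : ∀ a b, IntervalIntegrable (fun x => f x - dyadicAvg j f x) volume a b :=
    intervalIntegrable_of_abs_le_one (mf.sub measurable_dyadicAvg) b1
  have h0 : ∀ x : ℝ, |∫ t in 0..x, (f t - dyadicAvg j f t)| ≤ (2 ^ j)⁻¹ := by
    intro x
    have h3 : ∫ t in 0..(⌊2 ^ j * x⌋ : ℝ) / 2 ^ j, (f t - dyadicAvg j f t) = 0 := by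
      simpa using integral_sub_dyadicAvg_mul (j := j) mf f0 f1 (H := fun _ => 1) (C := 1)
        (by simp) ⌊2 ^ j * x⌋
    rw [← intervalIntegral.integral_add_adjacent_intervals (ii 0 ((⌊2 ^ j * x⌋ : ℝ) / 2 ^ j))
      (ii _ x), h3, zero_add]
    refine (intervalIntegral.norm_integral_le_of_norm_le_const (C := 1)
      (f := fun t => f t - dyadicAvg j f t) fun t _ => b1 t).trans ?_
    have h4 := Int.floor_le (2 ^ j * x)
    have h5 := Int.lt_floor_add_one (2 ^ j * x)
    have h6 : x - (⌊2 ^ j * x⌋ : ℝ) / 2 ^ j = (2 ^ j * x - ⌊2 ^ j * x⌋) * (2 ^ j)⁻¹ := by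
      field_simp
    rw [h6, one_mul, abs_mul, abs_of_nonneg (sub_nonneg.2 h4), abs_of_pos (inv_pos.2 h2)]
    exact mul_le_of_le_one_left (inv_pos.2 h2).le (by linarith)
  rw [← intervalIntegral.integral_interval_sub_left (ii 0 b) (ii 0 a)]
  refine (abs_sub _ _).trans ?_
  linarith [h0 a, h0 b]

end dyadic

section dyadic
variable {f : ℝ → ℝ} {j k : ℕ}

lemma dyadicAvg_floor_div (hjk : j ≤ k) (x : ℝ) :
    dyadicAvg j f ((⌊2 ^ k * x⌋ : ℤ) / 2 ^ k) = dyadicAvg j f x := by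
  have h : ∀ y : ℝ, ⌊2 ^ j * (y / 2 ^ k)⌋ = ⌊y⌋ / (2 ^ (k - j) : ℕ) := by
    intro y
    rw [← Int.floor_div_natCast]
    congr 1
    obtain ⟨d, rfl⟩ := Nat.exists_eq_add_of_le hjk
    push_cast
    rw [Nat.add_sub_cancel_left, pow_add]
    field_simp
  have h1 := h (2 ^ k * x)
  rw [mul_div_cancel_left₀ _ (by positivity)] at h1
  have h2 := h (⌊2 ^ k * x⌋ : ℤ)
  rw [Int.floor_intCast, ← h1] at h2
  simp only [dyadicAvg, h2]

lemma integrable_of_support_Icc {F : ℝ → ℝ} (mF : Measurable F) (bF : ∀ x, |F x| ≤ 1)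
    (sF : ∀ x, x ∉ Set.Icc (0 : ℝ) 1 → F x = 0) : Integrable F :=
  integrable_of_bounded_support (S := Set.Icc 0 1) mF.aestronglyMeasurable (by simp) sF bF

lemma integral_mul_dyadicAvg_eq (mf : Measurable f) (f0 : ∀ x, 0 ≤ f x) (f1 : ∀ x, f x ≤ 1)
    (hs : ∀ x, x ∉ Set.Icc (0 : ℝ) 1 → f x = 0) {i : ℕ} (hij : i ≤ k) (hjk : j ≤ k) :
    ∫ t, f t * (dyadicAvg i f t * dyadicAvg j f t) =
      ∫ t, dyadicAvg k f t * (dyadicAvg i f t * dyadicAvg j f t) := by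
  have := integral_mul_step_eq (j := k) mf f0 f1 hs (C := 1) (H := fun n =>
    dyadicAvg i f (n / 2 ^ k) * dyadicAvg j f (n / 2 ^ k)) fun n => by
      rw [abs_mul]
      exact mul_le_one₀ (abs_dyadicAvg_le mf f0 f1 _) (abs_nonneg _) (abs_dyadicAvg_le mf f0 f1 _)
  simpa only [dyadicAvg_floor_div hij, dyadicAvg_floor_div hjk] using this

lemma integral_mul_dyadicAvg (mf : Measurable f) (f0 : ∀ x, 0 ≤ f x) (f1 : ∀ x, f x ≤ 1)
    (hs : ∀ x, x ∉ Set.Icc (0 : ℝ) 1 → f x = 0) (hjk : j ≤ k) :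
    ∫ t, f t * dyadicAvg j f t = ∫ t, dyadicAvg k f t * dyadicAvg j f t := by
  have := integral_mul_step_eq (j := k) mf f0 f1 hs (C := 1) (H := fun n =>
    dyadicAvg j f (n / 2 ^ k)) fun n => abs_dyadicAvg_le mf f0 f1 _
  simpa only [dyadicAvg_floor_div hjk] using this

lemma integral_dyadicAvg (mf : Measurable f) (f0 : ∀ x, 0 ≤ f x) (f1 : ∀ x, f x ≤ 1)
    (hs : ∀ x, x ∉ Set.Icc (0 : ℝ) 1 → f x = 0) : ∫ t, dyadicAvg j f t = ∫ t, f t := by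
  simpa using (integral_mul_step_eq (j := j) mf f0 f1 hs (C := 1) (H := fun _ => 1) (by simp)).symm

lemma integrable_dyadicAvg_mul (mf : Measurable f) (f0 : ∀ x, 0 ≤ f x) (f1 : ∀ x, f x ≤ 1)
    (hs : ∀ x, x ∉ Set.Icc (0 : ℝ) 1 → f x = 0) {g : ℝ → ℝ} (mg : Measurable g)
    (bg : ∀ x, |g x| ≤ 1) : Integrable fun t => dyadicAvg j f t * g t :=
  integrable_of_support_Icc (measurable_dyadicAvg.mul mg) (fun x => by
    rw [abs_mul]; exact mul_le_one₀ (abs_dyadicAvg_le mf f0 f1 _) (abs_nonneg _) (bg _))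
    fun x hx => by rw [dyadicAvg_eq_zero hs fun h => hx ⟨h.1, h.2.le⟩, zero_mul]

/-- The `L²` norms of the dyadic averages increase by the norms of their differences. -/
lemma integral_sq_dyadicAvg_sub (mf : Measurable f) (f0 : ∀ x, 0 ≤ f x) (f1 : ∀ x, f x ≤ 1)
    (hs : ∀ x, x ∉ Set.Icc (0 : ℝ) 1 → f x = 0) (hjk : j ≤ k) :
    ∫ t, (dyadicAvg k f t - dyadicAvg j f t) ^ 2 =
      (∫ t, dyadicAvg k f t ^ 2) - ∫ t, dyadicAvg j f t ^ 2 := by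
  have int : ∀ i l : ℕ, Integrable fun t => dyadicAvg i f t * dyadicAvg l f t := fun i l =>
    integrable_dyadicAvg_mul mf f0 f1 hs measurable_dyadicAvg (abs_dyadicAvg_le mf f0 f1)
  have e : ∀ t, (dyadicAvg k f t - dyadicAvg j f t) ^ 2 = dyadicAvg k f t * dyadicAvg k f t -
      (2 * (dyadicAvg k f t * dyadicAvg j f t) - dyadicAvg j f t * dyadicAvg j f t) :=
    fun t => by ring
  have i2 : Integrable fun t =>
      2 * (dyadicAvg k f t * dyadicAvg j f t) - dyadicAvg j f t * dyadicAvg j f t :=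
    ((int _ _).const_mul 2).sub (int _ _)
  simp_rw [e, sq]
  rw [integral_sub (int _ _) i2, integral_sub ((int _ _).const_mul 2) (int _ _), integral_const_mul,
    ← integral_mul_dyadicAvg mf f0 f1 hs hjk, integral_mul_dyadicAvg mf f0 f1 hs le_rfl]
  ring

lemma integral_sq_dyadicAvg_mem_Icc (mf : Measurable f) (f0 : ∀ x, 0 ≤ f x) (f1 : ∀ x, f x ≤ 1)
    (hs : ∀ x, x ∉ Set.Icc (0 : ℝ) 1 → f x = 0) :
    ∫ t, dyadicAvg j f t ^ 2 ∈ Set.Icc (0 : ℝ) 1 := by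
  refine ⟨integral_nonneg fun t => sq_nonneg _, ?_⟩
  refine (le_abs_self _).trans ((abs_integral_le_of_bounded_support (S := Set.Icc (0 : ℝ) 1)
    (C := 1) (by simp) (fun x hx => ?_) fun x => ?_).trans (by simp))
  · rw [dyadicAvg_eq_zero hs fun h => hx ⟨h.1, h.2.le⟩]; norm_num
  · rw [abs_pow]; exact pow_le_one₀ (abs_nonneg _) (abs_dyadicAvg_le mf f0 f1 _)

/-- A lower bound for the correlation of `f` with two of its dyadic averages. -/
lemma pow_three_le_integral_mul_dyadicAvg (mf : Measurable f) (f0 : ∀ x, 0 ≤ f x)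
    (f1 : ∀ x, f x ≤ 1) (hs : ∀ x, x ∉ Set.Icc (0 : ℝ) 1 → f x = 0) (hjk : j ≤ k) :
    (∫ t, f t) ^ 3 ≤ ∫ t, f t * (dyadicAvg k f t * dyadicAvg j f t) := by
  set m := ∫ t, f t with hm
  have hm0 : 0 ≤ m := integral_nonneg f0
  have bE : ∀ i x, |dyadicAvg i f x| ≤ 1 := fun i => abs_dyadicAvg_le mf f0 f1
  have hE : ∀ i x, 0 ≤ dyadicAvg i f x := fun i x => (dyadicAvg_mem_Icc mf f0 f1 x).1
  have int : ∀ i l n : ℕ, Integrable fun t => dyadicAvg i f t * (dyadicAvg l f t * dyadicAvg n f t) :=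
    fun i l n => integrable_dyadicAvg_mul mf f0 f1 hs (measurable_dyadicAvg.mul measurable_dyadicAvg)
      fun x => by rw [abs_mul]; exact mul_le_one₀ (bE _ _) (abs_nonneg _) (bE _ _)
  have intE : Integrable fun t => dyadicAvg j f t := by
    simpa using integrable_dyadicAvg_mul (j := j) (g := fun _ => 1) mf f0 f1 hs measurable_const
      (by simp)
  rw [integral_mul_dyadicAvg_eq mf f0 f1 hs le_rfl hjk]
  have e1 : ∫ t, dyadicAvg k f t * (dyadicAvg j f t * dyadicAvg j f t) =
      ∫ t, dyadicAvg j f t * (dyadicAvg j f t * dyadicAvg j f t) := by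
    rw [← integral_mul_dyadicAvg_eq mf f0 f1 hs hjk hjk,
      integral_mul_dyadicAvg_eq mf f0 f1 hs le_rfl le_rfl]
  have h1 : ∫ t, dyadicAvg j f t * (dyadicAvg j f t * dyadicAvg j f t) ≤
      ∫ t, dyadicAvg k f t * (dyadicAvg k f t * dyadicAvg j f t) := by
    have : 0 ≤ ∫ t, (dyadicAvg k f t - dyadicAvg j f t) ^ 2 * dyadicAvg j f t :=
      integral_nonneg fun t => mul_nonneg (sq_nonneg _) (hE _ _)
    have e : ∀ t, (dyadicAvg k f t - dyadicAvg j f t) ^ 2 * dyadicAvg j f t =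
        dyadicAvg k f t * (dyadicAvg k f t * dyadicAvg j f t) -
        (2 * (dyadicAvg k f t * (dyadicAvg j f t * dyadicAvg j f t)) -
        dyadicAvg j f t * (dyadicAvg j f t * dyadicAvg j f t)) := fun t => by ring
    have i2 : Integrable fun t => 2 * (dyadicAvg k f t * (dyadicAvg j f t * dyadicAvg j f t)) -
        dyadicAvg j f t * (dyadicAvg j f t * dyadicAvg j f t) :=
      ((int _ _ _).const_mul 2).sub (int _ _ _)
    simp_rw [e] at this
    rw [integral_sub (int _ _ _) i2, integral_sub ((int _ _ _).const_mul 2) (int _ _ _),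
      integral_const_mul, e1] at this
    linarith
  refine le_trans ?_ h1
  have ic : IntegrableOn (fun _ => 2 * m ^ 3) (Set.Icc (0 : ℝ) 1) :=
    integrableOn_const (by simp)
  have h2 : ∫ t in Set.Icc (0 : ℝ) 1, (3 * m ^ 2 * dyadicAvg j f t - 2 * m ^ 3) ≤
      ∫ t in Set.Icc (0 : ℝ) 1, dyadicAvg j f t * (dyadicAvg j f t * dyadicAvg j f t) := by
    refine setIntegral_mono_on ((intE.const_mul _).integrableOn.sub ic)
      (int _ _ _).integrableOn measurableSet_Icc fun t _ => ?_
    have := hE j t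
    nlinarith [mul_nonneg (sq_nonneg (dyadicAvg j f t - m)) (show 0 ≤ dyadicAvg j f t + 2 * m by
      positivity)]
  have hz : ∀ x, x ∉ Set.Icc (0 : ℝ) 1 → dyadicAvg j f x = 0 := fun x hx =>
    dyadicAvg_eq_zero hs fun h => hx ⟨h.1, h.2.le⟩
  rw [integral_sub (intE.const_mul _).integrableOn ic, integral_const_mul,
    setIntegral_eq_integral_of_forall_compl_eq_zero hz, integral_dyadicAvg mf f0 f1 hs, ← hm,
    setIntegral_eq_integral_of_forall_compl_eq_zero (f := fun t => dyadicAvg j f t *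
      (dyadicAvg j f t * dyadicAvg j f t)) fun x hx => by rw [hz x hx, zero_mul]] at h2
  simp at h2
  linarith

/-- Dyadic averages are Lipschitz under translation in `L¹`. -/
lemma integral_abs_dyadicAvg_add_sub_le (mf : Measurable f) (f0 : ∀ x, 0 ≤ f x)
    (f1 : ∀ x, f x ≤ 1) (hs : ∀ x, x ∉ Set.Icc (0 : ℝ) 1 → f x = 0) (h : ℝ) :
    ∫ x, |dyadicAvg j f (x + h) - dyadicAvg j f x| ≤ 2 ^ (j + 1) * |h| := by
  wlog hh : 0 ≤ h generalizing h
  · have := this (-h) (by linarith)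
    rw [abs_neg] at this
    refine le_of_eq_of_le ?_ this
    rw [← integral_add_right_eq_self (fun x => |dyadicAvg j f (x + -h) - dyadicAvg j f x|) h]
    refine integral_congr_ae (Filter.Eventually.of_forall fun x => ?_)
    beta_reduce
    rw [add_neg_cancel_right, abs_sub_comm]
  rw [abs_of_nonneg hh]
  have h2 : (0 : ℝ) < 2 ^ j := by positivity
  have key : ∀ x, |dyadicAvg j f (x + h) - dyadicAvg j f x| ≤
      ∑ i ∈ Finset.range (2 ^ j + 1), (Set.Ico ((i : ℝ) / 2 ^ j - h) (i / 2 ^ j)).indicator 1 x := by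
    intro x
    have hnn : ∀ i ∈ Finset.range (2 ^ j + 1), (0 : ℝ) ≤
        (Set.Ico ((i : ℝ) / 2 ^ j - h) (i / 2 ^ j)).indicator 1 x := fun i _ =>
      Set.indicator_nonneg (fun _ _ => zero_le_one) _
    by_cases hc : ∃ i ∈ Finset.range (2 ^ j + 1), x ∈ Set.Ico ((i : ℝ) / 2 ^ j - h) (i / 2 ^ j)
    · obtain ⟨i, hi, hx⟩ := hc
      refine le_trans ?_ (Finset.single_le_sum hnn hi)
      rw [Set.indicator_of_mem hx, Pi.one_apply, abs_le]
      have a1 := dyadicAvg_mem_Icc (j := j) mf f0 f1 (x + h)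
      have a2 := dyadicAvg_mem_Icc (j := j) mf f0 f1 x
      constructor <;> linarith [a1.1, a1.2, a2.1, a2.2]
    · refine le_of_eq_of_le ?_ (Finset.sum_nonneg hnn)
      rw [abs_eq_zero, sub_eq_zero]
      push Not at hc
      have hc' : ∀ i : ℕ, i < 2 ^ j + 1 → (i : ℝ) ≤ 2 ^ j * (x + h) → (i : ℝ) ≤ 2 ^ j * x := by
        intro i hi hle
        by_contra! hlt
        refine hc i (Finset.mem_range.2 hi) ⟨?_, ?_⟩
        · rw [sub_le_iff_le_add, div_le_iff₀ h2]; linarith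
        · rw [lt_div_iff₀ h2]; linarith
      have hmono : 2 ^ j * x ≤ 2 ^ j * (x + h) := by gcongr; linarith
      by_cases hfl : ⌊2 ^ j * (x + h)⌋ = ⌊2 ^ j * x⌋
      · simp only [dyadicAvg, hfl]
      have hlt : ⌊2 ^ j * x⌋ < ⌊2 ^ j * (x + h)⌋ :=
        lt_of_le_of_ne (Int.floor_mono hmono) (Ne.symm hfl)
      have hlt1 : 2 ^ j * x < ⌊2 ^ j * (x + h)⌋ := Int.floor_lt.1 hlt
      have hle1 := Int.floor_le (2 ^ j * (x + h))
      rcases lt_or_ge ⌊2 ^ j * (x + h)⌋ 0 with hneg | hpos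
      · have h3 : (⌊2 ^ j * (x + h)⌋ : ℝ) + 1 ≤ 0 := by exact_mod_cast hneg
        have h4 := Int.lt_floor_add_one (2 ^ j * (x + h))
        rw [dyadicAvg_eq_zero hs, dyadicAvg_eq_zero hs]
        · exact fun hx => by nlinarith [hx.1]
        · exact fun hx => by nlinarith [hx.1]
      · obtain ⟨n, hn⟩ := Int.eq_ofNat_of_zero_le hpos
        rw [hn, Int.cast_natCast] at hlt1 hle1
        by_cases hn2 : n < 2 ^ j + 1
        · exact absurd (hc' n hn2 hle1) (not_le.2 hlt1)
        · have h3 : ((2 ^ j : ℕ) : ℝ) ≤ n := by exact_mod_cast (by omega : 2 ^ j ≤ n)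
          have h4 := hc' (2 ^ j) (by omega) (h3.trans hle1)
          push_cast at h3 h4
          rw [dyadicAvg_eq_zero hs, dyadicAvg_eq_zero hs]
          · exact fun hx => by nlinarith [hx.2]
          · exact fun hx => by nlinarith [hx.2]
  have int : ∀ i : ℕ, Integrable ((Set.Ico ((i : ℝ) / 2 ^ j - h) (i / 2 ^ j)).indicator
      (1 : ℝ → ℝ)) := fun i => (integrable_indicator_iff measurableSet_Ico).2
        (integrableOn_const (by simp) (by simp))
  refine (integral_mono_of_nonneg (Filter.Eventually.of_forall fun x => abs_nonneg _)
    (integrable_finsetSum _ fun i _ => int i) (Filter.Eventually.of_forall key)).trans ?_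
  rw [integral_finsetSum _ fun i _ => int i]
  have : ∀ i : ℕ, ∫ x, (Set.Ico ((i : ℝ) / 2 ^ j - h) (i / 2 ^ j)).indicator (1 : ℝ → ℝ) x = h := by
    intro i
    rw [integral_indicator_one measurableSet_Ico, Real.volume_real_Ico_of_le (by linarith)]
    ring
  simp_rw [this]
  rw [Finset.sum_const, Finset.card_range, nsmul_eq_mul, pow_succ]
  push_cast
  have : (1 : ℝ) ≤ 2 ^ j := one_le_pow₀ (by norm_num)
  nlinarith

end dyadic

lemma abs_integral_mul_le_integral_abs {F G : ℝ → ℝ} (hG : Integrable G) (hF : ∀ x, |F x| ≤ 1) :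
    |∫ x, F x * G x| ≤ ∫ x, |G x| := by
  refine norm_integral_le_of_norm_le (f := fun x => F x * G x) hG.abs
    (Filter.Eventually.of_forall fun x => ?_)
  rw [Real.norm_eq_abs, abs_mul]
  exact mul_le_of_le_one_left (abs_nonneg _) (hF x)

lemma integral_abs_le_of_integral_sq_le {F : ℝ → ℝ} {κ : ℝ} (hκ : 0 ≤ κ) (mF : Measurable F)
    (bF : ∀ x, |F x| ≤ 1) (sF : ∀ x, x ∉ Set.Icc (0 : ℝ) 1 → F x = 0)
    (h : ∫ x, F x ^ 2 ≤ κ ^ 2) : ∫ x, |F x| ≤ κ := by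
  refine abs_le_of_sq_le_sq' ?_ hκ |>.2
  refine le_trans ?_ h
  have hi : Integrable fun x => (1 : ℝ) * |F x| ^ 2 := by
    simp only [one_mul]
    refine integrable_of_support_Icc (by fun_prop) (fun x => ?_) fun x hx => by simp [sF x hx]
    rw [abs_pow, abs_abs]; exact pow_le_one₀ (abs_nonneg _) (bF x)
  have := sq_integral_mul_le (μ := volume) (S := Set.Icc (0 : ℝ) 1) (k := fun x => |F x|)
    (φ := (Set.Icc (0 : ℝ) 1).indicator 1) (c := fun _ => 1) (C := 1) measurableSet_Icc (by simp)
    (measurable_one.indicator measurableSet_Icc) (by fun_prop)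
    (fun x => by rw [Set.indicator_apply]; split_ifs <;> simp)
    (fun x hx => Set.indicator_of_notMem hx _) (by simpa using bF) (by simp) (by simp) hi
  have e : ∀ x, (Set.Icc (0 : ℝ) 1).indicator (1 : ℝ → ℝ) x * |F x| = |F x| := by
    intro x
    by_cases hx : x ∈ Set.Icc (0 : ℝ) 1
    · simp [Set.indicator_of_mem hx]
    · simp [sF x hx]
  simpa [e, sq_abs] using this

section
variable {w q f f₁ f₂ g : ℝ → ℝ}

lemma integrable_mul_add_mul_add (m₀ : Measurable f) (m₁ : Measurable f₁) (m₂ : Measurable f₂)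
    (b₀ : ∀ x, |f x| ≤ 1) (b₁ : ∀ x, |f₁ x| ≤ 1) (b₂ : ∀ x, |f₂ x| ≤ 1)
    (s₀ : ∀ x, x ∉ Set.Icc (0 : ℝ) 1 → f x = 0) (a b : ℝ) :
    Integrable fun x => f x * f₁ (x + a) * f₂ (x + b) :=
  integrable_of_support_Icc (by fun_prop) (fun x => by
    rw [abs_mul, abs_mul]
    exact mul_le_one₀ (mul_le_one₀ (b₀ _) (abs_nonneg _) (b₁ _)) (abs_nonneg _) (b₂ _))
    fun x hx => by rw [s₀ x hx, zero_mul, zero_mul]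

lemma integrable_tri (hw : Measurable w) (hw1 : ∀ u, |w u| ≤ 1)
    (hw0 : ∀ u, u ∉ Set.Icc (-1 : ℝ) 1 → w u = 0) (hq : Measurable q)
    (m₀ : Measurable f) (m₁ : Measurable f₁) (m₂ : Measurable f₂)
    (b₀ : ∀ x, |f x| ≤ 1) (b₁ : ∀ x, |f₁ x| ≤ 1) (b₂ : ∀ x, |f₂ x| ≤ 1)
    (s₀ : ∀ x, x ∉ Set.Icc (0 : ℝ) 1 → f x = 0) :
    Integrable fun u => w u * ∫ x, f x * f₁ (x + q u) * f₂ (x + u) := by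
  refine integrable_of_bounded_support (S := Set.Icc (-1) 1) (C := 1) ?_ (by simp)
    (fun u hu => by rw [hw0 u hu, zero_mul]) fun u => ?_
  · refine hw.aestronglyMeasurable.mul (StronglyMeasurable.aestronglyMeasurable ?_)
    refine StronglyMeasurable.integral_prod_right
      (f := fun u x => f x * f₁ (x + q u) * f₂ (x + u)) ?_
    refine Measurable.stronglyMeasurable ?_
    simp only [Function.uncurry_def]
    fun_prop
  · rw [abs_mul]
    refine mul_le_one₀ (hw1 u) (abs_nonneg _) ?_
    refine (abs_integral_le_of_bounded_support (S := Set.Icc (0 : ℝ) 1) (C := 1) (by simp)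
      (fun x hx => by rw [s₀ x hx, zero_mul, zero_mul]) fun x => ?_).trans (by simp)
    rw [abs_mul, abs_mul]
    exact mul_le_one₀ (mul_le_one₀ (b₀ _) (abs_nonneg _) (b₁ _)) (abs_nonneg _) (b₂ _)

lemma integrable_weight (hw : Measurable w) (hw1 : ∀ u, |w u| ≤ 1)
    (hw0 : ∀ u, u ∉ Set.Icc (-1 : ℝ) 1 → w u = 0) : Integrable w :=
  integrable_of_bounded_support (S := Set.Icc (-1) 1) hw.aestronglyMeasurable (by simp) hw0 hw1

/-- Integrating a pointwise lower bound against a nonnegative weight. -/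
lemma mul_integral_le_integral_mul {A : ℝ → ℝ} {c : ℝ} (iw : Integrable w) (hw : ∀ u, 0 ≤ w u)
    (iA : Integrable fun u => w u * A u) (h : ∀ u, w u ≠ 0 → c ≤ A u) :
    c * ∫ u, w u ≤ ∫ u, w u * A u := by
  rw [← integral_const_mul]
  refine integral_mono (iw.const_mul c) iA fun u => ?_
  by_cases hu : w u = 0
  · simp [hu]
  · beta_reduce
    rw [mul_comm]; exact mul_le_mul_of_nonneg_left (h u hu) (hw u)

end

section
variable {s M κ Θ Q W v : ℝ} {w q p ν f f₁ f₁' f₂ f₂' g : ℝ → ℝ} {U : Set ℝ} {i j k l : ℕ}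

lemma tri_sub_middle (hw : Measurable w) (hw1 : ∀ u, |w u| ≤ 1)
    (hw0 : ∀ u, u ∉ Set.Icc (-1 : ℝ) 1 → w u = 0) (hq : Measurable q)
    (m₀ : Measurable f) (m₁ : Measurable f₁) (m₁' : Measurable f₁') (m₂ : Measurable f₂)
    (b₀ : ∀ x, |f x| ≤ 1) (b₁ : ∀ x, |f₁ x| ≤ 1) (b₁' : ∀ x, |f₁' x| ≤ 1) (b₂ : ∀ x, |f₂ x| ≤ 1)
    (s₀ : ∀ x, x ∉ Set.Icc (0 : ℝ) 1 → f x = 0) :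
    tri w q f (fun x => f₁ x - f₁' x) f₂ = tri w q f f₁ f₂ - tri w q f f₁' f₂ := by
  rw [tri, tri, tri, ← integral_sub (integrable_tri hw hw1 hw0 hq m₀ m₁ m₂ b₀ b₁ b₂ s₀)
    (integrable_tri hw hw1 hw0 hq m₀ m₁' m₂ b₀ b₁' b₂ s₀)]
  refine integral_congr_ae (Filter.Eventually.of_forall fun u => ?_)
  beta_reduce
  rw [← mul_sub, ← integral_sub (integrable_mul_add_mul_add m₀ m₁ m₂ b₀ b₁ b₂ s₀ _ _)
    (integrable_mul_add_mul_add m₀ m₁' m₂ b₀ b₁' b₂ s₀ _ _)]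
  congr 2; funext x; ring

lemma tri_sub_right (hw : Measurable w) (hw1 : ∀ u, |w u| ≤ 1)
    (hw0 : ∀ u, u ∉ Set.Icc (-1 : ℝ) 1 → w u = 0) (hq : Measurable q)
    (m₀ : Measurable f) (m₁ : Measurable f₁) (m₂ : Measurable f₂) (m₂' : Measurable f₂')
    (b₀ : ∀ x, |f x| ≤ 1) (b₁ : ∀ x, |f₁ x| ≤ 1) (b₂ : ∀ x, |f₂ x| ≤ 1) (b₂' : ∀ x, |f₂' x| ≤ 1)
    (s₀ : ∀ x, x ∉ Set.Icc (0 : ℝ) 1 → f x = 0) :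
    tri w q f f₁ (fun x => f₂ x - f₂' x) = tri w q f f₁ f₂ - tri w q f f₁ f₂' := by
  rw [tri, tri, tri, ← integral_sub (integrable_tri hw hw1 hw0 hq m₀ m₁ m₂ b₀ b₁ b₂ s₀)
    (integrable_tri hw hw1 hw0 hq m₀ m₁ m₂' b₀ b₁ b₂' s₀)]
  refine integral_congr_ae (Filter.Eventually.of_forall fun u => ?_)
  beta_reduce
  rw [← mul_sub, ← integral_sub (integrable_mul_add_mul_add m₀ m₁ m₂ b₀ b₁ b₂ s₀ _ _)
    (integrable_mul_add_mul_add m₀ m₁ m₂' b₀ b₁ b₂' s₀ _ _)]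
  congr 2; funext x; ring

/-- The trilinear form along the vertical line `u ↦ (0, u)`. -/
lemma abs_tri_zero_le {w' : ℝ → ℝ} {L : ℝ} (hw : ∀ u, HasDerivAt w (w' u) u)
    (hw1 : ∀ u, |w u| ≤ 1) (hw' : Measurable w') (hL : ∀ u, |w' u| ≤ L)
    (hw0 : ∀ u, u ∉ Set.Icc (-1 : ℝ) 1 → w u = 0)
    (m₀ : Measurable f) (m₁ : Measurable f₁) (mg : Measurable g)
    (b₀ : ∀ x, |f x| ≤ 1) (b₁ : ∀ x, |f₁ x| ≤ 1) (bg : ∀ x, |g x| ≤ 1)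
    (s₀ : ∀ x, x ∉ Set.Icc (0 : ℝ) 1 → f x = 0) (hv : ∀ a b, |∫ x in a..b, g x| ≤ v) :
    |tri w (fun _ => 0) f f₁ g| ≤ 2 * L * v := by
  have hwm : Measurable w :=
    (continuous_iff_continuousAt.2 fun u => (hw u).continuousAt).measurable
  have hL0 : 0 ≤ L := (abs_nonneg _).trans (hL 0)
  have hv0 : 0 ≤ v := (abs_nonneg _).trans (hv 0 0)
  have i1 : Integrable (Function.uncurry fun u x : ℝ => f x * f₁ (x + 0) * (w u * g (x + u)))
      (volume.prod volume) := by
    refine integrable_of_bounded_support (S := Set.Icc (-1) 1 ×ˢ Set.Icc 0 1) (C := 1)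
      (Measurable.aestronglyMeasurable (by simp only [Function.uncurry_def]; fun_prop)) ?_ ?_ ?_
    · rw [Measure.prod_prod]; norm_num
    · rintro ⟨u, x⟩ h
      simp only [Set.mem_prod, not_and_or] at h
      rcases h with h | h
      · simp [hw0 _ h]
      · simp [s₀ _ h]
    · rintro ⟨u, x⟩
      simp only [Function.uncurry_apply_pair]
      rw [abs_mul, abs_mul, abs_mul]
      exact mul_le_one₀ (mul_le_one₀ (b₀ _) (abs_nonneg _) (b₁ _)) (by positivity)
        (mul_le_one₀ (hw1 _) (abs_nonneg _) (bg _))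
  have e : tri w (fun _ => 0) f f₁ g = ∫ x, f x * f₁ (x + 0) * ∫ u, w u * g (x + u) := by
    calc tri w (fun _ => 0) f f₁ g = ∫ u, ∫ x, f x * f₁ (x + 0) * (w u * g (x + u)) := by
          simp only [tri, ← integral_const_mul]
          refine integral_congr_ae (Filter.Eventually.of_forall fun u => ?_)
          refine integral_congr_ae (Filter.Eventually.of_forall fun x => ?_)
          beta_reduce; ring
      _ = _ := by
          rw [integral_integral_swap i1]
          simp_rw [integral_const_mul]
  rw [e]
  refine (abs_integral_le_of_bounded_support (S := Set.Icc (0 : ℝ) 1) (C := 2 * L * v) (by simp)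
    (fun x hx => by rw [s₀ x hx, zero_mul, zero_mul]) fun x => ?_).trans (by simp)
  rw [abs_mul, abs_mul]
  refine (mul_le_of_le_one_left (abs_nonneg _) (mul_le_one₀ (b₀ _) (abs_nonneg _) (b₁ _))).trans ?_
  refine abs_integral_mul_le_of_hasDerivAt hw hw' hL hw0 (g := fun u => g (x + u)) (by fun_prop)
    (fun u => bg _) fun a b => ?_
  rw [intervalIntegral.integral_comp_add_left fun t => g t]
  exact hv _ _

lemma abs_tri_le_mul_integral {c : ℝ} (hw : Measurable w) (hw1 : ∀ u, |w u| ≤ 1)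
    (hwn : ∀ u, 0 ≤ w u) (hw0 : ∀ u, u ∉ Set.Icc (-1 : ℝ) 1 → w u = 0)
    (h : ∀ u, w u ≠ 0 → |∫ x, f x * f₁ (x + q u) * f₂ (x + u)| ≤ c) :
    |tri w q f f₁ f₂| ≤ c * ∫ u, w u := by
  have iw := integrable_weight hw hw1 hw0
  rw [← integral_const_mul]
  refine norm_integral_le_of_norm_le (f := fun u => w u * _) (iw.const_mul c)
    (Filter.Eventually.of_forall fun u => ?_)
  rw [Real.norm_eq_abs, abs_mul, abs_of_nonneg (hwn u), mul_comm]
  by_cases hu : w u = 0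
  · simp [hu]
  · exact mul_le_mul_of_nonneg_right (h u hu) (hwn u)

end

section
variable {s M κ Θ Q : ℝ} {w q p ν f : ℝ → ℝ} {U : Set ℝ} {i j k l : ℕ}

/-- A lower bound for the trilinear form of a nonnegative function with little energy between the
scales `i` and `j`, and between the scales `k` and `l`. -/
theorem le_tri (hC : CurveData s M q p ν) (hw : CurvedCutoff M p ν w U) (hΘ : Θ ≤ 1)
    (hUΘ : ∀ u ∈ U, |u| ≤ Θ) (hUQ : ∀ u ∈ U, |q u| ≤ Q) (hW : 0 < ∫ u, w u)
    (mf : Measurable f) (f0 : ∀ x, 0 ≤ f x) (f1 : ∀ x, f x ≤ 1)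
    (hs : ∀ x, x ∉ Set.Icc (0 : ℝ) 1 → f x = 0) (hκ : 0 < κ) (hκ2 : κ ≤ 1 / 2)
    (hij : i ≤ j) (hkl : k ≤ l) (hki : k ≤ i)
    (hQ : 2 ^ (i + 1) * Q ≤ κ) (hΘκ : 2 ^ (k + 1) * Θ ≤ κ)
    (e1 : (∫ x, dyadicAvg j f x ^ 2) - ∫ x, dyadicAvg i f x ^ 2 ≤ κ ^ 2)
    (e2 : (∫ x, dyadicAvg l f x ^ 2) - ∫ x, dyadicAvg k f x ^ 2 ≤ κ ^ 2)
    (hj : 2 * (2 ^ j)⁻¹ * (2 ^ 121 * M ^ 33) ≤ s * (κ * ∫ u, w u) ^ 28)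
    (hl : 2 * M * (2 * (2 ^ l)⁻¹) ≤ κ * ∫ u, w u) :
    ((∫ x, f x) ^ 3 - 7 * κ) * ∫ u, w u ≤ tri w q f f f := by
  have bf : ∀ x, |f x| ≤ 1 := fun x => by rw [abs_of_nonneg (f0 x)]; exact f1 x
  have mE : ∀ n, Measurable (dyadicAvg n f) := fun n => measurable_dyadicAvg
  have bE : ∀ n x, |dyadicAvg n f x| ≤ 1 := fun n => abs_dyadicAvg_le mf f0 f1
  have hE : ∀ n x, dyadicAvg n f x ∈ Set.Icc (0 : ℝ) 1 := fun n => dyadicAvg_mem_Icc mf f0 f1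
  have sE : ∀ n x, x ∉ Set.Icc (0 : ℝ) 1 → dyadicAvg n f x = 0 := fun n x hx =>
    dyadicAvg_eq_zero hs fun h => hx ⟨h.1, h.2.le⟩
  have iE : ∀ n, Integrable (dyadicAvg n f) := fun n => integrable_of_support_Icc (mE n) (bE n) (sE n)
  have bEE : ∀ n m x, |dyadicAvg n f x - dyadicAvg m f x| ≤ 1 := fun n m x => by
    have a1 := hE n x
    have a2 := hE m x
    rw [abs_le]; constructor <;> linarith [a1.1, a1.2, a2.1, a2.2]
  have bg : ∀ n x, |f x - dyadicAvg n f x| ≤ 1 := fun n x => by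
    have a2 := hE n x
    rw [abs_le]; constructor <;> linarith [f0 x, f1 x, a2.1, a2.2]
  have mg : ∀ n, Measurable fun x => f x - dyadicAvg n f x := fun n => mf.sub (mE n)
  have hwc : Continuous w := hw.bdd.diff.continuous
  have hwm := hwc.measurable
  have hqm : Measurable q :=
    (continuous_iff_continuousAt.2 fun u => (hC.hasDerivAt u).continuousAt).measurable
  have hw1 : ∀ u, |w u| ≤ 1 := fun u => by rw [abs_of_nonneg (hw.nonneg u)]; exact hw.le_one u
  have hwU : ∀ u, w u ≠ 0 → u ∈ U := fun u h => by
    by_contra hu; exact h (hw.eq_zero u hu)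
  have hw0 : ∀ u, u ∉ Set.Icc (-1 : ℝ) 1 → w u = 0 := fun u hu => by
    by_contra h
    exact hu (abs_le.1 ((hUΘ u (hwU u h)).trans hΘ))
  have iw := integrable_weight hwm hw1 hw0
  set W := ∫ u, w u with hWdef
  have hW2 : W ≤ 2 := by
    refine (le_abs_self _).trans ((abs_integral_le_of_bounded_support (S := Set.Icc (-1 : ℝ) 1)
      (by simp) hw0 hw1).trans (by norm_num))
  -- translations of the coarse averages
  have sh : ∀ (n : ℕ) (h : ℝ) (F : ℝ → ℝ), (∀ x, |F x| ≤ 1) →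
      |∫ x, F x * (dyadicAvg n f (x + h) - dyadicAvg n f x)| ≤ 2 ^ (n + 1) * |h| :=
    fun n h F bF => (abs_integral_mul_le_integral_abs (((iE n).comp_add_right h).sub (iE n))
      bF).trans (integral_abs_dyadicAvg_add_sub_le mf f0 f1 hs h)
  have shq : ∀ u, w u ≠ 0 → 2 ^ (i + 1) * |q u| ≤ κ := fun u hu =>
    (mul_le_mul_of_nonneg_left (hUQ u (hwU u hu)) (by positivity)).trans hQ
  have shu : ∀ u, w u ≠ 0 → 2 ^ (k + 1) * |u| ≤ κ := fun u hu =>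
    (mul_le_mul_of_nonneg_left (hUΘ u (hwU u hu)) (by positivity)).trans hΘκ
  -- intermediate frequencies
  have mid : ∀ n m : ℕ, n ≤ m → (∫ x, dyadicAvg m f x ^ 2) - ∫ x, dyadicAvg n f x ^ 2 ≤ κ ^ 2 →
      ∀ (h : ℝ) (F : ℝ → ℝ), (∀ x, |F x| ≤ 1) →
      |∫ x, F x * (dyadicAvg m f (x + h) - dyadicAvg n f (x + h))| ≤ κ := by
    intro n m hnm hnrg h F bF
    refine (abs_integral_mul_le_integral_abs (((iE m).comp_add_right h).sub
      ((iE n).comp_add_right h)) bF).trans ?_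
    simp only [Pi.sub_apply]
    rw [integral_add_right_eq_self fun x => |dyadicAvg m f x - dyadicAvg n f x|]
    refine integral_abs_le_of_integral_sq_le hκ.le ((mE m).sub (mE n)) (bEE m n)
      (fun x hx => by rw [sE m x hx, sE n x hx, sub_zero]) ?_
    rwa [integral_sq_dyadicAvg_sub mf f0 f1 hs hnm]
  -- the five error terms
  have t1 : |tri w q f (fun x => f x - dyadicAvg j f x) f| ≤ κ * W :=
    abs_tri_le hC hw mf mf bf bf hs hs (mg j) (bg j)
      (fun a b => abs_integral_sub_dyadicAvg_le mf f0 f1 a b) (by positivity) (by nlinarith) hj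
  have t2 : |tri w q f (fun x => dyadicAvg j f x - dyadicAvg i f x) f| ≤ κ * W := by
    refine abs_tri_le_mul_integral hwm hw1 hw.nonneg hw0 fun u hu => ?_
    refine le_of_eq_of_le ?_ (mid i j hij e1 (q u) (fun x => f x * f (x + u)) fun x => ?_)
    · congr 2; funext x; ring
    · rw [abs_mul]; exact mul_le_one₀ (bf _) (abs_nonneg _) (bf _)
  have t3 : |tri w q f (dyadicAvg i f) (fun x => dyadicAvg l f x - dyadicAvg k f x)| ≤ κ * W := by
    refine abs_tri_le_mul_integral hwm hw1 hw.nonneg hw0 fun u hu => ?_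
    refine mid k l hkl e2 u (fun x => f x * dyadicAvg i f (x + q u)) fun x => ?_
    rw [abs_mul]; exact mul_le_one₀ (bf _) (abs_nonneg _) (bE _ _)
  have t4 : |tri w (fun _ => 0) f (dyadicAvg i f) (fun x => f x - dyadicAvg l f x)| ≤ κ * W := by
    refine (abs_tri_zero_le (w' := deriv w) (L := M) (fun u => (hw.bdd.diff u).hasDerivAt) hw1
      (measurable_deriv w) (fun u => ?_) hw0 mf (mE i) (mg l) bf (bE i) (bg l) hs
      fun a b => abs_integral_sub_dyadicAvg_le mf f0 f1 a b).trans hl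
    rw [← Real.norm_eq_abs, norm_deriv_eq_norm_fderiv]; exact hw.bdd.fderiv_bound u
  have t5 : |tri w q f (dyadicAvg i f) (fun x => f x - dyadicAvg l f x) -
      tri w (fun _ => 0) f (dyadicAvg i f) (fun x => f x - dyadicAvg l f x)| ≤ κ * W := by
    rw [tri, tri, ← integral_sub (integrable_tri hwm hw1 hw0 hqm mf (mE i) (mg l) bf (bE i) (bg l) hs)
      (integrable_tri hwm hw1 hw0 measurable_const mf (mE i) (mg l) bf (bE i) (bg l) hs),
      ← integral_const_mul, ← Real.norm_eq_abs]
    refine norm_integral_le_of_norm_le (iw.const_mul κ) (Filter.Eventually.of_forall fun u => ?_)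
    rw [← mul_sub, Real.norm_eq_abs, abs_mul, abs_of_nonneg (hw.nonneg u), mul_comm]
    by_cases hu : w u = 0
    · simp [hu]
    refine mul_le_mul_of_nonneg_right ?_ (hw.nonneg u)
    rw [← integral_sub (integrable_mul_add_mul_add mf (mE i) (mg l) bf (bE i) (bg l) hs _ _)
      (integrable_mul_add_mul_add mf (mE i) (mg l) bf (bE i) (bg l) hs _ _)]
    refine le_of_eq_of_le ?_ ((sh i (q u) (fun x => f x * (f (x + u) - dyadicAvg l f (x + u)))
      fun x => ?_).trans (shq u hu))
    · congr 2; funext x; rw [add_zero]; ring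
    · rw [abs_mul]; exact mul_le_one₀ (bf _) (abs_nonneg _) (bg _ _)
  -- the main term
  have t6 : ((∫ x, f x) ^ 3 - 2 * κ) * W ≤ tri w q f (dyadicAvg i f) (dyadicAvg k f) := by
    refine mul_integral_le_integral_mul iw hw.nonneg
      (integrable_tri hwm hw1 hw0 hqm mf (mE i) (mE k) bf (bE i) (bE k) hs) fun u hu => ?_
    have h0 := pow_three_le_integral_mul_dyadicAvg mf f0 f1 hs hki
    have h1 := (sh i (q u) (fun x => f x * dyadicAvg k f (x + u)) fun x => by
      rw [abs_mul]; exact mul_le_one₀ (bf _) (abs_nonneg _) (bE _ _)).trans (shq u hu)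
    have h2 := (sh k u (fun x => f x * dyadicAvg i f x) fun x => by
      rw [abs_mul]; exact mul_le_one₀ (bf _) (abs_nonneg _) (bE _ _)).trans (shu u hu)
    have j1 := integrable_mul_add_mul_add mf (mE i) (mE k) bf (bE i) (bE k) hs (q u) u
    have j2 := integrable_mul_add_mul_add mf (mE i) (mE k) bf (bE i) (bE k) hs 0 u
    have j3 := integrable_mul_add_mul_add mf (mE i) (mE k) bf (bE i) (bE k) hs 0 0
    simp only [add_zero] at j2 j3
    have a1 : ∫ x, f x * dyadicAvg k f (x + u) * (dyadicAvg i f (x + q u) - dyadicAvg i f x) =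
        (∫ x, f x * dyadicAvg i f (x + q u) * dyadicAvg k f (x + u)) -
        ∫ x, f x * dyadicAvg i f x * dyadicAvg k f (x + u) := by
      rw [← integral_sub j1 j2]; congr 1; funext x; ring
    have a2 : ∫ x, f x * dyadicAvg i f x * (dyadicAvg k f (x + u) - dyadicAvg k f x) =
        (∫ x, f x * dyadicAvg i f x * dyadicAvg k f (x + u)) -
        ∫ x, f x * (dyadicAvg i f x * dyadicAvg k f x) := by
      simp_rw [← mul_assoc]
      rw [← integral_sub j2 j3]; congr 1; funext x; ring
    rw [a1] at h1
    rw [a2] at h2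
    have := (abs_le.1 h1).1
    have := (abs_le.1 h2).1
    linarith
  have d1 := tri_sub_middle hwm hw1 hw0 hqm mf mf (mE j) mf bf bf (bE j) bf hs
  have d2 := tri_sub_middle hwm hw1 hw0 hqm mf (mE j) (mE i) mf bf (bE j) (bE i) bf hs
  have d3 := tri_sub_right hwm hw1 hw0 hqm mf (mE i) mf (mE l) bf (bE i) bf (bE l) hs
  have d4 := tri_sub_right hwm hw1 hw0 hqm mf (mE i) (mE l) (mE k) bf (bE i) (bE l) (bE k) hs
  have := (abs_le.1 t1).1
  have := (abs_le.1 t2).1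
  have := (abs_le.1 t3).1
  have := (abs_le.1 t4).1
  have := (abs_le.1 t5).1
  nlinarith

end

/-- A smooth ramp: `0` for `t ≤ 0` and of slope `1` for `t ≥ 1 / 2`. -/
noncomputable def ramp (t : ℝ) : ℝ := (max 0 t) ^ 2 - (max 0 (t - 1 / 2)) ^ 2

/-- A `C¹` map onto `[-1/2, 1/2]` that is the identity on `[-1/4, 1/4]`. -/
noncomputable def softClamp (y : ℝ) : ℝ := y - ramp (y - 1 / 4) + ramp (-y - 1 / 4)

/-- The derivative of `softClamp`. -/
noncomputable def softClampDeriv (y : ℝ) : ℝ :=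
  1 - (2 * max 0 (y - 1 / 4) - 2 * max 0 (y - 1 / 4 - 1 / 2)) -
    (2 * max 0 (-y - 1 / 4) - 2 * max 0 (-y - 1 / 4 - 1 / 2))

lemma hasDerivAt_ramp (t : ℝ) :
    HasDerivAt ramp (2 * max 0 t - 2 * max 0 (t - 1 / 2)) t := by
  have h1 := hasDerivAt_max_zero_sq t
  have h2 := (hasDerivAt_max_zero_sq (t - 1 / 2)).comp t ((hasDerivAt_id t).sub_const (1 / 2))
  rw [mul_one] at h2
  exact h1.sub h2

lemma hasDerivAt_softClamp (y : ℝ) : HasDerivAt softClamp (softClampDeriv y) y := by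
  have h1 := (hasDerivAt_ramp (y - 1 / 4)).comp y ((hasDerivAt_id y).sub_const (1 / 4))
  have h2 := (hasDerivAt_ramp (-y - 1 / 4)).comp y ((hasDerivAt_id y).neg.sub_const (1 / 4))
  have := ((hasDerivAt_id y).sub h1).add h2
  refine this.congr_deriv ?_
  simp only [softClampDeriv]; ring

lemma abs_softClampDeriv_le (y : ℝ) : |softClampDeriv y| ≤ 1 := by
  simp only [softClampDeriv]
  rw [abs_le]
  rcases max_cases 0 (y - 1 / 4) with h1 | h1 <;>
  rcases max_cases 0 (y - 1 / 4 - 1 / 2) with h2 | h2 <;>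
  rcases max_cases 0 (-y - 1 / 4) with h3 | h3 <;>
  rcases max_cases 0 (-y - 1 / 4 - 1 / 2) with h4 | h4 <;>
  rw [h1.1, h2.1, h3.1, h4.1] <;> constructor <;> linarith [h1.2, h2.2, h3.2, h4.2]

lemma sub_le_ramp (t : ℝ) : t - 1 / 4 ≤ ramp t := by
  unfold ramp
  rcases max_cases 0 t with h1 | h1 <;> rcases max_cases 0 (t - 1 / 2) with h2 | h2 <;>
  rw [h1.1, h2.1] <;> nlinarith [h1.2, h2.2, sq_nonneg (t - 1 / 2)]

lemma ramp_le (t : ℝ) : ramp t ≤ max 0 t := by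
  unfold ramp
  rcases max_cases 0 t with h1 | h1 <;> rcases max_cases 0 (t - 1 / 2) with h2 | h2 <;>
  rw [h1.1, h2.1] <;> nlinarith [h1.2, h2.2, sq_nonneg (t - 1 / 2)]

lemma ramp_eq_zero {t : ℝ} (ht : t ≤ 0) : ramp t = 0 := by
  unfold ramp
  rw [max_eq_left ht, max_eq_left (by linarith)]
  ring

lemma softClamp_le (y : ℝ) : softClamp y ≤ 1 / 2 := by
  unfold softClamp
  rcases le_total y (-1 / 4) with h | h
  · have := ramp_le (-y - 1 / 4)
    rw [max_eq_right (by linarith)] at this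
    rw [ramp_eq_zero (t := y - 1 / 4) (by linarith)]
    linarith
  · have := sub_le_ramp (y - 1 / 4)
    rw [ramp_eq_zero (t := -y - 1 / 4) (by linarith)]
    linarith

lemma abs_softClamp_le (y : ℝ) : |softClamp y| ≤ 1 / 2 := by
  have h : softClamp (-y) = -softClamp y := by
    simp only [softClamp, neg_neg]; ring
  have := softClamp_le (-y)
  rw [abs_le]
  exact ⟨by linarith, softClamp_le y⟩

lemma softClamp_of_abs_le {y : ℝ} (hy : |y| ≤ 1 / 4) : softClamp y = y := by
  have := abs_le.1 hy
  simp only [softClamp, ramp]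
  rw [max_eq_left (by linarith), max_eq_left (by linarith), max_eq_left (by linarith),
    max_eq_left (by linarith)]
  ring

lemma softClampDeriv_of_abs_le {y : ℝ} (hy : |y| ≤ 1 / 4) : softClampDeriv y = 1 := by
  have := abs_le.1 hy
  simp only [softClampDeriv]
  rw [max_eq_left (by linarith), max_eq_left (by linarith), max_eq_left (by linarith),
    max_eq_left (by linarith)]
  ring

/-- The mean value theorem as a lower bound for differences. -/
lemma mul_abs_sub_le_of_hasDerivAt {f f' : ℝ → ℝ} {U : Set ℝ} {c : ℝ} (hU : U.OrdConnected)
    (hf : ∀ x ∈ U, HasDerivAt f (f' x) x) (hc : ∀ x ∈ U, c ≤ |f' x|) {x y : ℝ} (hx : x ∈ U)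
    (hy : y ∈ U) : c * |x - y| ≤ |f x - f y| := by
  wlog hxy : x < y generalizing x y
  · rcases (not_lt.1 hxy).eq_or_lt with h | h
    · simp [h]
    · rw [abs_sub_comm x, abs_sub_comm (f x)]; exact this hy hx h
  have hsub := hU.out hx hy
  obtain ⟨ξ, hξ, h⟩ := exists_hasDerivAt_eq_slope f f' hxy
    (fun t ht => (hf t (hsub ht)).continuousAt.continuousWithinAt)
    fun t ht => hf t (hsub (Set.Ioo_subset_Icc_self ht))
  have h1 : f y - f x = f' ξ * (y - x) := by
    rw [h]; field_simp [sub_ne_zero.2 hxy.ne']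
  rw [abs_sub_comm x, abs_sub_comm (f x), h1, abs_mul]
  exact mul_le_mul_of_nonneg_right (hc ξ (hsub (Set.Ioo_subset_Icc_self hξ))) (abs_nonneg _)

/-- A quantitative inverse of a function whose derivative stays away from zero. -/
lemma exists_inverse {P b : ℝ → ℝ} {α β K : ℝ} (hαβ : α < β) (hK : 0 < K)
    (hP : ∀ τ, HasDerivAt P (b τ) τ) (hb : ∀ τ ∈ Set.Icc α β, K⁻¹ ≤ |b τ|) :
    ∃ (u₀ ρ : ℝ) (g : ℝ → ℝ), K⁻¹ * (β - α) ≤ 2 * ρ ∧ (∀ u, |u - u₀| < ρ →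
      g u ∈ Set.Icc α β ∧ P (g u) = u ∧ HasDerivAt g (b (g u))⁻¹ u) ∧
      Set.InjOn P (Set.Icc α β) := by
  have hPc : Continuous P := continuous_iff_continuousAt.2 fun τ => (hP τ).continuousAt
  have lip : ∀ x ∈ Set.Icc α β, ∀ y ∈ Set.Icc α β, K⁻¹ * |x - y| ≤ |P x - P y| :=
    fun x hx y hy => mul_abs_sub_le_of_hasDerivAt Set.ordConnected_Icc (fun τ _ => hP τ) hb hx hy
  have hsurj : ∀ u, |u - (P α + P β) / 2| < |P β - P α| / 2 → ∃ τ ∈ Set.Icc α β, P τ = u := by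
    intro u hu
    rw [abs_lt] at hu
    have : u ∈ Set.uIcc (P α) (P β) := by
      rw [Set.mem_uIcc]
      rcases abs_cases (P β - P α) with h | h
      · left; constructor <;> linarith
      · right; constructor <;> linarith
    have := intermediate_value_uIcc hPc.continuousOn this
    rwa [Set.uIcc_of_le hαβ.le] at this
  choose! g hg1 hg2 using hsurj
  refine ⟨(P α + P β) / 2, |P β - P α| / 2, g, ?_, fun u hu => ⟨hg1 u hu, hg2 u hu, ?_⟩, ?_⟩
  · have := lip β ⟨hαβ.le, le_rfl⟩ α ⟨le_rfl, hαβ.le⟩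
    rw [abs_of_pos (sub_pos.2 hαβ)] at this
    linarith
  · have hopen : ∀ᶠ y in nhds u, |y - (P α + P β) / 2| < |P β - P α| / 2 :=
      (isOpen_lt (by fun_prop) continuous_const).mem_nhds hu
    have hb0 : b (g u) ≠ 0 := fun h => by
      have := hb _ (hg1 u hu)
      rw [h, abs_zero] at this
      exact absurd (inv_pos.2 hK) (not_lt.2 this)
    refine HasDerivAt.of_local_left_inverse ?_ (hP _) hb0 (hopen.mono fun y hy => hg2 y hy)
    rw [ContinuousAt, tendsto_iff_dist_tendsto_zero]
    refine squeeze_zero' (Filter.Eventually.of_forall fun y => dist_nonneg) (hopen.mono fun y hy => ?_)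
      (g := fun y => K * dist y u) ?_
    · have := lip _ (hg1 y hy) _ (hg1 u hu)
      rw [hg2 y hy, hg2 u hu] at this
      rw [Real.dist_eq, Real.dist_eq]
      rwa [inv_mul_le_iff₀ hK] at this
    · have : Continuous fun y => K * dist y u := by fun_prop
      simpa using this.tendsto u
  · intro x hx y hy hxy
    have := lip x hx y hy
    rw [hxy, sub_self, abs_zero, inv_mul_le_iff₀ hK, mul_zero] at this
    exact sub_eq_zero.1 (abs_nonpos_iff.1 this)

/-- A curve `τ ↦ (P₁ τ, P₂ τ)`, on part of `[0, 1]`, parametrized by its second coordinate: the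
first coordinate is the function `q` of the second, and `w` is a cutoff supported on `U`. -/
structure IsArc (s M Q Θ : ℝ) (P₁ P₂ q p ν w : ℝ → ℝ) (U : Set ℝ) : Prop where
  data : CurveData s M q p ν
  cutoff : CurvedCutoff M p ν w U
  abs_le : ∀ u ∈ U, |u| ≤ Θ
  abs_q_le : ∀ u ∈ U, |q u| ≤ Q
  mass : M⁻¹ ≤ ∫ u, w u
  transfer : ∀ h : ℝ → ℝ → ℝ, Measurable (Function.uncurry h) → (∀ x y, 0 ≤ h x y) →
    (∀ x y, h x y ≤ 1) →
      ∫ u, w u * h (q u) u ≤ M * ∫ τ in Set.Icc (0 : ℝ) 1, h (P₁ τ) (P₂ τ)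

/-- Quantitative nondegeneracy on `[α, β]` of a curve `(P₁, P₂)` with velocity `(s a, b)`. -/
structure NondegenerateOn (s K Q Θ α β : ℝ) (P₁ P₂ a b a' b' W' E' : ℝ → ℝ) : Prop where
  s_pos : 0 < s
  s_le_one : s ≤ 1
  K_large : 16 ≤ K
  nonneg : 0 ≤ α
  le_one : β ≤ 1
  le_sub : K⁻¹ ≤ β - α
  hasDerivAt₁ : ∀ τ, HasDerivAt P₁ (s * a τ) τ
  hasDerivAt₂ : ∀ τ, HasDerivAt P₂ (b τ) τ
  hasDerivAt_a : ∀ τ, HasDerivAt a (a' τ) τ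
  hasDerivAt_b : ∀ τ, HasDerivAt b (b' τ) τ
  hasDerivAt_wronskian : ∀ τ, HasDerivAt (fun τ => a' τ * b τ - a τ * b' τ) (W' τ) τ
  hasDerivAt_prod : ∀ τ, HasDerivAt (fun τ => a τ * b τ * (b τ - s * a τ)) (E' τ) τ
  abs_a_le : ∀ τ ∈ Set.Icc α β, |a τ| ≤ K
  abs_b_le : ∀ τ ∈ Set.Icc α β, |b τ| ≤ K
  abs_e_le : ∀ τ ∈ Set.Icc α β, |b τ - s * a τ| ≤ K
  abs_a'_le : ∀ τ ∈ Set.Icc α β, |a' τ| ≤ K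
  abs_b'_le : ∀ τ ∈ Set.Icc α β, |b' τ| ≤ K
  le_abs_a : ∀ τ ∈ Set.Icc α β, K⁻¹ ≤ |a τ|
  le_abs_b : ∀ τ ∈ Set.Icc α β, K⁻¹ ≤ |b τ|
  le_abs_e : ∀ τ ∈ Set.Icc α β, K⁻¹ ≤ |b τ - s * a τ|
  le_abs_curv : ∀ τ ∈ Set.Icc α β, K⁻¹ ≤ |W' τ * (a τ * b τ * (b τ - s * a τ)) -
    (a' τ * b τ - a τ * b' τ) * E' τ|
  abs_P₁_le : ∀ τ ∈ Set.Icc α β, |P₁ τ| ≤ Q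
  abs_P₂_le : ∀ τ ∈ Set.Icc α β, |P₂ τ| ≤ Θ

/-- Monotone logarithmic derivative forces curvature. -/
lemma curved_of_hasDerivAt {ν l l' : ℝ → ℝ} {U : Set ℝ} {m κ : ℝ} (hU : U.OrdConnected)
    (hν : ∀ u ∈ U, HasDerivAt ν (ν u * l u) u) (hl : ∀ u ∈ U, HasDerivAt l (l' u) u)
    (hm : 0 < m) (hκ : 0 ≤ κ) (h1 : ∀ u ∈ U, m ≤ |ν u|) (h2 : ∀ u ∈ U, |ν u| ≤ m⁻¹)
    (h3 : ∀ u ∈ U, κ ≤ |l' u|) {a b c d : ℝ} (ha : a ∈ U) (hb : b ∈ U) (hc : c ∈ U) (hd : d ∈ U)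
    (h : a + d = b + c) :
    m ^ 2 * κ * |b - a| * |c - a| ≤ |ν b * (ν a)⁻¹ - ν d * (ν c)⁻¹| := by
  have h0 : ∀ u ∈ U, ν u ≠ 0 := fun u hu h => by
    have := h1 u hu
    rw [h, abs_zero] at this
    linarith
  set V : Set ℝ := U ∩ {y | y + (b - a) ∈ U} with hV
  have hVc : V.OrdConnected := hU.inter ⟨fun x hx y hy z hz =>
    hU.out hx hy ⟨by linarith [hz.1], by linarith [hz.2]⟩⟩
  have haV : a ∈ V := ⟨ha, by simpa using hb⟩
  have hcV : c ∈ V := ⟨hc, by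
    have : c + (b - a) = d := by linarith
    simpa [this] using hd⟩
  have hder : ∀ y ∈ V, HasDerivAt (fun y => ν (y + (b - a)) * (ν y)⁻¹)
      (ν (y + (b - a)) * (ν y)⁻¹ * (l (y + (b - a)) - l y)) y := fun y hy => by
    have e1 := (hν _ hy.2).comp y ((hasDerivAt_id y).add_const (b - a))
    have e2 := (hν _ hy.1).inv (h0 _ hy.1)
    refine (e1.mul e2).congr_deriv ?_
    have := h0 _ hy.1
    simp only [Function.comp_apply, Pi.inv_apply, id]
    field_simp
    ring
  have := mul_abs_sub_le_of_hasDerivAt (c := m ^ 2 * (κ * |b - a|)) hVc hder (fun y hy => ?_) hcV haV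
  · have e : c + (b - a) = d := by linarith
    have e' : a + (b - a) = b := by ring
    simp only [e, e'] at this
    rw [abs_sub_comm (ν b * _)]
    linarith
  · rw [abs_mul, abs_mul, abs_inv]
    have e1 := mul_abs_sub_le_of_hasDerivAt hU hl h3 hy.2 hy.1
    rw [add_sub_cancel_left] at e1
    have e2 : m ≤ |ν y|⁻¹ := (le_inv_comm₀ hm (abs_pos.2 (h0 _ hy.1))).2 (h2 y hy.1)
    have e3 := mul_le_mul (h1 _ hy.2) e2 hm.le (abs_nonneg _)
    rw [← sq] at e3
    exact mul_le_mul e3 e1 (by positivity) (by positivity)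

namespace NondegenerateOn

variable {s K Q Θ α β : ℝ} {P₁ P₂ a b a' b' W' E' : ℝ → ℝ}

lemma ne_zero_of_le_abs {x : ℝ} (hK : 0 < K) (h : K⁻¹ ≤ |x|) : x ≠ 0 := fun h' => by
  rw [h', abs_zero] at h
  exact absurd (inv_pos.2 hK) (not_lt.2 h)

lemma K_pos (H : NondegenerateOn s K Q Θ α β P₁ P₂ a b a' b' W' E') : 0 < K := by
  linarith [H.K_large]

lemma abs_wronskian_le (H : NondegenerateOn s K Q Θ α β P₁ P₂ a b a' b' W' E') {τ : ℝ}
    (hτ : τ ∈ Set.Icc α β) : |a' τ * b τ - a τ * b' τ| ≤ 2 * K ^ 2 := by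
  have hK := H.K_pos.le
  have e1 := mul_le_mul (H.abs_a'_le τ hτ) (H.abs_b_le τ hτ) (abs_nonneg _) hK
  have e2 := mul_le_mul (H.abs_a_le τ hτ) (H.abs_b'_le τ hτ) (abs_nonneg _) hK
  refine (abs_sub _ _).trans ?_
  rw [abs_mul, abs_mul]
  linarith

lemma abs_div_le {x y : ℝ} (hK : 0 < K) (hx : |x| ≤ K) (hy : K⁻¹ ≤ |y|) : |x / y| ≤ K ^ 2 := by
  rw [abs_div, div_eq_mul_inv, sq]
  have : |y|⁻¹ ≤ K := by
    rw [inv_le_comm₀ (lt_of_lt_of_le (inv_pos.2 hK) hy) hK]; exact hy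
  exact mul_le_mul hx this (by positivity) hK.le

lemma inv_le_abs_div {x y : ℝ} (hK : 0 < K) (hx : K⁻¹ ≤ |x|) (hy0 : y ≠ 0) (hy : |y| ≤ K) :
    (K ^ 2)⁻¹ ≤ |x / y| := by
  rw [abs_div, div_eq_mul_inv, sq, mul_inv]
  have : K⁻¹ ≤ |y|⁻¹ := by
    rwa [inv_le_inv₀ hK (abs_pos.2 hy0)]
  exact mul_le_mul hx this (by positivity) (by positivity)

/-- The derivative of a quotient along the inverse parametrization. -/
lemma abs_slope_deriv_le {w x y z c : ℝ} (hK : 0 < K) (hw : |w| ≤ 2 * K ^ 2) (hx : K⁻¹ ≤ |x|)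
    (hy : K⁻¹ ≤ |y|) (hz : K⁻¹ ≤ |z|) (hc : |c| ≤ 1) :
    |w / (x * y) * (z⁻¹ * c)| ≤ 2 * K ^ 5 := by
  have inv : ∀ t : ℝ, K⁻¹ ≤ |t| → |t⁻¹| ≤ K := fun t ht => by
    rw [abs_inv, inv_le_comm₀ (lt_of_lt_of_le (inv_pos.2 hK) ht) hK]; exact ht
  have : w / (x * y) * (z⁻¹ * c) = w * (x⁻¹ * y⁻¹ * z⁻¹) * c := by
    rw [div_eq_mul_inv, mul_inv]; ring
  rw [this, abs_mul, abs_mul, abs_mul, abs_mul]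
  calc |w| * (|x⁻¹| * |y⁻¹| * |z⁻¹|) * |c| ≤ 2 * K ^ 2 * (K * K * K) * 1 := by
        gcongr <;> first | assumption | (apply inv; assumption)
    _ = 2 * K ^ 5 := by ring

variable {s K Q Θ α β : ℝ} {P₁ P₂ a b a' b' W' E' : ℝ → ℝ}

lemma bddC1_comp {b F F' G c : ℝ → ℝ} {I : Set ℝ} {A : ℝ} (hGI : ∀ u, G u ∈ I)
    (hG : ∀ u, HasDerivAt G ((b (G u))⁻¹ * c u) u) (hF : ∀ τ ∈ I, HasDerivAt F (F' τ) τ)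
    (hA : ∀ τ ∈ I, |F τ| ≤ A) (hA' : ∀ u, |F' (G u) * ((b (G u))⁻¹ * c u)| ≤ A) :
    BddC1 (fun u => F (G u)) A :=
  BddC1.of_hasDerivAt (fun u => (hF _ (hGI u)).comp u (hG u)) (fun u => hA _ (hGI u)) hA'

lemma hasDerivAt_div_b (H : NondegenerateOn s K Q Θ α β P₁ P₂ a b a' b' W' E') {τ : ℝ}
    (hτ : τ ∈ Set.Icc α β) :
    HasDerivAt (fun τ => a τ / b τ) ((a' τ * b τ - a τ * b' τ) / (b τ * b τ)) τ := by
  have h0 := ne_zero_of_le_abs H.K_pos (H.le_abs_b τ hτ)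
  refine ((H.hasDerivAt_a τ).div (H.hasDerivAt_b τ) h0).congr_deriv ?_
  rw [sq]

lemma hasDerivAt_div_e (H : NondegenerateOn s K Q Θ α β P₁ P₂ a b a' b' W' E') {τ : ℝ}
    (hτ : τ ∈ Set.Icc α β) :
    HasDerivAt (fun τ => a τ / (b τ - s * a τ))
      ((a' τ * b τ - a τ * b' τ) / ((b τ - s * a τ) * (b τ - s * a τ))) τ := by
  have h0 := ne_zero_of_le_abs H.K_pos (H.le_abs_e τ hτ)
  refine ((H.hasDerivAt_a τ).div
    ((H.hasDerivAt_b τ).sub ((H.hasDerivAt_a τ).const_mul s)) h0).congr_deriv ?_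
  rw [← sq]
  congr 1
  simp only [Pi.sub_apply]
  ring

lemma hasDerivAt_e_div (H : NondegenerateOn s K Q Θ α β P₁ P₂ a b a' b' W' E') {τ : ℝ}
    (hτ : τ ∈ Set.Icc α β) :
    HasDerivAt (fun τ => (a τ / (b τ - s * a τ))⁻¹)
      (-(a' τ * b τ - a τ * b' τ) / (a τ * a τ)) τ := by
  have h0 := ne_zero_of_le_abs H.K_pos (H.le_abs_a τ hτ)
  have h := ((H.hasDerivAt_b τ).sub ((H.hasDerivAt_a τ).const_mul s)).div (H.hasDerivAt_a τ) h0
  have e : (fun τ => (a τ / (b τ - s * a τ))⁻¹) = (b - fun τ => s * a τ) / a := by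
    funext τ; simp
  rw [e]
  refine h.congr_deriv ?_
  rw [← sq]
  congr 1
  simp only [Pi.sub_apply]
  ring

lemma curveData (H : NondegenerateOn s K Q Θ α β P₁ P₂ a b a' b' W' E') {G c q : ℝ → ℝ}
    (hGI : ∀ u, G u ∈ Set.Icc α β) (hG : ∀ u, HasDerivAt G ((b (G u))⁻¹ * c u) u)
    (hc : ∀ u, |c u| ≤ 1) (hq : ∀ u, HasDerivAt q (s * (a (G u) / b (G u))) u) :
    CurveData s (K ^ 12) q (fun u => a (G u) / b (G u))
      (fun u => a (G u) / (b (G u) - s * a (G u))) := by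
  have hK := H.K_pos
  have hK1 : 1 ≤ K := by linarith [H.K_large]
  have h2 : K ^ 2 ≤ K ^ 12 := pow_le_pow_right₀ hK1 (by norm_num)
  have h6 : 2 * K ^ 5 ≤ K ^ 12 := by
    calc 2 * K ^ 5 ≤ K * K ^ 5 := by gcongr; linarith [H.K_large]
      _ = K ^ 6 := by ring
      _ ≤ K ^ 12 := pow_le_pow_right₀ hK1 (by norm_num)
  have ha0 := fun u => ne_zero_of_le_abs hK (H.le_abs_a _ (hGI u))
  have hb0 := fun u => ne_zero_of_le_abs hK (H.le_abs_b _ (hGI u))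
  have he0 := fun u => ne_zero_of_le_abs hK (H.le_abs_e _ (hGI u))
  have hb := fun u => H.le_abs_b _ (hGI u)
  refine ⟨H.s_pos, H.s_le_one, ?_, hq, ?_, ?_, ?_, fun u => div_ne_zero (ha0 u) (he0 u),
    fun u => ?_⟩
  · calc (6 : ℝ) ≤ K ^ 1 := by rw [pow_one]; linarith [H.K_large]
      _ ≤ K ^ 12 := pow_le_pow_right₀ hK1 (by norm_num)
  · refine bddC1_comp hGI hG (fun τ hτ => H.hasDerivAt_div_b hτ) (fun τ hτ =>
      (abs_div_le hK (H.abs_a_le τ hτ) (H.le_abs_b τ hτ)).trans h2) fun u =>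
      (abs_slope_deriv_le hK (H.abs_wronskian_le (hGI u)) (hb u) (hb u) (hb u) (hc u)).trans h6
  · refine bddC1_comp hGI hG (fun τ hτ => H.hasDerivAt_div_e hτ) (fun τ hτ =>
      (abs_div_le hK (H.abs_a_le τ hτ) (H.le_abs_e τ hτ)).trans h2) fun u =>
      (abs_slope_deriv_le hK (H.abs_wronskian_le (hGI u)) (H.le_abs_e _ (hGI u))
        (H.le_abs_e _ (hGI u)) (hb u) (hc u)).trans h6
  · refine bddC1_comp (F := fun τ => (a τ / (b τ - s * a τ))⁻¹) hGI hG
      (fun τ hτ => H.hasDerivAt_e_div hτ) (fun τ hτ => ?_) fun u =>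
      (abs_slope_deriv_le hK ?_ (H.le_abs_a _ (hGI u))
        (H.le_abs_a _ (hGI u)) (hb u) (hc u)).trans h6
    · rw [inv_div]
      exact (abs_div_le hK (H.abs_e_le τ hτ) (H.le_abs_a τ hτ)).trans h2
    · rw [abs_neg]; exact H.abs_wronskian_le (hGI u)
  · have h1 := hb0 u
    have h3 := he0 u
    have e : 1 - s * (a (G u) / b (G u)) = (b (G u) - s * a (G u)) / b (G u) := by
      field_simp
    rw [e, div_mul_div_comm, mul_comm (b (G u)), mul_div_mul_left _ _ h3]

lemma curved (H : NondegenerateOn s K Q Θ α β P₁ P₂ a b a' b' W' E') {G : ℝ → ℝ} {U : Set ℝ}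
    (hU : U.OrdConnected) (hGI : ∀ u, G u ∈ Set.Icc α β)
    (hG : ∀ u ∈ U, HasDerivAt G (b (G u))⁻¹ u) {x y z t : ℝ} (hx : x ∈ U) (hy : y ∈ U)
    (hz : z ∈ U) (ht : t ∈ U) (h : x + t = y + z) :
    (K ^ 12)⁻¹ * |y - x| * |z - x| ≤
      |(fun u => a (G u) / (b (G u) - s * a (G u))) y *
        ((fun u => a (G u) / (b (G u) - s * a (G u))) x)⁻¹ -
      (fun u => a (G u) / (b (G u) - s * a (G u))) t *
        ((fun u => a (G u) / (b (G u) - s * a (G u))) z)⁻¹| := by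
  have hK := H.K_pos
  have ha0 := fun u => ne_zero_of_le_abs hK (H.le_abs_a _ (hGI u))
  have hb0 := fun u => ne_zero_of_le_abs hK (H.le_abs_b _ (hGI u))
  have he0 := fun u => ne_zero_of_le_abs hK (H.le_abs_e _ (hGI u))
  set W : ℝ → ℝ := fun τ => a' τ * b τ - a τ * b' τ with hW
  set E : ℝ → ℝ := fun τ => a τ * b τ * (b τ - s * a τ) with hE
  have hE0 : ∀ u, E (G u) ≠ 0 := fun u => mul_ne_zero (mul_ne_zero (ha0 u) (hb0 u)) (he0 u)
  have key := curved_of_hasDerivAt (ν := fun u => a (G u) / (b (G u) - s * a (G u)))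
    (l := fun u => W (G u) / E (G u))
    (l' := fun u => (W' (G u) * E (G u) - W (G u) * E' (G u)) / E (G u) ^ 2 * (b (G u))⁻¹)
    (m := (K ^ 2)⁻¹) (κ := (K ^ 8)⁻¹) hU (fun u hu => ?_) (fun u hu => ?_) (by positivity)
    (by positivity) (fun u hu => inv_le_abs_div hK (H.le_abs_a _ (hGI u)) (he0 u)
      (H.abs_e_le _ (hGI u))) (fun u hu => ?_) (fun u hu => ?_) hx hy hz ht h
  · convert key using 3
    rw [inv_pow, ← mul_inv]; ring
  · refine ((H.hasDerivAt_div_e (hGI u)).comp u (hG u hu)).congr_deriv ?_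
    have h1 := ha0 u
    have h2 := hb0 u
    have h3 := he0 u
    simp only [hW, hE]
    field_simp
  · exact ((H.hasDerivAt_wronskian _).div (H.hasDerivAt_prod _) (hE0 u)).comp u (hG u hu)
  · rw [inv_inv]; exact abs_div_le hK (H.abs_a_le _ (hGI u)) (H.le_abs_e _ (hGI u))
  · rw [abs_mul, abs_div, abs_inv, abs_pow]
    have e1 : |E (G u)| ≤ K * K * K := by
      simp only [hE]
      rw [abs_mul, abs_mul]
      gcongr
      · exact H.abs_a_le _ (hGI u)
      · exact H.abs_b_le _ (hGI u)
      · exact H.abs_e_le _ (hGI u)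
    have e2 := H.le_abs_curv _ (hGI u)
    have e3 := H.abs_b_le _ (hGI u)
    have e4 := abs_pos.2 (hE0 u)
    have e5 := abs_pos.2 (hb0 u)
    calc (K ^ 8)⁻¹ = K⁻¹ / (K * K * K) ^ 2 * K⁻¹ := by field_simp
      _ ≤ |W' (G u) * E (G u) - W (G u) * E' (G u)| / |E (G u)| ^ 2 * |b (G u)|⁻¹ := by
        gcongr

lemma integral_transfer_le (H : NondegenerateOn s K Q Θ α β P₁ P₂ a b a' b' W' E')
    {g q w : ℝ → ℝ} {U : Set ℝ} (hU : MeasurableSet U) (hinj : Set.InjOn P₂ (Set.Icc α β))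
    (hg : ∀ u ∈ U, g u ∈ Set.Icc α β ∧ P₂ (g u) = u) (hq : ∀ u ∈ U, q u = P₁ (g u))
    (hUf : volume U ≠ ⊤) (hqc : Continuous q) (hwc : Continuous w)
    (hw0 : ∀ u, 0 ≤ w u) (hw1 : ∀ u, w u ≤ 1) (hwU : ∀ u, u ∉ U → w u = 0)
    {h : ℝ → ℝ → ℝ} (hh : Measurable (Function.uncurry h)) (h0 : ∀ x y, 0 ≤ h x y)
    (h1 : ∀ x y, h x y ≤ 1) :
    ∫ u, w u * h (q u) u ≤ K * ∫ τ in Set.Icc (0 : ℝ) 1, h (P₁ τ) (P₂ τ) := by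
  have hK := H.K_pos
  have hP₁c : Continuous P₁ := continuous_iff_continuousAt.2 fun τ =>
    (H.hasDerivAt₁ τ).continuousAt
  have hP₂c : Continuous P₂ := continuous_iff_continuousAt.2 fun τ =>
    (H.hasDerivAt₂ τ).continuousAt
  have mF : Measurable fun u => h (q u) u := hh.comp (hqc.measurable.prodMk measurable_id)
  have mP : Measurable fun τ => h (P₁ τ) (P₂ τ) := hh.comp (hP₁c.measurable.prodMk hP₂c.measurable)
  have iF : ∀ {S : Set ℝ} {F : ℝ → ℝ}, volume S ≠ ⊤ → Measurable F → (∀ x, 0 ≤ F x) →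
      (∀ x, F x ≤ 1) → IntegrableOn F S := fun {S F} hS mF h0 h1 =>
    Measure.integrableOn_of_bounded hS mF.aestronglyMeasurable (M := 1)
      (Filter.Eventually.of_forall fun x => by
        rw [Real.norm_eq_abs, abs_of_nonneg (h0 x)]; exact h1 x)
  set T : Set ℝ := Set.Icc α β ∩ P₂ ⁻¹' U with hT
  have mT : MeasurableSet T := measurableSet_Icc.inter (hP₂c.measurable hU)
  have himg : P₂ '' T = U := by
    ext u
    constructor
    · rintro ⟨τ, hτ, rfl⟩; exact hτ.2
    · intro hu
      exact ⟨g u, ⟨(hg u hu).1, by rw [Set.mem_preimage, (hg u hu).2]; exact hu⟩, (hg u hu).2⟩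
  have hTI : T ⊆ Set.Icc 0 1 := fun τ hτ =>
    ⟨H.nonneg.trans hτ.1.1, hτ.1.2.trans H.le_one⟩
  have cov := integral_image_eq_integral_abs_deriv_smul mT (fun τ _ =>
    (H.hasDerivAt₂ τ).hasDerivWithinAt) (hinj.mono Set.inter_subset_left) fun u => h (q u) u
  rw [himg] at cov
  have hTf : volume T ≠ ⊤ := ((measure_mono hTI).trans_lt measure_Icc_lt_top).ne
  calc ∫ u, w u * h (q u) u = ∫ u in U, w u * h (q u) u :=
        (setIntegral_eq_integral_of_forall_compl_eq_zero fun u hu => by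
          rw [hwU u hu, zero_mul]).symm
    _ ≤ ∫ u in U, h (q u) u := by
        refine setIntegral_mono (iF hUf (hwc.measurable.mul mF) (fun u => mul_nonneg (hw0 u)
          (h0 _ _)) fun u => mul_le_one₀ (hw1 u) (h0 _ _) (h1 _ _))
          (iF hUf mF (fun u => h0 _ _) fun u => h1 _ _) fun u => ?_
        exact mul_le_of_le_one_left (h0 _ _) (hw1 u)
    _ = ∫ τ in T, |b τ| • h (q (P₂ τ)) (P₂ τ) := cov
    _ = ∫ τ in T, |b τ| * h (P₁ τ) (P₂ τ) := by
        refine setIntegral_congr_fun mT fun τ hτ => ?_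
        have e1 := hg _ hτ.2
        have e2 := hinj e1.1 hτ.1 e1.2
        simp only [smul_eq_mul]
        rw [hq _ hτ.2, e2]
    _ ≤ ∫ τ in T, K * h (P₁ τ) (P₂ τ) := by
        have iK := (iF hTf mP (fun _ => h0 _ _) fun _ => h1 _ _).const_mul K
        refine integral_mono_of_nonneg (Filter.Eventually.of_forall fun τ =>
          mul_nonneg (abs_nonneg _) (h0 _ _)) iK ?_
        filter_upwards [ae_restrict_mem mT] with τ hτ
        exact mul_le_mul_of_nonneg_right (H.abs_b_le τ hτ.1) (h0 _ _)
    _ = K * ∫ τ in T, h (P₁ τ) (P₂ τ) := integral_const_mul _ _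
    _ ≤ K * ∫ τ in Set.Icc (0 : ℝ) 1, h (P₁ τ) (P₂ τ) := by
        refine mul_le_mul_of_nonneg_left ?_ hK.le
        exact setIntegral_mono_set (iF measure_Icc_lt_top.ne mP (fun _ => h0 _ _) fun _ => h1 _ _)
          (Filter.Eventually.of_forall fun τ => h0 _ _) hTI.eventuallyLE

end NondegenerateOn

/-- A continuously extended inverse: `softClamp` rescaled to a ball. -/
noncomputable def clampTo (u₀ ρ u : ℝ) : ℝ := u₀ + ρ * softClamp ((u - u₀) / ρ)

lemma hasDerivAt_clampTo {ρ : ℝ} (hρ : 0 < ρ) (u₀ u : ℝ) :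
    HasDerivAt (clampTo u₀ ρ) (softClampDeriv ((u - u₀) / ρ)) u := by
  have h1 := (hasDerivAt_softClamp ((u - u₀) / ρ)).comp u
    (((hasDerivAt_id u).sub_const u₀).div_const ρ)
  refine ((h1.const_mul ρ).const_add u₀).congr_deriv ?_
  field_simp

lemma abs_clampTo_sub_lt {ρ : ℝ} (hρ : 0 < ρ) (u₀ u : ℝ) : |clampTo u₀ ρ u - u₀| < ρ := by
  rw [clampTo, add_sub_cancel_left, abs_mul, abs_of_pos hρ]
  nlinarith [abs_softClamp_le ((u - u₀) / ρ)]

lemma clampTo_of_abs_le {ρ u₀ u : ℝ} (hρ : 0 < ρ) (hu : |u - u₀| ≤ ρ / 4) :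
    clampTo u₀ ρ u = u := by
  rw [clampTo, softClamp_of_abs_le]
  · field_simp; ring
  · rw [abs_div, abs_of_pos hρ, div_le_iff₀ hρ]; linarith

/-- The bump function of a ball. -/
noncomputable def ballBump (u₀ r u : ℝ) : ℝ := bump ((u - u₀) / r)

lemma hasDerivAt_ballBump {r : ℝ} (u₀ u : ℝ) : HasDerivAt (ballBump u₀ r)
    (-4 * ((u - u₀) / r) * max 0 (1 - ((u - u₀) / r) ^ 2) * (1 / r)) u :=
  (hasDerivAt_bump ((u - u₀) / r)).comp u (((hasDerivAt_id u).sub_const u₀).div_const r)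

lemma bddC1_ballBump {r M : ℝ} (hr : 0 < r) (h1 : 1 ≤ M) (h2 : 4 / r ≤ M) (u₀ : ℝ) :
    BddC1 (ballBump u₀ r) M := by
  refine BddC1.of_hasDerivAt (hasDerivAt_ballBump u₀) (fun u => ?_) fun u => ?_
  · exact (abs_of_nonneg (bump_nonneg _)).trans_le ((bump_le_one _).trans h1)
  · rw [abs_mul, abs_of_pos (one_div_pos.2 hr)]
    refine le_trans ?_ h2
    rw [div_eq_mul_one_div 4]
    exact mul_le_mul_of_nonneg_right (abs_deriv_bump_le _) (one_div_pos.2 hr).le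

lemma ballBump_eq_zero {u₀ r u : ℝ} (hr : 0 < r) (hu : ¬|u - u₀| ≤ r) : ballBump u₀ r u = 0 := by
  refine bump_eq_zero ?_
  rw [abs_div, abs_of_pos hr, le_div_iff₀ hr]
  linarith [not_le.1 hu]

lemma half_le_integral_ballBump {r : ℝ} (hr : 0 < r) (u₀ : ℝ) :
    r / 2 ≤ ∫ u, ballBump u₀ r u := by
  have hc : Continuous (ballBump u₀ r) := continuous_iff_continuousAt.2 fun u =>
    (hasDerivAt_ballBump u₀ u).continuousAt
  have hint : Integrable (ballBump u₀ r) := by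
    refine hc.integrable_of_hasCompactSupport ?_
    refine HasCompactSupport.intro (isCompact_Icc (a := u₀ - r) (b := u₀ + r)) fun u hu => ?_
    refine ballBump_eq_zero hr fun h => hu ?_
    rw [abs_le] at h
    constructor <;> linarith
  have h1 : ∫ _ in Set.Icc (u₀ - r / 2) (u₀ + r / 2), (1 / 2 : ℝ) = r / 2 := by
    rw [setIntegral_const, measureReal_def, Real.volume_Icc, ENNReal.toReal_ofReal (by linarith),
      smul_eq_mul]
    ring
  rw [← h1]
  refine le_trans (setIntegral_mono_on (integrableOn_const (by simp)) hint.integrableOn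
    measurableSet_Icc fun u hu => ?_) (setIntegral_le_integral hint
      (Filter.Eventually.of_forall fun u => bump_nonneg _))
  refine half_le_bump ?_
  rw [abs_div, abs_of_pos hr, div_le_iff₀ hr, abs_le]
  constructor <;> linarith [hu.1, hu.2]

theorem NondegenerateOn.exists_isArc {s K Q Θ α β : ℝ} {P₁ P₂ a b a' b' W' E' : ℝ → ℝ}
    (H : NondegenerateOn s K Q Θ α β P₁ P₂ a b a' b' W' E') :
    ∃ (q p ν w : ℝ → ℝ) (U : Set ℝ), IsArc s (K ^ 12) Q Θ P₁ P₂ q p ν w U := by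
  have hK := H.K_pos
  have hK1 : 1 ≤ K := by linarith [H.K_large]
  have hαβ : α < β := by linarith [H.le_sub, inv_pos.2 hK]
  obtain ⟨u₀, ρ, g, hρ, hg, hinj⟩ := exists_inverse hαβ hK H.hasDerivAt₂ H.le_abs_b
  have hρ' : (K ^ 2)⁻¹ ≤ 2 * ρ := by
    refine le_trans ?_ hρ
    rw [sq, mul_inv]
    exact mul_le_mul_of_nonneg_left H.le_sub (by positivity)
  have hρ0 : 0 < ρ := by
    have : 0 < (K ^ 2)⁻¹ := by positivity
    linarith
  set G : ℝ → ℝ := fun u => g (clampTo u₀ ρ u) with hGdef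
  have hGI : ∀ u, G u ∈ Set.Icc α β := fun u => (hg _ (abs_clampTo_sub_lt hρ0 u₀ u)).1
  have hG : ∀ u, HasDerivAt G ((b (G u))⁻¹ * softClampDeriv ((u - u₀) / ρ)) u := fun u =>
    (hg _ (abs_clampTo_sub_lt hρ0 u₀ u)).2.2.comp u (hasDerivAt_clampTo hρ0 u₀ u)
  have hGc : Continuous G := continuous_iff_continuousAt.2 fun u => (hG u).continuousAt
  have hb0 := fun u => ne_zero_of_le_abs hK (H.le_abs_b _ (hGI u))
  have hac : Continuous a := continuous_iff_continuousAt.2 fun τ => (H.hasDerivAt_a τ).continuousAt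
  have hbc : Continuous b := continuous_iff_continuousAt.2 fun τ => (H.hasDerivAt_b τ).continuousAt
  have hpc : Continuous fun u => a (G u) / b (G u) :=
    (hac.comp hGc).div (hbc.comp hGc) hb0
  set U : Set ℝ := Set.Icc (u₀ - ρ / 4) (u₀ + ρ / 4) with hUdef
  have hUabs : ∀ u, u ∈ U ↔ |u - u₀| ≤ ρ / 4 := fun u => by
    rw [abs_le, hUdef, Set.mem_Icc]
    constructor <;> rintro ⟨h1, h2⟩ <;> constructor <;> linarith
  have hGU : ∀ u ∈ U, G u = g u := fun u hu => by
    simp only [hGdef]; rw [clampTo_of_abs_le hρ0 ((hUabs u).1 hu)]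
  have hgU : ∀ u ∈ U, g u ∈ Set.Icc α β ∧ P₂ (g u) = u := fun u hu => by
    have := hg u (((hUabs u).1 hu).trans_lt (by linarith))
    exact ⟨this.1, this.2.1⟩
  have hGderU : ∀ u ∈ U, HasDerivAt G (b (G u))⁻¹ u := fun u hu => by
    have := hG u
    rwa [softClampDeriv_of_abs_le, mul_one] at this
    rw [abs_div, abs_of_pos hρ0, div_le_iff₀ hρ0]
    linarith [(hUabs u).1 hu]
  set q : ℝ → ℝ := fun u => P₁ (G u₀) + s * ∫ t in u₀..u, a (G t) / b (G t) with hqdef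
  have hq : ∀ u, HasDerivAt q (s * (a (G u) / b (G u))) u := fun u =>
    ((hpc.integral_hasStrictDerivAt u₀ u).hasDerivAt.const_mul s).const_add _
  have hqc : Continuous q := continuous_iff_continuousAt.2 fun u => (hq u).continuousAt
  have hu₀U : u₀ ∈ U := ⟨by linarith, by linarith⟩
  have hqU : ∀ u ∈ U, q u = P₁ (g u) := fun u hu => by
    have hsub : Set.uIcc u₀ u ⊆ U := Set.OrdConnected.uIcc_subset Set.ordConnected_Icc hu₀U hu
    have := intervalIntegral.integral_eq_sub_of_hasDerivAt (f := fun u => P₁ (G u))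
      (f' := fun t => s * (a (G t) / b (G t))) (a := u₀) (b := u) (fun t ht => by
        refine ((H.hasDerivAt₁ _).comp t (hGderU t (hsub ht))).congr_deriv ?_
        rw [mul_assoc, div_eq_mul_inv]) ((hpc.const_mul s).intervalIntegrable _ _)
    rw [intervalIntegral.integral_const_mul] at this
    simp only [hqdef]
    rw [this, ← hGU u hu]
    ring
  have hr : 0 < ρ / 4 := by linarith
  have hwc : Continuous (ballBump u₀ (ρ / 4)) := continuous_iff_continuousAt.2 fun u =>
    (hasDerivAt_ballBump u₀ u).continuousAt
  have hw0 : ∀ u, u ∉ U → ballBump u₀ (ρ / 4) u = 0 := fun u hu =>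
    ballBump_eq_zero hr fun h => hu ((hUabs u).2 h)
  have hM1 : (1 : ℝ) ≤ K ^ 12 := one_le_pow₀ hK1
  have hK3 : 16 * K ^ 2 ≤ K ^ 3 := by
    rw [pow_succ K 2, mul_comm]; exact mul_le_mul_of_nonneg_left H.K_large (by positivity)
  refine ⟨q, fun u => a (G u) / b (G u), fun u => a (G u) / (b (G u) - s * a (G u)),
    ballBump u₀ (ρ / 4), U, ?_⟩
  refine ⟨H.curveData hGI hG (fun u => abs_softClampDeriv_le _) hq, ?_, fun u hu => ?_,
    fun u hu => ?_, ?_, fun h mh h0 h1 => ?_⟩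
  · refine ⟨bddC1_ballBump hr hM1 ?_ u₀, fun u => bump_nonneg _, fun u => bump_le_one _, hw0,
      fun u hu => ?_, fun x hx y hy z hz t ht => H.curved Set.ordConnected_Icc hGI hGderU hx hy hz ht⟩
    · rw [div_le_iff₀ hr]
      have e1 : 1 ≤ 2 * ρ * K ^ 2 := by
        rwa [inv_le_iff_one_le_mul₀ (by positivity)] at hρ'
      have e2 : K ^ 4 ≤ K ^ 12 := pow_le_pow_right₀ hK1 (by norm_num)
      have e3 : 256 * K ^ 2 ≤ K ^ 4 := by nlinarith [H.K_large]
      nlinarith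
    · refine le_trans ?_ (inv_le_abs_div hK (H.le_abs_a _ (hGI u)) (hb0 u) (H.abs_b_le _ (hGI u)))
      exact inv_anti₀ (by positivity) (pow_le_pow_right₀ hK1 (by norm_num))
  · rw [← (hgU u hu).2]; exact H.abs_P₂_le _ (hgU u hu).1
  · rw [hqU u hu]; exact H.abs_P₁_le _ (hgU u hu).1
  · refine le_trans ?_ (half_le_integral_ballBump hr u₀)
    have e2 : K ^ 3 ≤ K ^ 12 := pow_le_pow_right₀ hK1 (by norm_num)
    have e3 : (K ^ 12)⁻¹ ≤ (16 * K ^ 2)⁻¹ := inv_anti₀ (by positivity) (hK3.trans e2)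
    rw [mul_inv] at e3
    linarith
  · refine (H.integral_transfer_le measurableSet_Icc hinj hgU hqU measure_Icc_lt_top.ne hqc hwc
      (fun u => bump_nonneg _) (fun u => bump_le_one _) hw0 mh h0 h1).trans ?_
    refine mul_le_mul_of_nonneg_right ?_ (integral_nonneg fun τ => h0 _ _)
    calc K = K ^ 1 := (pow_one K).symm
      _ ≤ K ^ 12 := pow_le_pow_right₀ hK1 (by norm_num)

namespace Polynomial

lemma coeff_derivative_mul (A B : ℝ[X]) {k : ℕ} (h : k + 1 = A.natDegree + B.natDegree) :
    (derivative A * B).coeff k = A.natDegree * (A.leadingCoeff * B.leadingCoeff) := by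
  rcases hA : A.natDegree with _ | m
  · rw [derivative_of_natDegree_zero hA]; simp
  · have hk : k = m + B.natDegree := by lia
    rw [hk, coeff_mul_add_eq_of_natDegree_le (by rw [natDegree_derivative, hA]; simp) le_rfl,
      coeff_derivative, leadingCoeff, leadingCoeff, hA]
    push_cast
    ring

lemma natDegree_derivative_mul_le (A B : ℝ[X]) {k : ℕ} (h : k + 1 = A.natDegree + B.natDegree) :
    (derivative A * B).natDegree ≤ k := by
  rcases hA : A.natDegree with _ | m
  · rw [derivative_of_natDegree_zero hA]; simp
  · refine natDegree_mul_le.trans ?_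
    rw [natDegree_derivative]
    lia

/-- The Wronskian of polynomials of different degrees has the expected degree. -/
lemma natDegree_derivative_mul_sub {A B : ℝ[X]} (hA : A ≠ 0) (hB : B ≠ 0)
    (h : A.natDegree ≠ B.natDegree) :
    (derivative A * B - A * derivative B).natDegree + 1 = A.natDegree + B.natDegree ∧
      derivative A * B - A * derivative B ≠ 0 := by
  obtain ⟨k, hk⟩ : ∃ k, k + 1 = A.natDegree + B.natDegree :=
    ⟨A.natDegree + B.natDegree - 1, by lia⟩
  have hk' : k + 1 = B.natDegree + A.natDegree := by rw [hk, add_comm]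
  have hc : (derivative A * B - A * derivative B).coeff k ≠ 0 := by
    rw [coeff_sub, coeff_derivative_mul A B hk, mul_comm A, coeff_derivative_mul B A hk',
      mul_comm B.leadingCoeff, ← sub_mul]
    refine mul_ne_zero (sub_ne_zero.2 (by exact_mod_cast h)) (mul_ne_zero ?_ ?_) <;> simpa
  refine ⟨?_, fun h0 => hc (by rw [h0, coeff_zero])⟩
  rw [natDegree_eq_of_le_of_coeff_ne_zero _ hc, hk]
  refine (natDegree_sub_le _ _).trans (max_le (natDegree_derivative_mul_le A B hk) ?_)
  rw [mul_comm]
  exact natDegree_derivative_mul_le B A hk'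

/-- The sum of the absolute values of the coefficients. -/
noncomputable def coeffSum (A : ℝ[X]) : ℝ := ∑ i ∈ Finset.range (A.natDegree + 1), |A.coeff i|

lemma coeffSum_nonneg (A : ℝ[X]) : 0 ≤ coeffSum A := Finset.sum_nonneg fun _ _ => abs_nonneg _

lemma abs_eval_le (A : ℝ[X]) {R τ : ℝ} (hR : 1 ≤ R) (hτ : τ ∈ Set.Icc (0 : ℝ) 1) :
    |A.eval (R * τ)| ≤ coeffSum A * R ^ A.natDegree := by
  rw [eval_eq_sum_range, coeffSum, Finset.sum_mul]
  refine (Finset.abs_sum_le_sum_abs _ _).trans (Finset.sum_le_sum fun i hi => ?_)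
  rw [abs_mul]
  refine mul_le_mul_of_nonneg_left ?_ (abs_nonneg _)
  have hR0 : 0 ≤ R := by linarith
  rw [abs_of_nonneg (pow_nonneg (mul_nonneg hR0 hτ.1) _)]
  calc (R * τ) ^ i ≤ R ^ i := pow_le_pow_left₀ (mul_nonneg hR0 hτ.1)
        (mul_le_of_le_one_right hR0 hτ.2) _
    _ ≤ R ^ A.natDegree := pow_le_pow_right₀ hR (Nat.lt_succ_iff.1 (Finset.mem_range.1 hi))

lemma abs_eval_le_mul (A : ℝ[X]) (hA : A.eval 0 = 0) (hA1 : 1 ≤ A.natDegree) {R τ : ℝ}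
    (hR : 1 ≤ R) (hτ : τ ∈ Set.Icc (0 : ℝ) 1) :
    |A.eval (R * τ)| ≤ coeffSum A.divX * τ * R ^ A.natDegree := by
  have h1 := divX_mul_X_add A
  rw [coeff_zero_eq_eval_zero, hA, C_0, add_zero] at h1
  have h2 := abs_eval_le A.divX hR hτ
  rw [natDegree_divX_eq_natDegree_tsub_one] at h2
  obtain ⟨k, hk⟩ : ∃ k, A.natDegree = k + 1 := ⟨A.natDegree - 1, by lia⟩
  have hRτ : 0 ≤ R * τ := mul_nonneg (by linarith) hτ.1
  conv_lhs => rw [← h1]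
  rw [eval_mul, eval_X, abs_mul, abs_of_nonneg hRτ]
  rw [hk, Nat.add_sub_cancel] at h2
  calc |A.divX.eval (R * τ)| * (R * τ) ≤ coeffSum A.divX * R ^ k * (R * τ) :=
        mul_le_mul_of_nonneg_right h2 hRτ
    _ = coeffSum A.divX * τ * R ^ A.natDegree := by rw [hk, pow_succ]; ring

lemma abs_mul_eval_derivative_le (A : ℝ[X]) {R τ : ℝ} (hR : 1 ≤ R) (hτ : τ ∈ Set.Icc (0 : ℝ) 1) :
    |R * (derivative A).eval (R * τ)| ≤ coeffSum (derivative A) * R ^ A.natDegree := by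
  have hR0 : 0 ≤ R := by linarith
  rcases hA : A.natDegree with _ | m
  · rw [derivative_of_natDegree_zero hA]; simp [coeffSum]
  · have := abs_eval_le (derivative A) hR hτ
    rw [natDegree_derivative, hA, Nat.add_sub_cancel] at this
    rw [abs_mul, abs_of_nonneg hR0, pow_succ]
    nlinarith

lemma exists_gap (S : Multiset ℝ) {η : ℝ} (hη : 0 < η) :
    ∃ k : ℕ, k ≤ S.card ∧ ∀ r ∈ S, ∀ t ∈ Set.Icc (3 * η * k + η) (3 * η * k + 2 * η),
      η ≤ |t - r| := by
  have h3 : 0 < 3 * η := by linarith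
  obtain ⟨k, hk, hkS⟩ : ∃ k ∈ (Finset.range (S.card + 1)).image (fun k : ℕ => (k : ℤ)),
      k ∉ (S.map fun r => ⌊r / (3 * η)⌋).toFinset := by
    refine Finset.exists_mem_notMem_of_card_lt_card ?_
    rw [Finset.card_image_of_injective _ Nat.cast_injective, Finset.card_range]
    exact Nat.lt_succ_iff.2 ((Multiset.toFinset_card_le _).trans (Multiset.card_map _ _).le)
  obtain ⟨k, hk', rfl⟩ := Finset.mem_image.1 hk
  refine ⟨k, Nat.lt_succ_iff.1 (Finset.mem_range.1 hk'), fun r hr t ht => ?_⟩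
  have hne : ⌊r / (3 * η)⌋ ≠ k := fun h => hkS (by
    rw [Multiset.mem_toFinset, Multiset.mem_map]; exact ⟨r, hr, h⟩)
  rw [le_abs]
  by_contra! hcon
  refine hne (Int.floor_eq_iff.2 ⟨?_, ?_⟩)
  · rw [le_div_iff₀ h3]; push_cast; linarith [ht.1]
  · rw [div_lt_iff₀ h3]; push_cast; linarith [ht.2]

lemma pow_card_le_norm_prod_map {S : Multiset ℂ} {F : ℂ → ℂ} {x : ℝ} (hx : 0 ≤ x)
    (h : ∀ z ∈ S, x ≤ ‖F z‖) : x ^ S.card ≤ ‖(S.map F).prod‖ := by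
  induction S using Multiset.induction with
  | empty => simp
  | cons z S ih =>
    rw [Multiset.card_cons, Multiset.map_cons, Multiset.prod_cons, pow_succ', norm_mul]
    exact mul_le_mul (h z (Multiset.mem_cons_self z S))
      (ih fun y hy => h y (Multiset.mem_cons_of_mem hy)) (pow_nonneg hx _)
      (hx.trans (h z (Multiset.mem_cons_self z S)))

/-- A rescaled polynomial is bounded below on a long interval. -/
lemma exists_interval_le_abs_eval (A : ℝ[X]) {R θ η : ℝ} (hR : 1 ≤ R) (hη : 0 < η)
    (h : 3 * η * (A.natDegree + 1) ≤ θ) :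
    ∃ α β : ℝ, 0 ≤ α ∧ β ≤ θ ∧ β - α = η ∧ ∀ τ ∈ Set.Icc α β,
      |A.leadingCoeff| * η ^ A.natDegree * R ^ A.natDegree ≤ |A.eval (R * τ)| := by
  have hR0 : 0 < R := by linarith
  set B : ℂ[X] := A.map (algebraMap ℝ ℂ) with hB
  have hsp := IsAlgClosed.splits B
  have hdeg : B.roots.card = A.natDegree := by
    rw [splits_iff_card_roots.1 hsp, hB, natDegree_map]
  obtain ⟨k, hk, hgap⟩ := exists_gap (B.roots.map fun z => z.re / R) hη
  rw [Multiset.card_map, hdeg] at hk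
  have hk' : (k : ℝ) ≤ A.natDegree := by exact_mod_cast hk
  refine ⟨3 * η * k + η, 3 * η * k + 2 * η, by positivity, by nlinarith, by ring, fun τ hτ => ?_⟩
  have e1 : (|A.eval (R * τ)| : ℝ) = ‖B.eval ((R * τ : ℝ) : ℂ)‖ := by
    rw [hB, ← Complex.coe_algebraMap, eval_map_algebraMap, aeval_algebraMap_apply,
      Complex.coe_algebraMap, Complex.norm_real, Real.norm_eq_abs, coe_aeval_eq_eval]
  rw [e1, hsp.eval_eq_prod_roots, norm_mul, hB, leadingCoeff_map, Complex.coe_algebraMap,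
    Complex.norm_real, Real.norm_eq_abs, ← hB, mul_assoc, ← mul_pow]
  refine mul_le_mul_of_nonneg_left ?_ (abs_nonneg _)
  rw [← hdeg]
  refine pow_card_le_norm_prod_map (by positivity) fun z hz => ?_
  have e2 := hgap _ (Multiset.mem_map_of_mem _ hz) τ hτ
  have e3 := Complex.abs_re_le_norm (((R * τ : ℝ) : ℂ) - z)
  rw [Complex.sub_re, Complex.ofReal_re] at e3
  refine le_trans ?_ e3
  have e4 : R * τ - z.re = R * (τ - z.re / R) := by field_simp
  rw [e4, abs_mul, abs_of_pos hR0, mul_comm]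
  exact mul_le_mul_of_nonneg_left e2 hR0.le

/-- The evaluation of a polynomial at scale `R`, normalized by its degree. -/
noncomputable def scaledEval (A : ℝ[X]) (R τ : ℝ) : ℝ := A.eval (R * τ) / R ^ A.natDegree

variable {A B : ℝ[X]} {R τ : ℝ}

lemma hasDerivAt_eval_mul_div (A : ℝ[X]) (R c τ : ℝ) : HasDerivAt (fun τ => A.eval (R * τ) / c)
    (R * (derivative A).eval (R * τ) / c) τ := by
  have h := ((A.hasDerivAt (R * τ)).comp τ ((hasDerivAt_id τ).const_mul R)).div_const c
  refine h.congr_deriv ?_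
  ring

lemma scaledEval_mul (hA : A ≠ 0) (hB : B ≠ 0) :
    scaledEval (A * B) R τ = scaledEval A R τ * scaledEval B R τ := by
  rw [scaledEval, scaledEval, scaledEval, eval_mul, natDegree_mul hA hB, pow_add,
    div_mul_div_comm]

lemma abs_scaledEval_le (A : ℝ[X]) (hR : 1 ≤ R) (hτ : τ ∈ Set.Icc (0 : ℝ) 1) :
    |scaledEval A R τ| ≤ coeffSum A := by
  have : 0 < R ^ A.natDegree := by positivity
  rw [scaledEval, abs_div, abs_of_pos this, div_le_iff₀ this]
  exact abs_eval_le A hR hτ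

lemma abs_scaledEval_deriv_le (A : ℝ[X]) (hR : 1 ≤ R) (hτ : τ ∈ Set.Icc (0 : ℝ) 1) :
    |R * (derivative A).eval (R * τ) / R ^ A.natDegree| ≤ coeffSum (derivative A) := by
  have : 0 < R ^ A.natDegree := by positivity
  rw [abs_div, abs_of_pos this, div_le_iff₀ this]
  exact abs_mul_eval_derivative_le A hR hτ

/-- Four bounded numbers with a large product are all large. -/
lemma le_abs_of_le_abs_mul {x y z t T l κ : ℝ} (hx : |x| ≤ T) (hy : |y| ≤ T) (hz : |z| ≤ T)
    (ht : |t| ≤ T) (h : l ≤ |x * y * z * t|) (hT : 0 < T) (hκ : κ * T ^ 3 ≤ l) :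
    κ ≤ |x| ∧ κ ≤ |y| ∧ κ ≤ |z| ∧ κ ≤ |t| := by
  have key : ∀ x y z t : ℝ, |y| ≤ T → |z| ≤ T → |t| ≤ T → l ≤ |x| * (|y| * |z| * |t|) →
      κ ≤ |x| := fun x y z t hy hz ht h => by
    have h1 : |y| * |z| * |t| ≤ T * T * T := by gcongr
    have h2 := mul_le_mul_of_nonneg_left h1 (abs_nonneg x)
    have h3 : κ * T ^ 3 ≤ |x| * T ^ 3 := by
      calc κ * T ^ 3 ≤ l := hκ
        _ ≤ |x| * (T * T * T) := h.trans h2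
        _ = |x| * T ^ 3 := by ring
    exact le_of_mul_le_mul_right h3 (by positivity)
  rw [abs_mul, abs_mul, abs_mul] at h
  refine ⟨key x y z t hy hz ht ?_, key y x z t hx hz ht ?_, key z x y t hx hy ht ?_,
    key t x y z hx hy hz ?_⟩ <;> linarith

/-- Degrees of the polynomials controlling the curvature of `(P₁, P₂)`. -/
lemma natDegree_curvature {P₁ P₂ A B F W E Z : ℝ[X]}
    (hA : A = derivative P₁) (hB : B = derivative P₂) (hF : F = B - A)
    (hW : W = derivative A * B - A * derivative B) (hE : E = A * B * F)
    (hZ : Z = derivative W * E - W * derivative E)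
    (h1 : 1 ≤ P₁.natDegree) (h12 : P₁.natDegree < P₂.natDegree) :
    P₁.natDegree = A.natDegree + 1 ∧ P₂.natDegree = B.natDegree + 1 ∧
      F.natDegree = B.natDegree ∧ A ≠ 0 ∧ B ≠ 0 ∧ F ≠ 0 ∧ Z ≠ 0 ∧
      Z.natDegree + 2 = A.natDegree + B.natDegree + E.natDegree := by
  have hAd : P₁.natDegree = A.natDegree + 1 := by rw [hA, natDegree_derivative]; lia
  have hBd : P₂.natDegree = B.natDegree + 1 := by rw [hB, natDegree_derivative]; lia
  have hlt : A.natDegree < B.natDegree := by lia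
  have hFd : F.natDegree = B.natDegree := by rw [hF, natDegree_sub_eq_left_of_natDegree_lt hlt]
  have hA0 : A ≠ 0 := fun h => by
    rw [hA, derivative_eq_zero] at h
    lia
  have hB0 : B ≠ 0 := fun h => by rw [h, natDegree_zero] at hlt; lia
  have hF0 : F ≠ 0 := fun h => by rw [h, natDegree_zero] at hFd; lia
  have hAB := natDegree_derivative_mul_sub hA0 hB0 hlt.ne
  rw [← hW] at hAB
  have hE0 : E ≠ 0 := hE ▸ mul_ne_zero (mul_ne_zero hA0 hB0) hF0
  have hEd : E.natDegree = A.natDegree + B.natDegree + B.natDegree := by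
    rw [hE, natDegree_mul (mul_ne_zero hA0 hB0) hF0, natDegree_mul hA0 hB0, hFd]
  have hWE := natDegree_derivative_mul_sub hAB.2 hE0 (by lia)
  rw [← hZ] at hWE
  exact ⟨hAd, hBd, hFd, hA0, hB0, hF0, hWE.2, by lia⟩

theorem nondegenerateOn {P₁ P₂ A B F W E Z : ℝ[X]} {s K Q Θ α β : ℝ}
    (hA : A = derivative P₁) (hB : B = derivative P₂) (hF : F = B - A)
    (hW : W = derivative A * B - A * derivative B) (hE : E = A * B * F)
    (hZ : Z = derivative W * E - W * derivative E)
    (h1 : 1 ≤ P₁.natDegree) (h12 : P₁.natDegree < P₂.natDegree) (hR : 1 ≤ R)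
    (hs : s = R ^ P₁.natDegree / R ^ P₂.natDegree)
    (hT : ∀ G ∈ [A, B, F, derivative A, derivative B], coeffSum G ≤ K)
    (hK : 16 ≤ K) (hα : 0 ≤ α) (hβ : β ≤ 1) (hαβ : K⁻¹ ≤ β - α)
    (hlow : ∀ τ ∈ Set.Icc α β, K⁻¹ ≤ |scaledEval A R τ| ∧ K⁻¹ ≤ |scaledEval B R τ| ∧
      K⁻¹ ≤ |scaledEval F R τ| ∧ K⁻¹ ≤ |scaledEval Z R τ|)
    (hQ : ∀ τ ∈ Set.Icc α β, |P₁.eval (R * τ) / R ^ P₂.natDegree| ≤ Q)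
    (hΘ : ∀ τ ∈ Set.Icc α β, |P₂.eval (R * τ) / R ^ P₂.natDegree| ≤ Θ) :
    NondegenerateOn s K Q Θ α β (fun τ => P₁.eval (R * τ) / R ^ P₂.natDegree)
      (fun τ => P₂.eval (R * τ) / R ^ P₂.natDegree) (scaledEval A R) (scaledEval B R)
      (fun τ => R * (derivative A).eval (R * τ) / R ^ A.natDegree)
      (fun τ => R * (derivative B).eval (R * τ) / R ^ B.natDegree)
      (fun τ => R * (R * (derivative W).eval (R * τ)) / R ^ (A.natDegree + B.natDegree))
      (fun τ => R * (derivative E).eval (R * τ) / R ^ E.natDegree) := by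
  have hR0 : 0 < R := by linarith
  have hR0' := hR0.ne'
  obtain ⟨hAd, hBd, hFd, hA0, hB0, hF0, -, hZd⟩ :=
    natDegree_curvature hA hB hF hW hE hZ h1 h12
  have he : ∀ τ, scaledEval B R τ - s * scaledEval A R τ = scaledEval F R τ := fun τ => by
    have e1 : scaledEval F R τ = B.eval (R * τ) / R ^ B.natDegree -
        A.eval (R * τ) / R ^ B.natDegree := by
      rw [scaledEval, hFd, hF, eval_sub, sub_div]
    rw [e1, scaledEval, scaledEval, hs, hAd, hBd]
    congr 1
    field_simp
    ring
  have hEe : ∀ τ, scaledEval A R τ * scaledEval B R τ * scaledEval F R τ =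
      scaledEval E R τ := fun τ => by
    rw [hE, scaledEval_mul (mul_ne_zero hA0 hB0) hF0, scaledEval_mul hA0 hB0]
  have hWe : ∀ τ, R * (derivative A).eval (R * τ) / R ^ A.natDegree * scaledEval B R τ -
      scaledEval A R τ * (R * (derivative B).eval (R * τ) / R ^ B.natDegree) =
      R * (W.eval (R * τ) / R ^ (A.natDegree + B.natDegree)) := fun τ => by
    rw [hW, eval_sub, eval_mul, eval_mul, scaledEval, scaledEval, pow_add]
    field_simp
  have I01 : ∀ τ ∈ Set.Icc α β, τ ∈ Set.Icc (0 : ℝ) 1 := fun τ hτ =>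
    ⟨hα.trans hτ.1, hτ.2.trans hβ⟩
  refine ⟨hs ▸ by positivity, ?_, hK, hα, hβ, hαβ, fun τ => ?_, fun τ => ?_,
    fun τ => hasDerivAt_eval_mul_div A R _ τ, fun τ => hasDerivAt_eval_mul_div B R _ τ,
    fun τ => ?_, fun τ => ?_,
    fun τ hτ => (abs_scaledEval_le A hR (I01 τ hτ)).trans (hT A (by simp)),
    fun τ hτ => (abs_scaledEval_le B hR (I01 τ hτ)).trans (hT B (by simp)),
    fun τ hτ => ?_,
    fun τ hτ => (abs_scaledEval_deriv_le A hR (I01 τ hτ)).trans (hT _ (by simp)),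
    fun τ hτ => (abs_scaledEval_deriv_le B hR (I01 τ hτ)).trans (hT _ (by simp)),
    fun τ hτ => (hlow τ hτ).1, fun τ hτ => (hlow τ hτ).2.1, fun τ hτ => ?_, fun τ hτ => ?_,
    hQ, hΘ⟩
  · rw [hs]
    exact div_le_one_of_le₀ (pow_le_pow_right₀ hR h12.le) (by positivity)
  · refine (hasDerivAt_eval_mul_div P₁ R _ τ).congr_deriv ?_
    rw [hs, scaledEval, ← hA, hAd, hBd]
    field_simp
    ring
  · refine (hasDerivAt_eval_mul_div P₂ R _ τ).congr_deriv ?_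
    rw [scaledEval, ← hB, hBd, pow_succ]
    field_simp
  · simp only [hWe]
    refine ((hasDerivAt_eval_mul_div W R _ τ).const_mul R).congr_deriv ?_
    ring
  · simp only [he, hEe]
    exact hasDerivAt_eval_mul_div E R _ τ
  · rw [he]
    exact (abs_scaledEval_le F hR (I01 τ hτ)).trans (hT F (by simp))
  · rw [he]; exact (hlow τ hτ).2.2.1
  · refine (hlow τ hτ).2.2.2.trans_eq ?_
    congr 1
    rw [he, hEe, hWe, scaledEval, scaledEval]
    have e2 : R ^ (A.natDegree + B.natDegree) * R ^ E.natDegree = R ^ Z.natDegree * R ^ 2 := by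
      rw [← pow_add, ← pow_add, hZd]
    have e3 : ∀ x y z t : ℝ, R * (R * x) / R ^ (A.natDegree + B.natDegree) *
        (y / R ^ E.natDegree) - R * (z / R ^ (A.natDegree + B.natDegree)) *
        (R * t / R ^ E.natDegree) =
        R ^ 2 * (x * y - z * t) / (R ^ (A.natDegree + B.natDegree) * R ^ E.natDegree) :=
      fun x y z t => by field_simp
    rw [e3, e2, hZ, eval_sub, eval_mul, eval_mul, mul_comm (R ^ 2),
      mul_div_mul_right _ _ (pow_ne_zero 2 hR0')]

end Polynomial

/-- Arcs of polynomial curves at every scale, with polynomial dependence on the scale. -/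
theorem Polynomial.exists_isArc (P₁ P₂ : ℝ[X]) (h1 : 1 ≤ P₁.natDegree)
    (h12 : P₁.natDegree < P₂.natDegree) (h01 : P₁.eval 0 = 0) (h02 : P₂.eval 0 = 0) :
    ∃ C : ℕ, ∀ R : ℝ, 1 ≤ R → ∀ n : ℕ, ∃ (q p ν w : ℝ → ℝ) (U : Set ℝ),
      IsArc (R ^ P₁.natDegree / R ^ P₂.natDegree) (2 ^ (C * (n + 1)))
        (R ^ P₁.natDegree / R ^ P₂.natDegree * (2 ^ C * (2 ^ n)⁻¹)) (2 ^ C * (2 ^ n)⁻¹)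
        (fun τ => P₁.eval (R * τ) / R ^ P₂.natDegree)
        (fun τ => P₂.eval (R * τ) / R ^ P₂.natDegree) q p ν w U := by
  obtain ⟨A, hA⟩ : ∃ A, A = derivative P₁ := ⟨_, rfl⟩
  obtain ⟨B, hB⟩ : ∃ B, B = derivative P₂ := ⟨_, rfl⟩
  obtain ⟨F, hF⟩ : ∃ F, F = B - A := ⟨_, rfl⟩
  obtain ⟨W, hW⟩ : ∃ W, W = derivative A * B - A * derivative B := ⟨_, rfl⟩
  obtain ⟨E, hE⟩ : ∃ E, E = A * B * F := ⟨_, rfl⟩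
  obtain ⟨Z, hZ⟩ : ∃ Z, Z = derivative W * E - W * derivative E := ⟨_, rfl⟩
  obtain ⟨-, -, -, hA0, hB0, hF0, hZ0, -⟩ := natDegree_curvature hA hB hF hW hE hZ h1 h12
  obtain ⟨Y, hY⟩ : ∃ Y, Y = A * B * F * Z := ⟨_, rfl⟩
  have hY0 : Y ≠ 0 := hY ▸ mul_ne_zero (mul_ne_zero (mul_ne_zero hA0 hB0) hF0) hZ0
  have hYe : ∀ R τ, scaledEval Y R τ =
      scaledEval A R τ * scaledEval B R τ * scaledEval F R τ * scaledEval Z R τ := fun R τ => by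
    rw [hY, scaledEval_mul (mul_ne_zero (mul_ne_zero hA0 hB0) hF0) hZ0,
      scaledEval_mul (mul_ne_zero hA0 hB0) hF0, scaledEval_mul hA0 hB0]
  set l := |Y.leadingCoeff| with hl
  have hl0 : 0 < l := abs_pos.2 (leadingCoeff_ne_zero.2 hY0)
  set D := Y.natDegree with hD
  set T : ℝ := 16 + ([A, B, F, derivative A, derivative B, Z, P₁.divX, P₂.divX].map coeffSum).sum
    with hTdef
  have hT : ∀ G ∈ [A, B, F, derivative A, derivative B, Z, P₁.divX, P₂.divX], coeffSum G ≤ T :=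
    fun G hG => by
      have := List.single_le_sum (l := [A, B, F, derivative A, derivative B, Z, P₁.divX,
        P₂.divX].map coeffSum) (fun x hx => by
          obtain ⟨G, -, rfl⟩ := List.mem_map.1 hx
          exact coeffSum_nonneg G) _ (List.mem_map_of_mem hG)
      linarith
  have hT16 : 16 ≤ T := by
    have : 0 ≤ ([A, B, F, derivative A, derivative B, Z, P₁.divX, P₂.divX].map coeffSum).sum :=
      List.sum_nonneg fun x hx => by
        obtain ⟨G, -, rfl⟩ := List.mem_map.1 hx
        exact coeffSum_nonneg G
    linarith
  have hT0 : 0 < T := by linarith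
  set x : ℝ := T ^ 3 * (3 * (D + 1)) ^ D / l with hx
  have hx0 : 0 ≤ x := by positivity
  obtain ⟨c, hc⟩ := pow_unbounded_of_one_lt (T + 3 * (D + 1) + x) (one_lt_two (α := ℝ))
  have hD0 : (0 : ℝ) ≤ D := Nat.cast_nonneg D
  refine ⟨12 * (c + D + 1), fun R hR n => ?_⟩
  set K : ℝ := 2 ^ ((c + D + 1) * (n + 1)) with hKdef
  have hpow : ∀ i : ℕ, i ≤ (c + D + 1) * (n + 1) → (2 : ℝ) ^ i ≤ K := fun i hi =>
    pow_le_pow_right₀ one_le_two hi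
  have hcK : (2 : ℝ) ^ c ≤ K := hpow c (by nlinarith)
  have hK0 : 0 < K := by positivity
  have hTK : T ≤ K := by linarith
  have h2n : (0 : ℝ) < 2 ^ n := by positivity
  set η : ℝ := ((2 : ℝ) ^ n)⁻¹ / (3 * (D + 1)) with hη
  have hη0 : 0 < η := by positivity
  have hηK : K⁻¹ ≤ η := by
    have e : η = ((2 : ℝ) ^ n * (3 * (D + 1)))⁻¹ := by rw [hη, mul_inv, div_eq_mul_inv]
    rw [e]
    refine inv_anti₀ (by positivity) ?_
    calc (2 : ℝ) ^ n * (3 * (D + 1)) ≤ 2 ^ n * 2 ^ c := by gcongr; linarith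
      _ = 2 ^ (n + c) := (pow_add _ _ _).symm
      _ ≤ K := hpow _ (by nlinarith)
  obtain ⟨α, β, hα, hβ, hαβ, hlow⟩ := exists_interval_le_abs_eval Y hR hη0
    (show 3 * η * (Y.natDegree + 1) ≤ (2 ^ n)⁻¹ by
      rw [← hD, hη]; apply le_of_eq; field_simp)
  have hβ1 : β ≤ 1 := hβ.trans (inv_le_one_of_one_le₀ (one_le_pow₀ one_le_two))
  have I01 : ∀ τ ∈ Set.Icc α β, τ ∈ Set.Icc (0 : ℝ) 1 := fun τ hτ =>
    ⟨hα.trans hτ.1, hτ.2.trans hβ1⟩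
  have hκ : K⁻¹ * T ^ 3 ≤ l * η ^ D := by
    rw [inv_mul_le_iff₀ hK0]
    have e1 : T ^ 3 = x * l / (3 * (D + 1)) ^ D := by rw [hx]; field_simp
    have e2 : K * (l * η ^ D) = K * ((2 ^ n) ^ D)⁻¹ * l / (3 * (D + 1)) ^ D := by
      rw [hη, div_pow, inv_pow]; ring
    rw [e1, e2]
    have e3 : x ≤ K * ((2 ^ n) ^ D)⁻¹ := by
      rw [le_mul_inv_iff₀ (by positivity)]
      calc x * (2 ^ n) ^ D ≤ 2 ^ c * (2 ^ n) ^ D := by gcongr; linarith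
        _ = 2 ^ (c + n * D) := by rw [← pow_mul, pow_add]
        _ ≤ K := hpow _ (by nlinarith)
    gcongr
  have hτC : ∀ τ ∈ Set.Icc α β, T * τ ≤ 2 ^ (12 * (c + D + 1)) * (2 ^ n)⁻¹ := fun τ hτ => by
    have e1 : (2 : ℝ) ^ c ≤ 2 ^ (12 * (c + D + 1)) := pow_le_pow_right₀ one_le_two (by lia)
    exact mul_le_mul (by linarith) (hτ.2.trans hβ) (I01 τ hτ).1 (by positivity)
  have hP : ∀ P : ℝ[X], coeffSum P.divX ≤ T → P.eval 0 = 0 → 1 ≤ P.natDegree → ∀ τ ∈ Set.Icc α β,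
      |P.eval (R * τ) / R ^ P₂.natDegree| ≤ R ^ P.natDegree / R ^ P₂.natDegree *
        (2 ^ (12 * (c + D + 1)) * (2 ^ n)⁻¹) := fun P hPT hP0 hPd τ hτ => by
    have hpos : 0 < R ^ P₂.natDegree := by positivity
    have e1 := abs_eval_le_mul P hP0 hPd hR (I01 τ hτ)
    have e2 : coeffSum P.divX * τ ≤ 2 ^ (12 * (c + D + 1)) * (2 ^ n)⁻¹ :=
      (mul_le_mul_of_nonneg_right hPT (I01 τ hτ).1).trans (hτC τ hτ)
    rw [abs_div, abs_of_pos hpos, div_mul_eq_mul_div, div_le_div_iff_of_pos_right hpos, mul_comm]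
    rw [mul_comm] at e1
    exact e1.trans (by rw [mul_comm (R ^ _)]; gcongr)
  have H := nondegenerateOn hA hB hF hW hE hZ h1 h12 hR rfl (s := R ^ P₁.natDegree /
    R ^ P₂.natDegree) (K := K) (Q := R ^ P₁.natDegree / R ^ P₂.natDegree *
    (2 ^ (12 * (c + D + 1)) * (2 ^ n)⁻¹)) (Θ := 2 ^ (12 * (c + D + 1)) * (2 ^ n)⁻¹)
    (fun G hG => (hT G (by simp only [List.mem_cons] at hG ⊢; tauto)).trans hTK)
    (by linarith) hα hβ1 (by rw [hαβ]; exact hηK) (fun τ hτ => ?_)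
    (fun τ hτ => hP P₁ (hT _ (by simp)) h01 h1 τ hτ)
    (fun τ hτ => ?_)
  · have := H.exists_isArc
    rwa [hKdef, ← pow_mul, show (c + D + 1) * (n + 1) * 12 = 12 * (c + D + 1) * (n + 1) by ring]
      at this
  · refine le_abs_of_le_abs_mul
      ((abs_scaledEval_le A hR (I01 τ hτ)).trans (hT A (by simp)))
      ((abs_scaledEval_le B hR (I01 τ hτ)).trans (hT B (by simp)))
      ((abs_scaledEval_le F hR (I01 τ hτ)).trans (hT F (by simp)))
      ((abs_scaledEval_le Z hR (I01 τ hτ)).trans (hT Z (by simp))) ?_ hT0 hκ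
    have hpos : 0 < R ^ D := by positivity
    rw [← hYe, scaledEval, abs_div, ← hD, abs_of_pos hpos, le_div_iff₀ hpos]
    exact hlow τ hτ
  · have := hP P₂ (hT _ (by simp)) h02 (by lia) τ hτ
    rwa [div_self (by positivity), one_mul] at this

/-- A rapidly growing sequence of dyadic scales. -/
def scaleSeq (A b : ℕ) : ℕ → ℕ
  | 0 => 0
  | t + 1 => A * (scaleSeq A b t + b)

lemma scaleSeq_le_succ {A b : ℕ} (hA : 1 ≤ A) (t : ℕ) : scaleSeq A b t ≤ scaleSeq A b (t + 1) := by
  rw [scaleSeq]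
  nlinarith [Nat.zero_le b, Nat.zero_le (scaleSeq A b t)]

lemma monotone_scaleSeq {A b : ℕ} (hA : 1 ≤ A) : Monotone (scaleSeq A b) :=
  monotone_nat_of_le_succ (scaleSeq_le_succ hA)

lemma exists_small_increments {E : ℕ → ℝ} (hE : Monotone E) (hE01 : ∀ n, E n ∈ Set.Icc (0 : ℝ) 1)
    {m : ℕ → ℕ} (hm : Monotone m) (a : ℕ) {η : ℝ} {T : ℕ} (hT : 2 ≤ T * η) :
    ∃ t < T, E (a + m (t + 1)) - E (a + m t) ≤ η ∧ E (m (t + 1)) - E (m t) ≤ η := by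
  by_contra! H
  have hT0 : T ≠ 0 := by rintro rfl; norm_num at hT
  have h1 : ∀ t, E (m t) ≤ E (m (t + 1)) := fun t => hE (hm t.le_succ)
  have h2 : ∀ t, E (a + m t) ≤ E (a + m (t + 1)) := fun t =>
    hE (Nat.add_le_add_left (hm t.le_succ) a)
  have h3 : ∑ _t ∈ Finset.range T, η < ∑ t ∈ Finset.range T,
      ((E (a + m (t + 1)) + E (m (t + 1))) - (E (a + m t) + E (m t))) := by
    refine Finset.sum_lt_sum_of_nonempty (Finset.nonempty_range_iff.2 hT0) fun t ht => ?_
    by_cases h : E (a + m (t + 1)) - E (a + m t) ≤ η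
    · linarith [H t (Finset.mem_range.1 ht) h, h2 t]
    · linarith [h1 t]
  rw [Finset.sum_range_sub (fun t => E (a + m t) + E (m t))] at h3
  simp only [Finset.sum_const, Finset.card_range, nsmul_eq_mul] at h3
  linarith [(hE01 (a + m T)).2, (hE01 (m T)).2, (hE01 (a + m 0)).1, (hE01 (m 0)).1]

lemma measurable_integral_mul_add_mul_add {f : ℝ → ℝ} (mf : Measurable f) :
    Measurable (Function.uncurry fun x y => ∫ z, f z * f (z + x) * f (z + y)) := by
  have : StronglyMeasurable fun P : (ℝ × ℝ) × ℝ => f P.2 * f (P.2 + P.1.1) * f (P.2 + P.1.2) := by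
    refine Measurable.stronglyMeasurable ?_
    fun_prop
  exact this.integral_prod_right.measurable

lemma integral_mul_add_mul_add_mem_Icc {f : ℝ → ℝ} (f0 : ∀ x, 0 ≤ f x)
    (f1 : ∀ x, f x ≤ 1) (hs : ∀ x, x ∉ Set.Icc (0 : ℝ) 1 → f x = 0) (x y : ℝ) :
    ∫ z, f z * f (z + x) * f (z + y) ∈ Set.Icc (0 : ℝ) 1 := by
  have h0 : ∀ z, 0 ≤ f z * f (z + x) * f (z + y) := fun z =>
    mul_nonneg (mul_nonneg (f0 _) (f0 _)) (f0 _)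
  refine ⟨integral_nonneg h0, ?_⟩
  have := abs_integral_le_of_bounded_support (μ := volume) (S := Set.Icc (0 : ℝ) 1) (C := 1)
    (f := fun z => f z * f (z + x) * f (z + y)) (by simp) (fun z hz => by simp [hs z hz])
    fun z => by
      rw [abs_of_nonneg (h0 z)]
      exact mul_le_one₀ (mul_le_one₀ (f1 _) (f0 _) (f1 _)) (f0 _) (f1 _)
  simpa using (le_abs_self _).trans this

section
variable {f P₁ P₂ : ℝ → ℝ} {s κ : ℝ} {C b T : ℕ}

/-- The normalised counting estimate. -/
theorem inv_two_pow_lt_integral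
    (hP : ∀ n : ℕ, ∃ q p ν w U, IsArc s (2 ^ (C * (n + 1))) (s * (2 ^ C * (2 ^ n)⁻¹))
      (2 ^ C * (2 ^ n)⁻¹) P₁ P₂ q p ν w U)
    (mf : Measurable f) (f0 : ∀ x, 0 ≤ f x) (f1 : ∀ x, f x ≤ 1)
    (hs : ∀ x, x ∉ Set.Icc (0 : ℝ) 1 → f x = 0) (hκ2 : κ ≤ 1 / 2)
    (hb : 1 ≤ b) (hbκ : (2 ^ b)⁻¹ ≤ κ) (hT : 2 ≤ T * κ ^ 2) (hf : 16 * κ ≤ (∫ x, f x) ^ 3) :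
    (2 ^ scaleSeq (151 + 61 * C * (C + 3)) b T)⁻¹ <
      ∫ τ in Set.Icc (0 : ℝ) 1, ∫ z, f z * f (z + P₁ τ) * f (z + P₂ τ) := by
  have hκ : 0 < κ := lt_of_lt_of_le (by positivity) hbκ
  have hA : 1 ≤ 151 + 61 * C * (C + 3) := by lia
  obtain ⟨_, _, _, _, _, h0⟩ := hP 0
  have hs0 := h0.data.s_pos
  obtain ⟨a, ha1, ha2⟩ := exists_nat_pow_near ((one_le_inv₀ hs0).2 h0.data.s_le_one)
    (one_lt_two : (1 : ℝ) < 2)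
  have ha1' : 2 ^ a * s ≤ 1 := by
    have := mul_le_mul_of_nonneg_right ha1 hs0.le
    rwa [inv_mul_cancel₀ hs0.ne'] at this
  have ha2' : ((2 : ℝ) ^ (a + 1))⁻¹ ≤ s := inv_le_of_inv_le₀ hs0 ha2.le
  have hE : Monotone fun n => ∫ x, dyadicAvg n f x ^ 2 := fun n m hnm => by
    have := integral_sq_dyadicAvg_sub mf f0 f1 hs hnm
    have h : 0 ≤ ∫ t, (dyadicAvg m f t - dyadicAvg n f t) ^ 2 :=
      integral_nonneg fun t => sq_nonneg _
    simp only
    linarith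
  obtain ⟨t, htT, e1, e2⟩ := exists_small_increments hE
    (fun n => integral_sq_dyadicAvg_mem_Icc mf f0 f1 hs)
    (monotone_scaleSeq (b := b) hA) a hT
  have hkl := scaleSeq_le_succ (b := b) hA t
  have hlT := monotone_scaleSeq (b := b) hA htT
  simp only [Nat.succ_eq_add_one] at hlT
  obtain ⟨k, hk⟩ : ∃ k, k = scaleSeq (151 + 61 * C * (C + 3)) b t := ⟨_, rfl⟩
  obtain ⟨l, hl⟩ : ∃ l, l = scaleSeq (151 + 61 * C * (C + 3)) b (t + 1) := ⟨_, rfl⟩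
  have hlk : 123 + 28 * b + 61 * (C * (C + k + 1 + b + 1)) ≤ l := by
    rw [hl, scaleSeq, ← hk]
    have : C * (C + k + 1 + b + 1) ≤ C * ((C + 3) * (k + b)) := by
      refine Nat.mul_le_mul_left C ?_
      nlinarith [Nat.zero_le C, Nat.zero_le k]
    nlinarith
  rw [← hk, ← hl] at e1 e2 hkl
  rw [← hl] at hlT
  obtain ⟨q, p, ν, w, U, h⟩ := hP (C + k + 1 + b)
  obtain ⟨A, hAdef⟩ : ∃ A, A = C * (C + k + 1 + b + 1) := ⟨_, rfl⟩
  rw [← hAdef] at h hlk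
  have hΘ : (2 : ℝ) ^ C * (2 ^ (C + k + 1 + b))⁻¹ = (2 ^ (k + 1))⁻¹ * (2 ^ b)⁻¹ := by
    rw [show C + k + 1 + b = C + ((k + 1) + b) by ring, pow_add, pow_add, mul_inv, mul_inv,
      mul_inv_cancel_left₀ (by positivity)]
  rw [hΘ] at h
  have hΘκ : (2 : ℝ) ^ (k + 1) * ((2 ^ (k + 1))⁻¹ * (2 ^ b)⁻¹) ≤ κ := by
    rwa [mul_inv_cancel_left₀ (by positivity)]
  have hM := h.mass
  have hM0 : (0 : ℝ) < 2 ^ A := by positivity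
  have hW : 0 < ∫ u, w u := lt_of_lt_of_le (by positivity) hM
  have hκW : ((2 : ℝ) ^ (b + A))⁻¹ ≤ κ * ∫ u, w u := by
    rw [pow_add, mul_inv]
    exact mul_le_mul hbκ hM (by positivity) hκ.le
  have key := le_tri h.data h.cutoff (i := a + k) (j := a + l) (k := k) (l := l) (κ := κ)
    (mul_le_one₀ (inv_le_one_of_one_le₀ (one_le_pow₀ one_le_two)) (by positivity)
      (inv_le_one_of_one_le₀ (one_le_pow₀ one_le_two))) h.abs_le h.abs_q_le hW mf f0 f1 hs
    hκ hκ2 (by lia) hkl (by lia)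
    (by
      refine le_trans ?_ hΘκ
      rw [show a + k + 1 = a + (k + 1) by ring, pow_add]
      have : (0 : ℝ) ≤ 2 ^ (k + 1) * ((2 ^ (k + 1))⁻¹ * (2 ^ b)⁻¹) := by positivity
      nlinarith)
    hΘκ e1 e2
    (by
      calc (2 : ℝ) * (2 ^ (a + l))⁻¹ * (2 ^ 121 * (2 ^ A) ^ 33)
          ≤ (2 ^ (a + 1))⁻¹ * ((2 ^ (b + A))⁻¹) ^ 28 := by
            rw [inv_pow, ← pow_mul, ← pow_mul, ← pow_add, ← mul_inv, ← pow_add,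
              mul_right_comm, ← pow_succ', ← div_eq_mul_inv,
              div_le_iff₀ (by positivity), ← div_eq_inv_mul, le_div_iff₀ (by positivity), ← pow_add]
            exact pow_le_pow_right₀ one_le_two (by lia)
        _ ≤ _ := by gcongr)
    (by
      refine le_trans ?_ hκW
      rw [← mul_assoc, ← div_eq_mul_inv, div_le_iff₀ (by positivity), ← div_eq_inv_mul,
        le_div_iff₀ (by positivity), ← pow_succ', ← pow_succ, ← pow_add]
      exact pow_le_pow_right₀ one_le_two (by lia))
  have hmem := integral_mul_add_mul_add_mem_Icc f0 f1 hs
  have tr := h.transfer _ (measurable_integral_mul_add_mul_add mf) (fun x y => (hmem x y).1)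
    fun x y => (hmem x y).2
  rw [tri] at key
  have low : 8 * (2 ^ (b + A))⁻¹ ≤
      2 ^ A * ∫ τ in Set.Icc (0 : ℝ) 1, ∫ z, f z * f (z + P₁ τ) * f (z + P₂ τ) := by
    nlinarith
  refine lt_of_mul_lt_mul_left (lt_of_lt_of_le ?_ low) hM0.le
  rw [← div_eq_mul_inv, div_lt_iff₀ (by positivity), mul_assoc, ← div_eq_inv_mul,
    ← mul_div_assoc, lt_div_iff₀ (by positivity), ← pow_add, show (8 : ℝ) = 2 ^ 3 by norm_num,
    ← pow_add]
  exact pow_lt_pow_right₀ one_lt_two (by lia)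

end

lemma scaleSeq_add_le {A b : ℕ} (hA : 1 ≤ A) (t : ℕ) :
    scaleSeq A b t + b ≤ (2 * A) ^ t * b := by
  induction t with
  | zero => simp [scaleSeq]
  | succ t ih =>
    have h : b ≤ A * (scaleSeq A b t + b) := by nlinarith [Nat.zero_le (scaleSeq A b t)]
    calc A * (scaleSeq A b t + b) + b ≤ 2 * A * (scaleSeq A b t + b) := by lia
      _ ≤ 2 * A * ((2 * A) ^ t * b) := Nat.mul_le_mul_left _ ih
      _ = (2 * A) ^ (t + 1) * b := by ring

lemma exp_neg_exp_le_inv_two_pow {A b T : ℕ} {x : ℝ} (hA : 1 ≤ A) (hb : b ≤ 17 * x)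
    (hT : T ≤ 513 * x) :
    Real.exp (-Real.exp ((17 + 513 * Real.log (2 * A)) * x)) ≤ (2 ^ scaleSeq A b T)⁻¹ := by
  have hA' : (1 : ℝ) ≤ A := by exact_mod_cast hA
  have h1 : (scaleSeq A b T : ℝ) ≤ (2 * A) ^ T * b := by
    exact_mod_cast (Nat.le_add_right _ b).trans (scaleSeq_add_le hA T)
  have h2 : (2 * A : ℝ) ^ T ≤ Real.exp (513 * Real.log (2 * A) * x) := by
    rw [← Real.exp_log (by positivity : (0 : ℝ) < (2 * A) ^ T), Real.log_pow]
    refine Real.exp_le_exp.2 ?_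
    have := mul_le_mul_of_nonneg_right hT (Real.log_nonneg (by linarith : (1 : ℝ) ≤ 2 * A))
    linarith
  have h3 : (b : ℝ) ≤ Real.exp (17 * x) := by linarith [Real.add_one_le_exp (17 * x)]
  have h4 : (scaleSeq A b T : ℝ) ≤ Real.exp ((17 + 513 * Real.log (2 * A)) * x) := by
    rw [add_mul, add_comm, Real.exp_add]
    exact h1.trans (mul_le_mul h2 h3 (by positivity) (by positivity))
  have h5 : (2 : ℝ) ^ scaleSeq A b T ≤ Real.exp (scaleSeq A b T) := by
    rw [← mul_one (scaleSeq A b T : ℝ), Real.exp_nat_mul]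
    exact pow_le_pow_left₀ zero_le_two (by linarith [Real.add_one_le_exp (1 : ℝ)]) _
  rw [Real.exp_neg]
  exact inv_anti₀ (by positivity) (h5.trans (Real.exp_le_exp.2 h4))

lemma setIntegral_setIntegral_eq_rescaled {f p₁ p₂ : ℝ → ℝ} {N R : ℝ} (hN : 0 < N) (hR : 0 < R)
    (mf : Measurable f) (f0 : ∀ x, 0 ≤ f x) (f1 : ∀ x, f x ≤ 1)
    (hs : ∀ x, x ∉ Set.Icc 0 N → f x = 0) (m₁ : Measurable p₁) (m₂ : Measurable p₂) :
    ∫ x in Set.Icc 0 N, ∫ t in Set.Icc 0 R, f x * f (x + p₁ t) * f (x + p₂ t) =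
      N * R * ∫ τ in Set.Icc (0 : ℝ) 1, ∫ z, f (N * z) * f (N * (z + p₁ (R * τ) / N)) *
        f (N * (z + p₂ (R * τ) / N)) := by
  have hinner : ∀ t, ∫ x in Set.Icc 0 N, f x * f (x + p₁ t) * f (x + p₂ t) =
      N * ∫ z, f (N * z) * f (N * (z + p₁ t / N)) * f (N * (z + p₂ t / N)) := fun t => by
    rw [setIntegral_eq_integral_of_forall_compl_eq_zero fun x hx => by simp [hs x hx]]
    have := Measure.integral_comp_mul_left (fun x => f x * f (x + p₁ t) * f (x + p₂ t)) N
    simp only [mul_add, mul_div_cancel₀ _ hN.ne', smul_eq_mul] at this ⊢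
    rw [this, abs_of_pos (inv_pos.2 hN), mul_inv_cancel_left₀ hN.ne']
  rw [integral_integral_swap]
  · simp_rw [hinner]
    rw [integral_const_mul, integral_Icc_eq_integral_Ioc, integral_Icc_eq_integral_Ioc,
      ← intervalIntegral.integral_of_le hR.le, ← intervalIntegral.integral_of_le zero_le_one,
      intervalIntegral.integral_comp_mul_left (fun t =>
        ∫ z, f (N * z) * f (N * (z + p₁ t / N)) * f (N * (z + p₂ t / N))) hR.ne', mul_zero,
      mul_one, smul_eq_mul, mul_assoc, mul_inv_cancel_left₀ hR.ne']
  · have hm : Measurable (Function.uncurry fun x t => f x * f (x + p₁ t) * f (x + p₂ t)) := by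
      unfold Function.uncurry
      fun_prop
    refine Integrable.of_bound hm.aestronglyMeasurable 1 (Filter.Eventually.of_forall fun y => ?_)
    rw [Function.uncurry, Real.norm_of_nonneg (mul_nonneg (mul_nonneg (f0 _) (f0 _)) (f0 _))]
    exact mul_le_one₀ (mul_le_one₀ (f1 _) (f0 _) (f1 _)) (f0 _) (f1 _)

/-- the integral lower bound implying Theorem 1.  For polynomials `P₁, P₂`
with `1 ≤ deg P₁ < deg P₂ = d₂` and `P₁(0) = P₂(0) = 0`, there is `c > 0` depending only on
`P₁, P₂` such that for every `ε > 0` there is `δ ≥ exp(−exp(c ε⁻⁶))` such that for every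
`N > 1` and every measurable `f` with `supp f ⊆ [0, N]`, `0 ≤ f ≤ 1` and `∫₀^N f ≥ εN`, one
has `∫₀^N ∫₀^{N^{1/d₂}} f(x) f(x+P₁(t)) f(x+P₂(t)) dt dx > δ N^{1+1/d₂}`. -/
theorem stmt4 (P₁ P₂ : Polynomial ℝ)
    (hdeg₁ : 1 ≤ P₁.natDegree) (hdeg₁₂ : P₁.natDegree < P₂.natDegree)
    (h01 : P₁.eval 0 = 0) (h02 : P₂.eval 0 = 0) :
    ∃ c : ℝ, 0 < c ∧ ∀ ε : ℝ, 0 < ε → ∃ δ : ℝ, 0 < δ ∧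
      Real.exp (-Real.exp (c * ε ^ (-6 : ℝ))) ≤ δ ∧
      ∀ N : ℝ, 1 < N → ∀ f : ℝ → ℝ, Measurable f →
        Function.support f ⊆ Set.Icc 0 N →
        (∀ x, 0 ≤ f x) → (∀ x, f x ≤ 1) →
        ε * N ≤ ∫ x in Set.Icc (0:ℝ) N, f x →
        δ * N ^ (1 + (P₂.natDegree : ℝ)⁻¹) <
          ∫ x in Set.Icc (0:ℝ) N,
            ∫ t in Set.Icc (0:ℝ) (N ^ ((P₂.natDegree : ℝ)⁻¹)),
              f x * f (x + P₁.eval t) * f (x + P₂.eval t) := by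
  obtain ⟨C, hC⟩ := Polynomial.exists_isArc P₁ P₂ hdeg₁ hdeg₁₂ h01 h02
  set d₁ := P₁.natDegree
  set d := P₂.natDegree with hd
  have hd0 : d ≠ 0 := by lia
  set A : ℕ := 151 + 61 * C * (C + 3) with hA
  have hA1 : 1 ≤ A := by lia
  have hA' : (1 : ℝ) ≤ A := by exact_mod_cast hA1
  refine ⟨17 + 513 * Real.log (2 * A), by
    linarith [Real.log_nonneg (by linarith : (1 : ℝ) ≤ 2 * A)], fun ε hε => ⟨_, Real.exp_pos _, le_rfl,
    fun N hN f mf hsupp f0 f1 hf => ?_⟩⟩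
  have hN0 : 0 < N := by linarith
  have hs : ∀ x, x ∉ Set.Icc 0 N → f x = 0 := fun x hx => by
    by_contra h
    exact hx (hsupp h)
  set g : ℝ → ℝ := fun x => f (N * x) with hg
  have mg : Measurable g := by fun_prop
  have sg : ∀ x, x ∉ Set.Icc (0 : ℝ) 1 → g x = 0 := fun x hx => hs _ fun h => hx
    ⟨nonneg_of_mul_nonneg_right h.1 hN0, by nlinarith [h.2]⟩
  have ig : ε ≤ ∫ x, g x := by
    rw [Measure.integral_comp_mul_left f N, abs_of_pos (inv_pos.2 hN0), smul_eq_mul,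
      ← div_eq_inv_mul, le_div_iff₀ hN0, ← setIntegral_eq_integral_of_forall_compl_eq_zero hs]
    exact hf
  have ε1 : ε ≤ 1 := by
    have := abs_integral_le_of_bounded_support (μ := volume) (S := Set.Icc (0 : ℝ) 1) (C := 1)
      (by simp) sg fun x => by rw [abs_of_nonneg (f0 _)]; exact f1 _
    exact ig.trans ((le_abs_self _).trans (by simpa using this))
  have hε3 : ε ^ 3 ≤ 1 := pow_le_one₀ hε.le ε1
  have hε36 : (ε ^ 3)⁻¹ ≤ (ε ^ 6)⁻¹ :=
    inv_anti₀ (by positivity) (pow_le_pow_of_le_one hε.le ε1 (by norm_num))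
  have hε6 : 1 ≤ (ε ^ 6)⁻¹ := (one_le_inv₀ (by positivity)).2 (pow_le_one₀ hε.le ε1)
  have hεpow : ε ^ (-6 : ℝ) = (ε ^ 6)⁻¹ := by
    rw [Real.rpow_neg hε.le]
    norm_cast
  set R : ℝ := N ^ ((d : ℝ)⁻¹) with hR
  have hR1 : 1 ≤ R := Real.one_le_rpow hN.le (by positivity)
  have hRN : R ^ d = N := Real.rpow_inv_natCast_pow hN0.le hd0
  set b := ⌈16 * (ε ^ 3)⁻¹⌉₊ with hb
  set T := ⌈512 * (ε ^ 6)⁻¹⌉₊ with hT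
  have hb0 : 16 * (ε ^ 3)⁻¹ ≤ b := Nat.le_ceil _
  have hb17 : (b : ℝ) ≤ 17 * (ε ^ 6)⁻¹ := by
    linarith [Nat.ceil_lt_add_one (by positivity : 0 ≤ 16 * (ε ^ 3)⁻¹)]
  have hT513 : (T : ℝ) ≤ 513 * (ε ^ 6)⁻¹ := by
    linarith [Nat.ceil_lt_add_one (by positivity : 0 ≤ 512 * (ε ^ 6)⁻¹)]
  have main := inv_two_pow_lt_integral (κ := ε ^ 3 / 16) (b := b) (T := T)
    (hC R hR1) mg (fun x => f0 _) (fun x => f1 _) sg (by linarith)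
    (Nat.ceil_pos.2 (by positivity))
    (inv_le_of_inv_le₀ (by positivity) (by
      rw [inv_div, div_eq_mul_inv]
      exact hb0.trans (by exact_mod_cast b.lt_two_pow_self.le)))
    (by
      calc (2 : ℝ) = 512 * (ε ^ 6)⁻¹ * (ε ^ 3 / 16) ^ 2 := by field_simp; norm_num
        _ ≤ _ := by gcongr; exact Nat.le_ceil _)
    (by
      rw [mul_div_cancel₀ _ (by norm_num : (16 : ℝ) ≠ 0)]
      exact pow_le_pow_left₀ hε.le ig 3)
  rw [hεpow, setIntegral_setIntegral_eq_rescaled hN0 (by linarith) mf f0 f1 hs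
    P₁.continuous.measurable P₂.continuous.measurable, Real.rpow_add hN0, Real.rpow_one, mul_comm]
  refine mul_lt_mul_of_pos_left ((exp_neg_exp_le_inv_two_pow hA1 hb17 hT513).trans_lt ?_)
    (by positivity)
  rwa [hRN] at main
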